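/- arXiv:0803.3997 — 2 statements merged into one kernel-verified Lean document; each statement's English description precedes it below -/
import Mathlib

section
/- Let U be a domain in C^n, V an algebraic subvariety of C^m̂, and F : U → V a holomorphic mapping. Then for every x₀ ∈ U there exist an open neighborhood U₀ ⊆ U of x₀ and a sequence (F^ν : U₀ → V) of Nash mappings converging uniformly on U₀ to F|_{U₀}. -/
open Filter Topology

/-- A Nash function on an open set `U ⊆ ℂⁿ`. -/
def NashFn (n : ℕ) (U : Set (Fin n → ℂ)) (f : (Fin n → ℂ) → ℂ) : Prop :=
  DifferentiableOn ℂ f U ∧ ∀ x₀ ∈ U, ∃ V : Set (Fin n → ℂ), IsOpen V ∧ x₀ ∈ V ∧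
    ∃ P : Polynomial (MvPolynomial (Fin n) ℂ), P ≠ 0 ∧
      ∀ x ∈ V ∩ U, Polynomial.eval₂ (MvPolynomial.eval x) (f x) P = 0

/-- An algebraic subvariety of `ℂ^N`: the common zero set of finitely many polynomials. -/
def IsAlgSet (N : ℕ) (V : Set (Fin N → ℂ)) : Prop :=
  ∃ (q : ℕ) (ps : Fin q → MvPolynomial (Fin N) ℂ),
    V = {y | ∀ i, MvPolynomial.eval y (ps i) = 0}

section Presentation

open Polynomial in
/-- A finite family of algebraic elements over a domain of characteristic zero is expressed through
a single element, up to denominators. -/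
theorem exists_common_generator {S k K ι : Type} [CommRing S] [IsDomain S] [CharZero S] [Field k]
    [Algebra S k] [IsFractionRing S k] [Field K] [Algebra S K] [Algebra k K] [IsScalarTower S k K]
    [Finite ι] (F : ι → K) (hF : ∀ i, IsAlgebraic S (F i)) :
    ∃ θ ∈ Algebra.adjoin S (Set.range F), ∀ i, ∃ d : S, d ≠ 0 ∧ ∃ p : S[X],
      d • F i = aeval θ p := by
  have clear : ∀ (X : Set K), ∀ x ∈ Algebra.adjoin k X,
      ∃ d : S, d ≠ 0 ∧ d • x ∈ Algebra.adjoin S X := by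
    intro X x hx
    induction hx using Algebra.adjoin_induction with
    | mem x hx => exact ⟨1, one_ne_zero, by simpa using Algebra.subset_adjoin hx⟩
    | algebraMap r =>
      obtain ⟨a, b, hb, rfl⟩ := IsFractionRing.div_surjective (A := S) r
      have hb' : b ≠ 0 := nonZeroDivisors.ne_zero hb
      refine ⟨b, hb', ?_⟩
      have : b • (algebraMap k K) (algebraMap S k a /
          algebraMap S k b) = algebraMap S K a := by
        rw [map_div₀, ← IsScalarTower.algebraMap_apply, ← IsScalarTower.algebraMap_apply,
          Algebra.smul_def, mul_div_cancel₀]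
        rw [IsScalarTower.algebraMap_apply S k K]
        simpa using hb'
      rw [this]
      exact Subalgebra.algebraMap_mem _ _
    | add x y _ _ hx hy =>
      obtain ⟨d, hd, hdx⟩ := hx
      obtain ⟨e, he, hey⟩ := hy
      refine ⟨d * e, mul_ne_zero hd he, ?_⟩
      have : (d * e) • (x + y) = e • (d • x) + d • (e • y) := by
        simp only [Algebra.smul_def, map_mul]; ring
      rw [this]
      exact add_mem (Subalgebra.smul_mem _ hdx _) (Subalgebra.smul_mem _ hey _)
    | mul x y _ _ hx hy =>
      obtain ⟨d, hd, hdx⟩ := hx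
      obtain ⟨e, he, hey⟩ := hy
      refine ⟨d * e, mul_ne_zero hd he, ?_⟩
      have : (d * e) • (x * y) = (d • x) * (e • y) := by
        simp only [Algebra.smul_def, map_mul]; ring
      rw [this]
      exact mul_mem hdx hey
  have hF' : ∀ i, IsAlgebraic k (F i) := fun i =>
    (hF i).extendScalars (IsFractionRing.injective S k)
  have : FiniteDimensional k
      (IntermediateField.adjoin k (Set.range F)) := by
    apply IntermediateField.finiteDimensional_adjoin
    rintro _ ⟨i, rfl⟩
    exact (hF' i).isIntegral
  have : CharZero k :=
    charZero_of_injective_algebraMap (IsFractionRing.injective S k)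
  obtain ⟨θ₀, hθ₀⟩ := Field.exists_primitive_element k
    (IntermediateField.adjoin k (Set.range F))
  have hmem : ∀ x ∈ IntermediateField.adjoin k (Set.range F),
      x ∈ Algebra.adjoin k ({(θ₀ : K)} : Set K) := by
    intro x hx
    have h1 : (⟨x, hx⟩ : IntermediateField.adjoin k (Set.range F)) ∈
        IntermediateField.adjoin k {θ₀} := by rw [hθ₀]; trivial
    rw [← IntermediateField.mem_toSubalgebra,
      IntermediateField.adjoin_simple_toSubalgebra_of_isAlgebraic
        (Algebra.IsAlgebraic.isAlgebraic θ₀), Algebra.adjoin_singleton_eq_range_aeval] at h1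
    obtain ⟨p, hp⟩ := h1
    rw [Algebra.adjoin_singleton_eq_range_aeval]
    refine ⟨p, ?_⟩
    have := congrArg (Subtype.val) hp
    simpa using this
  have hθ₁ : (θ₀ : K) ∈ Algebra.adjoin k (Set.range F) := by
    have := θ₀.2
    rwa [← IntermediateField.mem_toSubalgebra,
      IntermediateField.adjoin_toSubalgebra_of_isAlgebraic] at this
    rintro _ ⟨i, rfl⟩
    exact hF' i
  obtain ⟨d, hd, hdθ⟩ := clear _ _ hθ₁
  refine ⟨d • (θ₀ : K), hdθ, fun i => ?_⟩
  have h2 : F i ∈ Algebra.adjoin k ({d • (θ₀ : K)} : Set K) := by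
    have h3 := hmem (F i) (IntermediateField.subset_adjoin _ _ ⟨i, rfl⟩)
    refine (Algebra.adjoin_le ?_) h3
    rintro _ rfl
    have h4 : (θ₀ : K) = (algebraMap S k d)⁻¹ • (d • (θ₀ : K)) := by
      rw [← IsScalarTower.algebraMap_smul k d (θ₀ : K), smul_smul,
        inv_mul_cancel₀, one_smul]
      simpa using hd
    have h5 := Subalgebra.smul_mem _ (Algebra.self_mem_adjoin_singleton k (d • (θ₀ : K)))
      (algebraMap S k d)⁻¹
    rwa [← h4] at h5
  obtain ⟨e, he, h5⟩ := clear _ _ h2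
  rw [Algebra.adjoin_singleton_eq_range_aeval] at h5
  obtain ⟨p, hp⟩ := h5
  exact ⟨e, he, p, hp.symm⟩

open Polynomial in
theorem exists_C_mul_dvd_of_minimal {S B : Type} [CommRing S] [IsDomain S] [CommRing B]
    [Algebra S B] (θ : B) (P : S[X]) (hP0 : P ≠ 0) (hP : aeval θ P = 0)
    (hmin : ∀ Q : S[X], aeval θ Q = 0 → Q.natDegree < P.natDegree → Q = 0) (hdeg : 0 < P.natDegree)
    (Q : S[X]) (hQ : aeval θ Q = 0) : ∃ c : S, c ≠ 0 ∧ P ∣ C c * Q := by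
  induction hn : Q.natDegree using Nat.strong_induction_on generalizing Q with
  | _ n ih =>
    by_cases hQP : Q.natDegree < P.natDegree
    · exact ⟨1, one_ne_zero, by rw [hmin Q hQ hQP]; simp⟩
    · push Not at hQP
      have hQ0 : Q ≠ 0 := by rintro rfl; simp at hQP; omega
      set Q₁ : S[X] := C P.leadingCoeff * Q - C Q.leadingCoeff * X ^ (Q.natDegree - P.natDegree) * P
        with hQ₁
      have hlt : Q₁.natDegree < Q.natDegree := by
        have hd : Q₁.degree < Q.degree := by
          have e1 : (C P.leadingCoeff * Q).degree = Q.degree := by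
            rw [degree_mul, degree_C (leadingCoeff_ne_zero.2 hP0), zero_add]
          rw [← e1]
          apply degree_sub_lt_left
          · rw [e1, degree_mul, degree_mul, degree_C (leadingCoeff_ne_zero.2 hQ0), degree_X_pow,
              degree_eq_natDegree hQ0, degree_eq_natDegree hP0, zero_add]
            norm_cast; omega
          · exact mul_ne_zero (by simpa using hP0) hQ0
          · simp only [leadingCoeff_mul, leadingCoeff_C, leadingCoeff_X_pow, mul_one]
            ring
        have hQd : 0 < Q.natDegree := by omega
        by_cases h0 : Q₁ = 0
        · rw [h0]; simpa using hQd
        · exact natDegree_lt_natDegree h0 hd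
      have hz : aeval θ Q₁ = 0 := by simp [hQ₁, hQ, hP]
      obtain ⟨c, hc, H, hH⟩ := ih _ (hn ▸ hlt) Q₁ hz rfl
      refine ⟨c * P.leadingCoeff, mul_ne_zero hc (leadingCoeff_ne_zero.2 hP0),
        H + C c * (C Q.leadingCoeff * X ^ (Q.natDegree - P.natDegree)), ?_⟩
      rw [mul_add, ← hH, hQ₁, C_mul]
      ring

theorem exists_denominator_pow_mul_aeval {σ ι : Type} (D : MvPolynomial σ ℂ)
    (A : ι → MvPolynomial σ ℂ) (q : MvPolynomial ι ℂ) :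
    ∃ (N : ℕ) (Q : MvPolynomial σ ℂ), ∀ (B : Type) [CommRing B] [Algebra ℂ B] (v : σ → B)
      (y : ι → B), (∀ i, MvPolynomial.aeval v D * y i = MvPolynomial.aeval v (A i)) →
        MvPolynomial.aeval v D ^ N * MvPolynomial.aeval y q = MvPolynomial.aeval v Q := by
  induction q using MvPolynomial.induction_on with
  | C a => exact ⟨0, MvPolynomial.C a, fun B _ _ v y _ => by simp⟩
  | add p q hp hq =>
    obtain ⟨N, Q, h⟩ := hp
    obtain ⟨N', Q', h'⟩ := hq
    refine ⟨N + N', D ^ N' * Q + D ^ N * Q', fun B _ _ v y hy => ?_⟩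
    simp only [map_add, map_mul, map_pow, ← h B v y hy, ← h' B v y hy]
    ring
  | mul_X p i hp =>
    obtain ⟨N, Q, h⟩ := hp
    refine ⟨N + 1, Q * A i, fun B _ _ v y hy => ?_⟩
    simp only [map_mul, MvPolynomial.aeval_X, ← h B v y hy, ← hy i]
    ring

open MvPolynomial in
theorem aeval_optionEquivLeft_symm {τ B : Type} [CommRing B] [Algebra ℂ B] (v : Option τ → B)
    (p : Polynomial (MvPolynomial τ ℂ)) :
    aeval v ((optionEquivLeft ℂ τ).symm p) =
      Polynomial.eval₂ (aeval fun t => v (some t) : MvPolynomial τ ℂ →ₐ[ℂ] B).toRingHom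
        (v none) p := by
  induction p using Polynomial.induction_on' with
  | add p q hp hq => simp [hp, hq, Polynomial.eval₂_add]
  | monomial n a =>
    rw [← Polynomial.C_mul_X_pow_eq_monomial]
    simp only [optionEquivLeft_symm_apply, Polynomial.aevalTower_C, Polynomial.aevalTower_X,
      map_mul, map_pow, aeval_X, Polynomial.eval₂_mul, Polynomial.eval₂_C, Polynomial.eval₂_X_pow,
      aeval_rename]
    rfl

open MvPolynomial in
theorem pderiv_optionEquivLeft_symm {τ : Type} (p : Polynomial (MvPolynomial τ ℂ)) :
    pderiv none ((optionEquivLeft ℂ τ).symm p) =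
      (optionEquivLeft ℂ τ).symm (Polynomial.derivative p) := by
  classical
  induction p using Polynomial.induction_on' with
  | add p q hp hq => simp [hp, hq]
  | monomial n a =>
    have h0 : pderiv (none : Option τ) (rename some a) = 0 := by
      apply pderiv_eq_zero_of_notMem_vars
      intro h
      obtain ⟨x, -, hx⟩ := Finset.mem_image.1 (vars_rename _ _ h)
      simp at hx
    rw [← Polynomial.C_mul_X_pow_eq_monomial]
    simp [optionEquivLeft_symm_apply, Polynomial.aevalTower_C, Polynomial.aevalTower_X,
      Derivation.leibniz, Derivation.leibniz_pow, h0, Polynomial.derivative_X_pow]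

open MvPolynomial in
/-- A finite family `F` in a domain is, up to denominators, rationally parametrized by a simple
zero `v` of one polynomial `P`, in such a way that `P` accounts for every polynomial relation
satisfied by `F`. -/
theorem exists_simple_presentation {R ι : Type} [CommRing R] [IsDomain R] [Algebra ℂ R] [Finite ι]
    (F : ι → R) :
    ∃ (τ : Type) (_ : Fintype τ) (v : Option τ → R) (P : MvPolynomial (Option τ) ℂ)
      (D : MvPolynomial τ ℂ) (A : ι → MvPolynomial (Option τ) ℂ),
      aeval v P = 0 ∧ aeval v (pderiv none P) ≠ 0 ∧ aeval v (rename some D) ≠ 0 ∧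
      (∀ i, aeval v (rename some D) * F i = aeval v (A i)) ∧
      ∀ q : MvPolynomial ι ℂ, aeval F q = 0 → ∃ e : MvPolynomial (Option τ) ℂ, aeval v e ≠ 0 ∧
        ∀ (v' : Option τ → ℂ) (y' : ι → ℂ), eval v' P = 0 →
          (∀ i, eval v' (rename some D) * y' i = eval v' (A i)) →
            eval v' e * eval y' q = 0 := by
  classical
  have := Fintype.ofFinite ι
  obtain ⟨T, hT⟩ : ∃ T : Set ι, Maximal (fun T => AlgebraicIndepOn ℂ F T) T := by
    have hne : {T : Set ι | AlgebraicIndepOn ℂ F T}.Nonempty :=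
      ⟨∅, algebraicIndependent_empty_type_iff.2 (FaithfulSMul.algebraMap_injective ℂ R)⟩
    obtain ⟨T, hT⟩ := (Set.toFinite {T : Set ι | AlgebraicIndepOn ℂ F T}).exists_maximal hne
    exact ⟨T, hT⟩
  set t : T → R := fun i => F i with ht
  have hind : AlgebraicIndependent ℂ t := hT.1
  let _ : Algebra (MvPolynomial T ℂ) R := (aeval t : MvPolynomial T ℂ →ₐ[ℂ] R).toRingHom.toAlgebra
  have hmap : ∀ p : MvPolynomial T ℂ, algebraMap (MvPolynomial T ℂ) R p = aeval t p := fun _ => rfl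
  have hinj : Function.Injective (algebraMap (MvPolynomial T ℂ) R) :=
    algebraicIndependent_iff_injective_aeval.1 hind
  have halg : ∀ i, IsAlgebraic (MvPolynomial T ℂ) (F i) := by
    intro i
    by_cases hi : i ∈ T
    · have : F i = algebraMap (MvPolynomial T ℂ) R (X ⟨i, hi⟩) := by rw [hmap, aeval_X]
      rw [this]
      exact isAlgebraic_algebraMap _
    · have h1 : IsAlgebraic (Algebra.adjoin ℂ (F '' T)) (F i) := by
        by_contra hcon
        have h2 := AlgebraicIndepOn.insert hT.1 hcon
        exact hi (hT.2 h2 (Set.subset_insert _ _) (Set.mem_insert _ _))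
      refine IsAlgebraic.of_ringHom_of_comp_eq (S := Algebra.adjoin ℂ (F '' T))
        (R := MvPolynomial T ℂ) (hT.1.aevalEquiv.toRingEquiv.toRingHom) (RingHom.id R)
        (by simpa using h1) hT.1.aevalEquiv.surjective Function.injective_id ?_
      ext x
      · simp [hmap, AlgebraicIndepOn.aevalEquiv]
      · simp [hmap, AlgebraicIndepOn.aevalEquiv, ht]
  set K := FractionRing R
  have hinjK : Function.Injective (algebraMap (MvPolynomial T ℂ) K) := by
    rw [IsScalarTower.algebraMap_eq (MvPolynomial T ℂ) R K]
    exact (IsFractionRing.injective R K).comp hinj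
  have : FaithfulSMul (MvPolynomial T ℂ) K := (faithfulSMul_iff_algebraMap_injective _ _).2 hinjK
  let _ := FractionRing.liftAlgebra (MvPolynomial T ℂ) K
  obtain ⟨θK, hθK, hrep⟩ := exists_common_generator (S := MvPolynomial T ℂ)
    (k := FractionRing (MvPolynomial T ℂ))
    (fun i => algebraMap R K (F i)) (fun i => (halg i).algebraMap)
  obtain ⟨θ, hθmem, rfl⟩ : ∃ θ ∈ Algebra.adjoin (MvPolynomial T ℂ) (Set.range F),
      algebraMap R K θ = θK := by
    have e : Set.range (fun i => algebraMap R K (F i)) =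
        (IsScalarTower.toAlgHom (MvPolynomial T ℂ) R K) '' Set.range F := by
      rw [← Set.range_comp]; rfl
    rw [e, ← AlgHom.map_adjoin] at hθK
    obtain ⟨θ, h, h'⟩ := hθK
    exact ⟨θ, h, h'⟩
  have hθalg : IsAlgebraic (MvPolynomial T ℂ) θ := by
    have : Algebra.adjoin (MvPolynomial T ℂ) (Set.range F) ≤
        Subalgebra.algebraicClosure (MvPolynomial T ℂ) R := by
      apply Algebra.adjoin_le
      rintro _ ⟨i, rfl⟩
      exact halg i
    exact this hθmem
  obtain ⟨P, ⟨hP0, hP⟩, hPmin⟩ : ∃ P : Polynomial (MvPolynomial T ℂ),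
      (P ≠ 0 ∧ Polynomial.aeval θ P = 0) ∧
      ∀ Q : Polynomial (MvPolynomial T ℂ), Polynomial.aeval θ Q = 0 →
        Q.natDegree < P.natDegree → Q = 0 := by
    have hex : ∃ n, ∃ P : Polynomial (MvPolynomial T ℂ), (P ≠ 0 ∧ Polynomial.aeval θ P = 0) ∧
        P.natDegree = n := by
      obtain ⟨P, h⟩ := hθalg
      exact ⟨_, P, h, rfl⟩
    obtain ⟨P, h, hn⟩ := Nat.find_spec hex
    refine ⟨P, h, fun Q hQ hlt => ?_⟩
    by_contra hQ0
    exact Nat.find_min hex (hn ▸ hlt) ⟨Q, ⟨hQ0, hQ⟩, rfl⟩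
  have hPdeg : 0 < P.natDegree := by
    by_contra h
    obtain ⟨c, rfl⟩ := Polynomial.natDegree_eq_zero.1 (Nat.eq_zero_of_not_pos h)
    rw [Polynomial.aeval_C] at hP
    exact hP0 (by rw [(map_eq_zero_iff _ hinj).1 hP, Polynomial.C_0])
  have hPder : Polynomial.aeval θ (Polynomial.derivative P) ≠ 0 := by
    intro h
    have h1 := hPmin _ h (Polynomial.natDegree_derivative_lt hPdeg.ne')
    have := Polynomial.derivative_eq_zero.1 h1
    omega
  have hrep' : ∀ i, ∃ d : MvPolynomial T ℂ, d ≠ 0 ∧ ∃ p : Polynomial (MvPolynomial T ℂ),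
      algebraMap _ R d * F i = Polynomial.aeval θ p := by
    intro i
    obtain ⟨d, hd, p, h⟩ := hrep i
    refine ⟨d, hd, p, IsFractionRing.injective R K ?_⟩
    rw [map_mul, ← IsScalarTower.algebraMap_apply, ← Algebra.smul_def, h,
      Polynomial.aeval_algebraMap_apply]
  choose d hd p hp using hrep'
  set v : Option T → R := fun o => o.elim θ t with hv
  have hvs : ∀ q : Polynomial (MvPolynomial T ℂ),
      aeval v ((optionEquivLeft ℂ T).symm q) = Polynomial.aeval θ q := by
    intro q
    rw [aeval_optionEquivLeft_symm]
    rfl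
  have hvD : ∀ q : MvPolynomial T ℂ, aeval v (rename some q) = algebraMap _ R q := by
    intro q
    rw [aeval_rename, hmap]
    rfl
  have hDne : algebraMap (MvPolynomial T ℂ) R (∏ i, d i) ≠ 0 := by
    rw [Ne, map_eq_zero_iff _ hinj]
    exact Finset.prod_ne_zero_iff.2 fun i _ => hd i
  refine ⟨T, inferInstance, v, (optionEquivLeft ℂ T).symm P, ∏ i, d i,
    fun i => (optionEquivLeft ℂ T).symm (Polynomial.C (∏ j ∈ Finset.univ.erase i, d j) * p i),
    ?_, ?_, ?_, ?_, ?_⟩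
  · rw [hvs, hP]
  · rwa [pderiv_optionEquivLeft_symm, hvs]
  · rwa [hvD]
  · intro i
    rw [hvD, hvs, map_mul, Polynomial.aeval_C, ← hp i, ← mul_assoc, ← map_mul,
      Finset.prod_erase_mul _ _ (Finset.mem_univ i)]
  · intro q hq
    obtain ⟨N, Q, hQ⟩ := exists_denominator_pow_mul_aeval (rename some (∏ i, d i))
      (fun i => (optionEquivLeft ℂ T).symm
        (Polynomial.C (∏ j ∈ Finset.univ.erase i, d j) * p i)) q
    have hQR := hQ R v F (fun i => by
      rw [hvD, hvs, map_mul, Polynomial.aeval_C, ← hp i, ← mul_assoc, ← map_mul,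
        Finset.prod_erase_mul _ _ (Finset.mem_univ i)])
    rw [hq, mul_zero] at hQR
    have hQθ : Polynomial.aeval θ (optionEquivLeft ℂ T Q) = 0 := by
      rw [← hvs, AlgEquiv.symm_apply_apply, ← hQR]
    obtain ⟨c, hc, H, hH⟩ := exists_C_mul_dvd_of_minimal θ P hP0 hP hPmin hPdeg _ hQθ
    refine ⟨rename some c * rename some (∏ i, d i) ^ N, ?_, ?_⟩
    · rw [map_mul, map_pow, hvD, hvD]
      refine mul_ne_zero ?_ (pow_ne_zero _ hDne)
      rwa [Ne, map_eq_zero_iff _ hinj]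
    · intro v' y' hPv hDy
      have h1 := hQ ℂ v' y' hDy
      have h2 : rename some c * Q =
          (optionEquivLeft ℂ T).symm P * (optionEquivLeft ℂ T).symm H := by
        rw [← map_mul, ← hH, map_mul, AlgEquiv.symm_apply_apply]
        simp [optionEquivLeft_symm_apply]
      have h1' : eval v' (rename some (∏ i, d i)) ^ N * eval y' q = eval v' Q := h1
      rw [map_mul, map_pow, mul_assoc, h1', ← map_mul, h2, map_mul, hPv, zero_mul]

end Presentation

section FunctionAlgebras

variable {E E' : Type} [NormedAddCommGroup E] [NormedSpace ℂ E] [NormedAddCommGroup E']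
  [NormedSpace ℂ E']

theorem eqOn_zero_of_convex {U W : Set E} {f : E → ℂ} (hU : IsOpen U) (hc : Convex ℝ U)
    (hf : DifferentiableOn ℂ f U) (hW : IsOpen W) (hne : (W ∩ U).Nonempty)
    (h0 : ∀ x ∈ W ∩ U, f x = 0) : ∀ x ∈ U, f x = 0 := by
  obtain ⟨w, hwW, hwU⟩ := hne
  intro x hx
  set ℓ : ℂ → E := fun z => w + z • (x - w) with hℓ
  have hℓd : Differentiable ℂ ℓ := by fun_prop
  have hV : IsOpen (ℓ ⁻¹' U) := hU.preimage hℓd.continuous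
  have hVc : Convex ℝ (ℓ ⁻¹' U) := by
    intro a ha b hb s t hs ht hst
    have : ℓ (s • a + t • b) = s • ℓ a + t • ℓ b := by
      have hst' : (s : ℂ) + t = 1 := by exact_mod_cast hst
      simp only [hℓ, ← Complex.coe_smul, smul_add, smul_smul, add_smul, smul_eq_mul]
      have : w = ((s : ℂ) + t) • w := by rw [hst', one_smul]
      nth_rewrite 1 [this]
      rw [add_smul]
      abel
    rw [Set.mem_preimage, this]
    exact hc ha hb hs ht hst
  have hg : DifferentiableOn ℂ (f ∘ ℓ) (ℓ ⁻¹' U) :=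
    hf.comp hℓd.differentiableOn (Set.mapsTo_preimage _ _)
  have h0' : (0 : ℂ) ∈ ℓ ⁻¹' U := by simpa [hℓ] using hwU
  have h1' : (1 : ℂ) ∈ ℓ ⁻¹' U := by simpa [hℓ] using hx
  have hev : f ∘ ℓ =ᶠ[𝓝 0] 0 := by
    have : ℓ ⁻¹' (W ∩ U) ∈ 𝓝 (0 : ℂ) :=
      ((hW.inter hU).preimage hℓd.continuous).mem_nhds (by simpa [hℓ] using ⟨hwW, hwU⟩)
    filter_upwards [this] with z hz using h0 _ hz
  have := (hg.analyticOnNhd hV).eqOn_zero_of_preconnected_of_eventuallyEq_zero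
    hVc.isPreconnected h0' hev h1'
  simpa [hℓ] using this

theorem eqOn_zero_or_of_mul {U : Set E} {f g : E → ℂ} (hU : IsOpen U) (hc : Convex ℝ U)
    (hf : DifferentiableOn ℂ f U) (hg : DifferentiableOn ℂ g U)
    (h : ∀ x ∈ U, f x * g x = 0) : (∀ x ∈ U, f x = 0) ∨ (∀ x ∈ U, g x = 0) := by
  by_contra! hcon
  obtain ⟨⟨x, hx, hfx⟩, y, hy, hgy⟩ := hcon
  have hO : IsOpen (U ∩ f ⁻¹' {0}ᶜ) :=
    hf.continuousOn.isOpen_inter_preimage hU isOpen_compl_singleton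
  refine hgy (eqOn_zero_of_convex hU hc hg hO ⟨x, ⟨hx, hfx⟩, hx⟩ ?_ y hy)
  rintro z ⟨⟨hz, hfz⟩, -⟩
  exact (mul_eq_zero.1 (h z hz)).resolve_left hfz

/-- The algebra of holomorphic functions on `U`. -/
def holFn (U : Set E) : Subalgebra ℂ (U → ℂ) where
  carrier := {φ | ∃ f : E → ℂ, DifferentiableOn ℂ f U ∧ U.domRestrict f = φ}
  mul_mem' := by
    rintro _ _ ⟨f, hf, rfl⟩ ⟨g, hg, rfl⟩
    exact ⟨f * g, hf.mul hg, rfl⟩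
  add_mem' := by
    rintro _ _ ⟨f, hf, rfl⟩ ⟨g, hg, rfl⟩
    exact ⟨f + g, hf.add hg, rfl⟩
  algebraMap_mem' c := ⟨fun _ => c, differentiableOn_const c, rfl⟩

/-- The algebra of polynomial functions on `U`. -/
def polyFn (U : Set E) : Subalgebra ℂ (U → ℂ) :=
  Algebra.adjoin ℂ {φ | ∃ ℓ : E →L[ℂ] ℂ, φ = U.domRestrict ℓ}

theorem polyFn_le_holFn (U : Set E) : polyFn U ≤ holFn U := by
  apply Algebra.adjoin_le
  rintro _ ⟨ℓ, rfl⟩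
  exact ⟨ℓ, ℓ.differentiable.differentiableOn, rfl⟩

theorem isDomain_of_le_holFn {U : Set E} (hU : IsOpen U) (hc : Convex ℝ U) (hne : U.Nonempty)
    {S : Subalgebra ℂ (U → ℂ)} (hS : S ≤ holFn U) : IsDomain S := by
  have : Nonempty U := hne.to_subtype
  have : NoZeroDivisors S := by
    refine ⟨fun {φ ψ} h => ?_⟩
    obtain ⟨f, hf, hfφ⟩ := hS φ.2
    obtain ⟨g, hg, hgψ⟩ := hS ψ.2
    have h' : ∀ x ∈ U, f x * g x = 0 := by
      intro x hx
      have := congrFun (congrArg Subtype.val h) ⟨x, hx⟩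
      rwa [Subalgebra.coe_mul, ← hfφ, ← hgψ] at this
    rcases eqOn_zero_or_of_mul hU hc hf hg h' with h1 | h1
    · left
      ext x
      rw [← hfφ]
      exact h1 x x.2
    · right
      ext x
      rw [← hgψ]
      exact h1 x x.2
  exact NoZeroDivisors.to_isDomain S

theorem eq_zero_of_mem_holFn {U W : Set E} (hU : IsOpen U) (hc : Convex ℝ U) {φ : U → ℂ}
    (hφ : φ ∈ holFn U) (hW : IsOpen W) (hne : (W ∩ U).Nonempty)
    (h0 : ∀ x : U, (x : E) ∈ W → φ x = 0) : φ = 0 := by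
  obtain ⟨f, hf, rfl⟩ := hφ
  ext x
  exact eqOn_zero_of_convex hU hc hf hW hne (fun x hx => h0 ⟨x, hx.2⟩ hx.1) x x.2

/-- Holomorphic functions on `U` that are algebraic over the polynomial functions. -/
def NashOn (U : Set E) (f : E → ℂ) : Prop :=
  DifferentiableOn ℂ f U ∧ IsAlgebraic (polyFn U) (U.domRestrict f)

variable {U : Set E}

theorem NashOn.of_mem_polyFn (hU : IsOpen U) (hc : Convex ℝ U) (hne : U.Nonempty) {f : E → ℂ}
    (hd : DifferentiableOn ℂ f U)
    (h : U.domRestrict f ∈ polyFn U) : NashOn U f := by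
  have := isDomain_of_le_holFn hU hc hne (polyFn_le_holFn U)
  exact ⟨hd, isAlgebraic_algebraMap (⟨_, h⟩ : polyFn U)⟩

theorem NashOn.add (hU : IsOpen U) (hc : Convex ℝ U) (hne : U.Nonempty) {f g : E → ℂ}
    (hf : NashOn U f) (hg : NashOn U g) : NashOn U (fun x => f x + g x) := by
  have := isDomain_of_le_holFn hU hc hne (polyFn_le_holFn U)
  exact ⟨hf.1.add hg.1, hf.2.add hg.2⟩

theorem NashOn.mul (hU : IsOpen U) (hc : Convex ℝ U) (hne : U.Nonempty) {f g : E → ℂ}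
    (hf : NashOn U f) (hg : NashOn U g) : NashOn U (fun x => f x * g x) := by
  have := isDomain_of_le_holFn hU hc hne (polyFn_le_holFn U)
  exact ⟨hf.1.mul hg.1, hf.2.mul hg.2⟩

theorem NashOn.const (hU : IsOpen U) (hc : Convex ℝ U) (hne : U.Nonempty) (c : ℂ) :
    NashOn U (fun _ => c) :=
  NashOn.of_mem_polyFn hU hc hne (differentiableOn_const c) ((polyFn U).algebraMap_mem c)

theorem NashOn.clm (hU : IsOpen U) (hc : Convex ℝ U) (hne : U.Nonempty) (ℓ : E →L[ℂ] ℂ) :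
    NashOn U ℓ :=
  NashOn.of_mem_polyFn hU hc hne ℓ.differentiable.differentiableOn
    (Algebra.subset_adjoin ⟨ℓ, rfl⟩)

theorem NashOn.eval (hU : IsOpen U) (hc : Convex ℝ U) (hne : U.Nonempty) {κ : Type}
    {t : κ → E → ℂ} (ht : ∀ k, NashOn U (t k)) (p : MvPolynomial κ ℂ) :
    NashOn U (fun x => MvPolynomial.eval (fun k => t k x) p) := by
  induction p using MvPolynomial.induction_on with
  | C a => simpa using NashOn.const hU hc hne a
  | add p q hp hq => simpa using hp.add hU hc hne hq
  | mul_X p k hp => simpa using hp.mul hU hc hne (ht k)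

theorem NashOn.of_root (hU : IsOpen U) (hc : Convex ℝ U) {κ : Type}
    {t : κ → E → ℂ} (ht : ∀ k, NashOn U (t k)) (P : Polynomial (MvPolynomial κ ℂ)) {x₀ : E}
    (hx₀ : x₀ ∈ U) (hP : P.map (MvPolynomial.eval fun k => t k x₀) ≠ 0) {f : E → ℂ}
    (hf : DifferentiableOn ℂ f U)
    (hroot : ∀ x ∈ U, P.eval₂ (MvPolynomial.eval fun k => t k x) (f x) = 0) : NashOn U f := by
  have hne : U.Nonempty := ⟨x₀, hx₀⟩
  have := isDomain_of_le_holFn hU hc hne (polyFn_le_holFn U)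
  refine ⟨hf, ?_⟩
  let A : Subalgebra (polyFn U) (U → ℂ) := Subalgebra.algebraicClosure (polyFn U) (U → ℂ)
  let B : Subalgebra ℂ (U → ℂ) := A.restrictScalars ℂ ⊓ holFn U
  have hB : ∀ {φ : E → ℂ}, NashOn U φ → U.domRestrict φ ∈ B := fun {φ} h => ⟨h.2, φ, h.1, rfl⟩
  have : IsDomain B := isDomain_of_le_holFn hU hc hne inf_le_right
  have hle : polyFn U ≤ B := fun φ hφ =>
    ⟨isAlgebraic_algebraMap (⟨φ, hφ⟩ : polyFn U), polyFn_le_holFn U hφ⟩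
  let _ : Algebra (polyFn U) B := (Subalgebra.inclusion hle).toRingHom.toAlgebra
  have : IsScalarTower (polyFn U) B (U → ℂ) := IsScalarTower.of_algebraMap_eq fun _ => rfl
  have : Algebra.IsAlgebraic (polyFn U) B := ⟨fun b => by
    have hb : IsAlgebraic (polyFn U) (algebraMap B (U → ℂ) b) := b.2.1
    exact (isAlgebraic_algebraMap_iff Subtype.val_injective).1 hb⟩
  suffices IsAlgebraic B (U.domRestrict f) from this.restrictScalars (polyFn U)
  let ψ : MvPolynomial κ ℂ →ₐ[ℂ] B :=
    MvPolynomial.aeval fun k => (⟨U.domRestrict (t k), hB (ht k)⟩ : B)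
  have hψ : ∀ (p : MvPolynomial κ ℂ) (x : U), (ψ p : U → ℂ) x =
      MvPolynomial.eval (fun k => t k x) p := by
    intro p x
    induction p using MvPolynomial.induction_on with
    | C a => simp [ψ]
    | add p q hp hq => simp [hp, hq]
    | mul_X p k hp => simp [hp, ψ]
  refine ⟨P.map ψ.toRingHom, ?_, ?_⟩
  · intro h
    apply hP
    ext k
    have := congrFun (congrArg Subtype.val (congrArg (fun q => Polynomial.coeff q k) h)) ⟨x₀, hx₀⟩
    simpa [Polynomial.coeff_map, hψ] using this
  · ext x
    have := hroot x x.2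
    rw [Polynomial.eval₂_eq_sum_range] at this
    rw [Polynomial.aeval_def, Polynomial.eval₂_map, Polynomial.eval₂_eq_sum_range]
    simp only [Finset.sum_apply, Pi.mul_apply, Pi.pow_apply]
    rw [Pi.zero_apply, ← this]
    refine Finset.sum_congr rfl fun k _ => ?_
    congr 1
    exact hψ _ x

theorem NashOn.comp_affine {U' : Set E'} (hU : IsOpen U) (hne : U.Nonempty)
    (hU' : IsOpen U') (hc' : Convex ℝ U') (L : E →L[ℂ] E') (hL : IsOpenMap L) (b : E')
    (hmaps : ∀ x ∈ U, L x + b ∈ U') {f : E' → ℂ} (hf : NashOn U' f) :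
    NashOn U (fun x => f (L x + b)) := by
  have hd : Differentiable ℂ fun x => L x + b := by fun_prop
  refine ⟨hf.1.comp hd.differentiableOn hmaps, ?_⟩
  let T : (U' → ℂ) →ₐ[ℂ] (U → ℂ) :=
    { toFun := fun φ x => φ ⟨L x + b, hmaps x x.2⟩
      map_one' := rfl
      map_mul' := fun _ _ => rfl
      map_zero' := rfl
      map_add' := fun _ _ => rfl
      commutes' := fun _ => rfl }
  have hT : ∀ φ ∈ polyFn U', T φ ∈ polyFn U := by
    intro φ hφ
    have : polyFn U' ≤ (polyFn U).comap T := by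
      apply Algebra.adjoin_le
      rintro _ ⟨ℓ, rfl⟩
      have e : T (U'.domRestrict ℓ) = U.domRestrict (ℓ.comp L) + algebraMap ℂ _ (ℓ b) := by
        ext x
        exact map_add ℓ _ _
      rw [SetLike.mem_coe, Subalgebra.mem_comap, e]
      exact add_mem (Algebra.subset_adjoin ⟨_, rfl⟩) (Subalgebra.algebraMap_mem _ _)
    exact this hφ
  let g : polyFn U' →ₐ[ℂ] polyFn U :=
    (T.comp (polyFn U').val).codRestrict (polyFn U) fun φ => hT _ φ.2
  refine hf.2.ringHom_of_comp_eq g T ?_ rfl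
  rw [injective_iff_map_eq_zero]
  intro φ hφ
  have hO : IsOpen ((fun x => L x + b) '' U) := by
    have : (fun x => L x + b) = (Homeomorph.addRight b) ∘ L := rfl
    rw [this]
    exact ((Homeomorph.addRight b).isOpenMap.comp hL) U hU
  obtain ⟨x₀, hx₀⟩ := hne
  refine Subtype.ext (eq_zero_of_mem_holFn hU' hc' (polyFn_le_holFn _ φ.2) hO
    ⟨L x₀ + b, ⟨x₀, hx₀, rfl⟩, hmaps x₀ hx₀⟩ ?_)
  rintro ⟨_, h⟩ ⟨x, hx, rfl⟩
  exact congrFun (congrArg Subtype.val hφ) ⟨x, hx⟩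

theorem NashOn.mono {U' : Set E} (hU : IsOpen U) (hne : U.Nonempty)
    (hU' : IsOpen U') (hc' : Convex ℝ U') (hsub : U ⊆ U') {f : E → ℂ} (hf : NashOn U' f) :
    NashOn U f := by
  simpa using hf.comp_affine hU hne hU' hc' (ContinuousLinearMap.id ℂ E) IsOpenMap.id 0
    (fun x hx => by simpa using hsub hx)

theorem NashOn.nashFn {n : ℕ} {U : Set (Fin n → ℂ)} (hU : IsOpen U) {f : (Fin n → ℂ) → ℂ}
    (hf : NashOn U f) : NashFn n U f := by
  refine ⟨hf.1, fun x₀ hx₀ => ⟨U, hU, hx₀, ?_⟩⟩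
  let ψ : MvPolynomial (Fin n) ℂ →ₐ[ℂ] (U → ℂ) :=
    MvPolynomial.aeval fun i => U.domRestrict fun x => x i
  have hψ : ∀ (p : MvPolynomial (Fin n) ℂ) (x : U),
      ψ p x = MvPolynomial.eval (x : Fin n → ℂ) p := by
    intro p x
    induction p using MvPolynomial.induction_on with
    | C a => simp [ψ]
    | add p q hp hq => simp [hp, hq]
    | mul_X p k hp => simp [hp, ψ]
  have hr : polyFn U ≤ ψ.range := by
    apply Algebra.adjoin_le
    rintro _ ⟨ℓ, rfl⟩
    refine ⟨∑ i, MvPolynomial.C (ℓ (Pi.single i 1)) * MvPolynomial.X i, ?_⟩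
    ext x
    change ψ _ x = _
    rw [hψ, Set.domRestrict_apply]
    conv_rhs => rw [← Finset.univ_sum_single (x : Fin n → ℂ), map_sum]
    simp only [map_sum, map_mul, MvPolynomial.eval_C, MvPolynomial.eval_X]
    refine Finset.sum_congr rfl fun i _ => ?_
    have : (Pi.single i ((x : Fin n → ℂ) i) : Fin n → ℂ) = (x : Fin n → ℂ) i • Pi.single i 1 := by
      rw [← Pi.single_smul]; simp
    rw [this, map_smul, smul_eq_mul, mul_comm]
  obtain ⟨p, hp0, hp⟩ := hf.2
  have hlift : ∀ a : polyFn U, ∃ q, ψ q = a := fun a => hr a.2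
  choose q hq using hlift
  refine ⟨∑ k ∈ Finset.range (p.natDegree + 1),
    Polynomial.C (q (p.coeff k)) * Polynomial.X ^ k, ?_, ?_⟩
  · intro h
    apply hp0
    ext k
    rw [Polynomial.coeff_zero]
    by_cases hk : k < p.natDegree + 1
    · have := congrArg (fun r => Polynomial.coeff r k) h
      simp only [Polynomial.finsetSum_coeff, Polynomial.coeff_C_mul_X_pow, Finset.sum_ite_eq,
        Finset.mem_range, hk, if_true, Polynomial.coeff_zero] at this
      rw [← hq, this, map_zero]
      rfl
    · rw [Polynomial.coeff_eq_zero_of_natDegree_lt (by omega)]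
  · rintro x ⟨hx, -⟩
    have := congrFun hp ⟨x, hx⟩
    rw [Polynomial.aeval_eq_sum_range, Finset.sum_apply] at this
    rw [Polynomial.eval₂_finsetSum]
    refine Eq.trans (Finset.sum_congr rfl fun k _ => ?_) this
    simp only [Polynomial.eval₂_mul, Polynomial.eval₂_C, Polynomial.eval₂_X_pow]
    rw [← hψ _ ⟨x, hx⟩, hq]
    rfl

end FunctionAlgebras

section DiskAlgebra

open Metric

/-- The disk algebra of the closed disk of radius `ρ`, inside the continuous functions. -/
def diskSubalg (ρ : ℝ) : Subalgebra ℂ C(closedBall (0 : ℂ) ρ, ℂ) where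
  carrier := {g | ∃ f : ℂ → ℂ, DifferentiableOn ℂ f (ball 0 ρ) ∧ ∀ z, g z = f z}
  mul_mem' := by
    rintro _ _ ⟨f, hf, hf'⟩ ⟨g, hg, hg'⟩
    exact ⟨f * g, hf.mul hg, fun z => by simp [hf', hg']⟩
  add_mem' := by
    rintro _ _ ⟨f, hf, hf'⟩ ⟨g, hg, hg'⟩
    exact ⟨f + g, hf.add hg, fun z => by simp [hf', hg']⟩
  algebraMap_mem' c := ⟨fun _ => c, differentiableOn_const c, fun _ => rfl⟩

variable {ρ : ℝ}

theorem isClosed_diskSubalg : IsClosed (diskSubalg ρ : Set C(closedBall (0 : ℂ) ρ, ℂ)) := by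
  apply IsSeqClosed.isClosed
  intro u g hu hg
  choose f hf hfu using hu
  refine ⟨Function.extend Subtype.val g 0, ?_, fun z => ?_⟩
  · refine TendstoLocallyUniformlyOn.differentiableOn (φ := atTop) (F := f)
      (TendstoUniformlyOn.tendstoLocallyUniformlyOn ?_) (Eventually.of_forall hf) isOpen_ball
    rw [ContinuousMap.tendsto_iff_tendstoUniformly, Metric.tendstoUniformly_iff] at hg
    rw [Metric.tendstoUniformlyOn_iff]
    intro ε hε
    filter_upwards [hg ε hε] with n hn z hz
    have := hn ⟨z, ball_subset_closedBall hz⟩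
    rw [hfu] at this
    have e : Function.extend Subtype.val g 0 z = g ⟨z, ball_subset_closedBall hz⟩ :=
      Subtype.val_injective.extend_apply g 0 ⟨z, ball_subset_closedBall hz⟩
    rwa [e]
  · exact (Subtype.val_injective.extend_apply g 0 z).symm

/-- The disk algebra of the closed disk of radius `ρ`. -/
def diskAlg (ρ : ℝ) : Type := diskSubalg ρ

namespace diskAlg

noncomputable instance : NormedCommRing (diskAlg ρ) :=
  inferInstanceAs (NormedCommRing (diskSubalg ρ))

noncomputable instance : NormedAlgebra ℂ (diskAlg ρ) :=
  inferInstanceAs (NormedAlgebra ℂ (diskSubalg ρ))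

instance : CompleteSpace (diskAlg ρ) :=
  (isClosed_diskSubalg (ρ := ρ)).completeSpace_coe

/-- The element of the disk algebra given by a function. -/
def ofFun (f : ℂ → ℂ) (hc : ContinuousOn f (closedBall 0 ρ))
    (hd : DifferentiableOn ℂ f (ball 0 ρ)) : diskAlg ρ :=
  ⟨⟨fun z => f z, continuousOn_iff_continuous_domRestrict.1 hc⟩, f, hd, fun _ => rfl⟩

/-- Evaluation at a point of the disk. -/
noncomputable def ev (z : closedBall (0 : ℂ) ρ) : diskAlg ρ →ₐ[ℂ] ℂ :=
  (ContinuousMap.evalAlgHom ℂ ℂ z).comp (diskSubalg ρ).val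

/-- Evaluation at a point of the disk, as a continuous linear map. -/
noncomputable def evL (z : closedBall (0 : ℂ) ρ) : diskAlg ρ →L[ℂ] ℂ :=
  (ContinuousMap.evalCLM ℂ z).comp (diskSubalg ρ).toSubmodule.subtypeL

@[simp] theorem ev_ofFun (f : ℂ → ℂ) (hc hd) (z : closedBall (0 : ℂ) ρ) :
    ev z (ofFun f hc hd) = f z := rfl

theorem ext_ev {g h : diskAlg ρ} (H : ∀ z, ev z g = ev z h) : g = h :=
  Subtype.ext (ContinuousMap.ext H)

theorem continuous_ev (g : diskAlg ρ) : Continuous fun z => ev z g := g.1.continuous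

theorem norm_ev_le (z : closedBall (0 : ℂ) ρ) (g : diskAlg ρ) : ‖ev z g‖ ≤ ‖g‖ :=
  g.1.norm_coe_le_norm z

theorem exists_fun (g : diskAlg ρ) : ∃ f : ℂ → ℂ, ∃ (hc : ContinuousOn f (closedBall 0 ρ))
    (hd : DifferentiableOn ℂ f (ball 0 ρ)), g = ofFun f hc hd := by
  obtain ⟨f, hd, hf⟩ := g.2
  have hc : ContinuousOn f (closedBall 0 ρ) := by
    rw [continuousOn_iff_continuous_domRestrict]
    have : (closedBall 0 ρ).domRestrict f = g.1 := funext fun z => (hf z).symm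
    rw [this]
    exact g.1.continuous
  exact ⟨f, hc, hd, ext_ev hf⟩

/-- The coordinate function. -/
def coord : diskAlg ρ := ofFun id continuousOn_id differentiableOn_id

@[simp] theorem ev_coord (z : closedBall (0 : ℂ) ρ) : ev z (coord : diskAlg ρ) = z := rfl

theorem isUnit_of_ev_ne_zero (g : diskAlg ρ) (h : ∀ z, ev z g ≠ 0) : IsUnit g := by
  obtain ⟨f, hc, hd, rfl⟩ := exists_fun g
  have h0 : ∀ z ∈ closedBall (0 : ℂ) ρ, f z ≠ 0 := fun z hz => h ⟨z, hz⟩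
  refine IsUnit.of_mul_eq_one (ofFun (fun z => (f z)⁻¹) (hc.inv₀ h0)
    (hd.inv fun z hz => h0 z (ball_subset_closedBall hz))) (ext_ev fun z => ?_)
  rw [map_mul, ev_ofFun, ev_ofFun, map_one, mul_inv_cancel₀ (h0 z z.2)]

theorem exists_eq_add_sub_mul {w : ℂ} (hw : w ∈ ball (0 : ℂ) ρ) (g : diskAlg ρ) :
    ∃ h : diskAlg ρ, g = (coord - algebraMap ℂ _ w) * h +
      algebraMap ℂ _ (ev ⟨w, ball_subset_closedBall hw⟩ g) := by
  obtain ⟨f, hc, hd, rfl⟩ := exists_fun g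
  have hn : ball (0 : ℂ) ρ ∈ 𝓝 w := isOpen_ball.mem_nhds hw
  have hn' : closedBall (0 : ℂ) ρ ∈ 𝓝 w := mem_of_superset hn ball_subset_closedBall
  refine ⟨ofFun (dslope f w) ((continuousOn_dslope hn').2 ⟨hc, hd.differentiableAt hn⟩)
    ((Complex.differentiableOn_dslope hn).2 hd), ext_ev fun z => ?_⟩
  simp only [ev_ofFun, map_add, map_mul, map_sub, ev_coord, AlgHom.commutes,
    Algebra.algebraMap_self, RingHom.id_apply]
  have := sub_smul_dslope f w z
  rw [smul_eq_mul] at this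
  rw [this]
  ring

theorem eq_zero_of_sub_mul_eq_zero {w : ℂ} (hw : w ∈ ball (0 : ℂ) ρ) {h : diskAlg ρ}
    (H : (coord - algebraMap ℂ _ w) * h = 0) : h = 0 := by
  obtain ⟨f, hc, hd, rfl⟩ := exists_fun h
  have h1 : ∀ z ∈ closedBall (0 : ℂ) ρ, z ≠ w → f z = 0 := by
    intro z hz hzw
    have := congrArg (ev ⟨z, hz⟩) H
    simp only [ev_ofFun, map_mul, map_sub, ev_coord, AlgHom.commutes, map_zero,
      Algebra.algebraMap_self, RingHom.id_apply, mul_eq_zero, sub_eq_zero] at this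
    exact this.resolve_left hzw
  have hn : ball (0 : ℂ) ρ ∈ 𝓝 w := isOpen_ball.mem_nhds hw
  have hcw : ContinuousAt f w := (hd.differentiableAt hn).continuousAt
  have h2 : f w = 0 := by
    have h3 : Tendsto f (𝓝[≠] w) (𝓝 (f w)) := hcw.tendsto.mono_left nhdsWithin_le_nhds
    refine tendsto_nhds_unique_of_eventuallyEq h3 tendsto_const_nhds ?_
    filter_upwards [self_mem_nhdsWithin, nhdsWithin_le_nhds hn] with z hz hz'
    exact h1 z (ball_subset_closedBall hz') hz
  refine ext_ev fun z => ?_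
  rw [map_zero, ev_ofFun]
  by_cases hz : (z : ℂ) = w
  · rw [hz, h2]
  · exact h1 z z.2 hz

/-- `R ↦ ∑ R_j z^j`. -/
noncomputable def polyPart (ρ : ℝ) (s : ℕ) : (Fin s → ℂ) →L[ℂ] diskAlg ρ :=
  ∑ j : Fin s, (ContinuousLinearMap.proj j : (Fin s → ℂ) →L[ℂ] ℂ).smulRight
    ((coord : diskAlg ρ) ^ (j : ℕ))

theorem polyPart_apply (s : ℕ) (R : Fin s → ℂ) :
    polyPart ρ s R = ∑ j : Fin s, R j • (coord : diskAlg ρ) ^ (j : ℕ) := by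
  simp [polyPart]

/-- `(h, R) ↦ p * h + ∑ R_j z^j`. -/
noncomputable def divMap (s : ℕ) (p : diskAlg ρ) : (diskAlg ρ × (Fin s → ℂ)) →L[ℂ] diskAlg ρ :=
  (ContinuousLinearMap.mul ℂ (diskAlg ρ) p).comp (ContinuousLinearMap.fst ℂ _ _) +
    (polyPart ρ s).comp (ContinuousLinearMap.snd ℂ _ _)

theorem divMap_apply (s : ℕ) (p : diskAlg ρ) (v : diskAlg ρ × (Fin s → ℂ)) :
    divMap s p v = p * v.1 + polyPart ρ s v.2 := rfl

theorem polyPart_succ (s : ℕ) (R : Fin (s + 1) → ℂ) :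
    polyPart ρ (s + 1) R =
      coord * polyPart ρ s (fun j => R j.succ) + algebraMap ℂ (diskAlg ρ) (R 0) := by
  rw [polyPart_apply, polyPart_apply, Fin.sum_univ_succ, Finset.mul_sum, add_comm]
  congr 1
  · refine Finset.sum_congr rfl fun j _ => ?_
    rw [mul_smul_comm, Fin.val_succ, pow_succ']
  · simp [Algebra.algebraMap_eq_smul_one]

theorem divMap_coord_pow_bijective (hρ : 0 < ρ) (s : ℕ) :
    Function.Bijective (divMap s ((coord : diskAlg ρ) ^ s)) := by
  have h0 : (0 : ℂ) ∈ ball (0 : ℂ) ρ := mem_ball_self hρ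
  induction s with
  | zero =>
    refine ⟨fun v w h => ?_, fun g => ⟨(g, 0), ?_⟩⟩
    · simp only [divMap_apply, pow_zero, one_mul, polyPart_apply, Finset.univ_eq_empty,
        Finset.sum_empty, add_zero] at h
      exact Prod.ext h (Subsingleton.elim _ _)
    · rw [divMap_apply, polyPart_apply]
      simp
  | succ s ih =>
    constructor
    · rw [injective_iff_map_eq_zero]
      rintro ⟨h, R⟩ hv
      rw [divMap_apply, polyPart_succ, ← add_assoc, pow_succ', mul_assoc, ← mul_add] at hv
      dsimp only at hv
      have hR0 : R 0 = 0 := by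
        have := congrArg (ev ⟨0, ball_subset_closedBall h0⟩) hv
        simpa [AlgHom.commutes] using this
      rw [hR0, map_zero, add_zero] at hv
      have h1 := eq_zero_of_sub_mul_eq_zero h0 (by rw [map_zero, sub_zero]; exact hv)
      have h2 : (h, fun j : Fin s => R j.succ) = 0 :=
        (injective_iff_map_eq_zero _).1 ih.1 _ h1
      rw [Prod.mk_eq_zero] at h2
      refine Prod.ext h2.1 (funext fun j => ?_)
      refine Fin.cases hR0 (fun j => ?_) j
      exact congrFun h2.2 j
    · intro g
      obtain ⟨g', hg'⟩ := exists_eq_add_sub_mul h0 g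
      obtain ⟨⟨h, R⟩, hv⟩ := ih.2 g'
      refine ⟨(h, Fin.cons (ev ⟨0, ball_subset_closedBall h0⟩ g) R), ?_⟩
      rw [divMap_apply] at hv ⊢
      rw [polyPart_succ, ← add_assoc, pow_succ', mul_assoc]
      simp only [Fin.cons_succ, Fin.cons_zero]
      rw [← mul_add, hv]
      conv_rhs => rw [hg']
      rw [map_zero, sub_zero]

theorem divMap_bijective (hρ : 0 < ρ) (s : ℕ) {u : diskAlg ρ} (hu : IsUnit u) :
    Function.Bijective (divMap s ((coord : diskAlg ρ) ^ s * u)) := by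
  obtain ⟨u, rfl⟩ := hu
  have e : ⇑(divMap s ((coord : diskAlg ρ) ^ s * (u : diskAlg ρ))) =
      divMap s ((coord : diskAlg ρ) ^ s) ∘ (fun v => ((u : diskAlg ρ) * v.1, v.2)) := by
    ext1 v
    simp only [Function.comp, divMap_apply, mul_assoc]
  rw [e]
  refine (divMap_coord_pow_bijective hρ s).comp ⟨fun v w h => ?_,
    fun v => ⟨(((u⁻¹ : (diskAlg ρ)ˣ) : diskAlg ρ) * v.1, v.2), ?_⟩⟩
  · rw [Prod.mk.injEq] at h
    exact Prod.ext (u.isUnit.mul_right_injective h.1) h.2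
  · simp

theorem differentiable_divMap (s : ℕ) :
    Differentiable ℂ (divMap s : diskAlg ρ → (diskAlg ρ × (Fin s → ℂ)) →L[ℂ] diskAlg ρ) := by
  have h : Differentiable ℂ fun p : diskAlg ρ => (ContinuousLinearMap.mul ℂ (diskAlg ρ) p).comp
      (ContinuousLinearMap.fst ℂ (diskAlg ρ) (Fin s → ℂ)) :=
    (ContinuousLinearMap.mul ℂ (diskAlg ρ)).differentiable.clm_comp (differentiable_const _)
  exact Differentiable.add_const (𝕜 := ℂ) (E := diskAlg ρ)
    (F := (diskAlg ρ × (Fin s → ℂ)) →L[ℂ] diskAlg ρ) _ h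

end diskAlg

variable {E X Y : Type} [NormedAddCommGroup E] [NormedSpace ℂ E] [NormedAddCommGroup X]
  [NormedSpace ℂ X] [CompleteSpace X] [NormedAddCommGroup Y] [NormedSpace ℂ Y] [CompleteSpace Y]

theorem exists_inverse_family {T : E → X →L[ℂ] Y} {V : Set E} (hV : IsOpen V) {x₀ : E}
    (hx₀ : x₀ ∈ V) (hT : DifferentiableOn ℂ T V) (hb : Function.Bijective (T x₀)) :
    ∃ W ⊆ V, IsOpen W ∧ x₀ ∈ W ∧ ∃ S : E → Y →L[ℂ] X, DifferentiableOn ℂ S W ∧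
      ∀ x ∈ W, (∀ y, T x (S x y) = y) ∧ ∀ v, S x (T x v) = v := by
  let e : X ≃L[ℂ] Y := ContinuousLinearEquiv.ofBijective (T x₀) (LinearMap.ker_eq_bot.2 hb.1)
    (LinearMap.range_eq_top.2 hb.2)
  have he : (e : X →L[ℂ] Y) = T x₀ := ContinuousLinearMap.ext fun _ => rfl
  refine ⟨V ∩ T ⁻¹' Set.range ContinuousLinearEquiv.toContinuousLinearMap, Set.inter_subset_left,
    hT.continuousOn.isOpen_inter_preimage hV ContinuousLinearEquiv.isOpen,
    ⟨hx₀, e, he⟩, fun x => (T x).inverse, ?_, ?_⟩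
  · rintro x ⟨hx, e', he'⟩
    have h1 : DifferentiableAt ℂ ContinuousLinearMap.inverse (T x) := by
      rw [← he']
      exact (contDiffAt_map_inverse (n := 1) e').differentiableAt one_ne_zero
    exact (h1.comp x (hT.differentiableAt (hV.mem_nhds hx))).differentiableWithinAt
  · rintro x ⟨hx, e', he'⟩
    simp only [← he', ContinuousLinearMap.inverse_equiv]
    exact ⟨e'.apply_symm_apply, e'.symm_apply_apply⟩

namespace diskAlg

/-- Holomorphic families in the disk algebra are jointly holomorphic. -/
theorem differentiableOn_uncurry (Q : E → diskAlg ρ) {V : Set E} (hV : IsOpen V)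
    (hQ : DifferentiableOn ℂ Q V) (f : E × ℂ → ℂ)
    (hf : ∀ x ∈ V, ∀ z : closedBall (0 : ℂ) ρ, f (x, z) = ev z (Q x)) :
    DifferentiableOn ℂ f (V ×ˢ ball 0 ρ) := by
  rintro ⟨x₀, z₀⟩ ⟨hx₀, hz₀⟩
  have hx₀ : x₀ ∈ V := hx₀
  have hz₀ : z₀ ∈ ball (0 : ℂ) ρ := hz₀
  let T : ℂ → (diskAlg ρ × ℂ) →L[ℂ] diskAlg ρ := fun w =>
    (ContinuousLinearMap.mul ℂ (diskAlg ρ) (coord - algebraMap ℂ _ w)).comp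
      (ContinuousLinearMap.fst ℂ _ _) +
        (Algebra.linearMap ℂ (diskAlg ρ)).toContinuousLinearMap.comp (ContinuousLinearMap.snd ℂ _ _)
  have hTa : ∀ w v, T w v = (coord - algebraMap ℂ _ w) * v.1 + algebraMap ℂ _ v.2 :=
    fun w v => rfl
  have hT : Differentiable ℂ T := by
    have h1 : Differentiable ℂ fun w : ℂ => (coord : diskAlg ρ) - algebraMap ℂ _ w :=
      (differentiable_const _).sub
        (Algebra.linearMap ℂ (diskAlg ρ)).toContinuousLinearMap.differentiable
    have h2 : Differentiable ℂ fun w : ℂ =>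
        (ContinuousLinearMap.mul ℂ (diskAlg ρ) (coord - algebraMap ℂ _ w)).comp
          (ContinuousLinearMap.fst ℂ (diskAlg ρ) ℂ) :=
      ((ContinuousLinearMap.mul ℂ (diskAlg ρ)).differentiable.comp h1).clm_comp
        (differentiable_const _)
    exact Differentiable.add_const (𝕜 := ℂ) (E := ℂ)
      (F := (diskAlg ρ × ℂ) →L[ℂ] diskAlg ρ) _ h2
  have hevT : ∀ (w : ℂ) (hw : w ∈ ball (0 : ℂ) ρ) v,
      ev ⟨w, ball_subset_closedBall hw⟩ (T w v) = v.2 := by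
    intro w hw v
    simp [hTa, AlgHom.commutes]
  have hb : Function.Bijective (T z₀) := by
    constructor
    · rw [injective_iff_map_eq_zero]
      rintro ⟨h, c⟩ hv
      have hc : c = 0 := by
        have := hevT z₀ hz₀ (h, c)
        rw [hv, map_zero] at this
        exact this.symm
      rw [hTa] at hv
      simp only [hc, map_zero, add_zero] at hv
      exact Prod.ext (eq_zero_of_sub_mul_eq_zero hz₀ hv) hc
    · intro g
      obtain ⟨h, hh⟩ := exists_eq_add_sub_mul hz₀ g
      exact ⟨(h, _), hh.symm⟩
  obtain ⟨W, hWsub, hW, hzW, S, hS, hST⟩ :=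
    exists_inverse_family isOpen_ball hz₀ hT.differentiableOn hb
  have hfeq : ∀ p ∈ V ×ˢ W, f p = (S p.2 (Q p.1)).2 := by
    rintro ⟨x, z⟩ ⟨hx, hz⟩
    have hz' : z ∈ ball (0 : ℂ) ρ := hWsub hz
    have h1 := hf x hx ⟨z, ball_subset_closedBall hz'⟩
    rw [h1]
    have h2 := hevT z hz' (S z (Q x))
    rwa [(hST z hz).1] at h2
  have hnhds : V ×ˢ W ∈ 𝓝 (x₀, z₀) := (hV.prod hW).mem_nhds ⟨hx₀, hzW⟩
  have hd : DifferentiableAt ℂ (fun p : E × ℂ => (S p.2 (Q p.1)).2) (x₀, z₀) := by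
    have h1 : DifferentiableAt ℂ (fun p : E × ℂ => S p.2) (x₀, z₀) :=
      (hS.differentiableAt (hW.mem_nhds hzW)).comp (x₀, z₀) differentiableAt_snd
    have h2 : DifferentiableAt ℂ (fun p : E × ℂ => Q p.1) (x₀, z₀) :=
      (hQ.differentiableAt (hV.mem_nhds hx₀)).comp (x₀, z₀) differentiableAt_fst
    exact (h1.clm_apply h2).snd
  refine (hd.congr_of_eventuallyEq ?_).differentiableWithinAt
  filter_upwards [hnhds] with p hp using hfeq p hp

end diskAlg

end DiskAlgebra

section HolomorphicFamilies

open Metric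

theorem norm_sub_sub_deriv_le {g : ℂ → ℂ} {S M : ℝ} (hS : 2 ≤ S)
    (hg : DifferentiableOn ℂ g (ball 0 S)) (hM : ∀ z ∈ ball (0 : ℂ) S, ‖g z‖ ≤ M) :
    ‖g 1 - g 0 - deriv g 0‖ ≤ 4 * M / S ^ 2 := by
  have hS0 : 0 < S := by linarith
  have h0 : (0 : ℂ) ∈ ball (0 : ℂ) S := mem_ball_self hS0
  have h1 : (1 : ℂ) ∈ ball (0 : ℂ) S := by
    rw [mem_ball_zero_iff, norm_one]; linarith
  have hb : ∀ {k : ℂ → ℂ} {B : ℝ}, DifferentiableOn ℂ k (ball 0 S) →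
      (∀ z ∈ ball (0 : ℂ) S, ‖k z‖ ≤ B) → ∀ z ∈ ball (0 : ℂ) S, ‖dslope k 0 z‖ ≤ 2 * B / S := by
    intro k B hk hB z hz
    refine Complex.norm_dslope_le_div_of_mapsTo_ball hk (fun w hw => ?_) hz
    rw [mem_closedBall, dist_eq_norm]
    calc ‖k w - k 0‖ ≤ ‖k w‖ + ‖k 0‖ := norm_sub_le _ _
      _ ≤ 2 * B := by linarith [hB w hw, hB 0 h0]
  have hd := (Complex.differentiableOn_dslope (isOpen_ball.mem_nhds h0)).2 hg
  have := hb hd (hb hg hM) 1 h1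
  rw [dslope_of_ne _ one_ne_zero, slope_def_field, dslope_of_ne _ one_ne_zero, slope_def_field,
    dslope_same, sub_zero, div_one, div_one] at this
  refine this.trans (le_of_eq ?_)
  field_simp
  ring

variable {E : Type} [NormedAddCommGroup E] [NormedSpace ℂ E]

theorem norm_sub_sub_fderiv_le {F : E → ℂ} {x h : E} {s M : ℝ} (hs : 0 < s) (hh : ‖h‖ ≤ s / 2)
    (hF : DifferentiableOn ℂ F (ball x s)) (hM : ∀ y ∈ ball x s, ‖F y‖ ≤ M) :
    ‖F (x + h) - F x - fderiv ℂ F x h‖ ≤ 4 * M / s ^ 2 * ‖h‖ ^ 2 := by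
  rcases eq_or_ne h 0 with rfl | h0
  · simp
  have hpos : 0 < ‖h‖ := norm_pos_iff.2 h0
  have hmaps : Set.MapsTo (fun t : ℂ => x + t • h) (ball 0 (s / ‖h‖)) (ball x s) := by
    intro t ht
    rw [mem_ball_zero_iff, lt_div_iff₀ hpos] at ht
    rwa [mem_ball, dist_eq_norm, add_sub_cancel_left, norm_smul]
  have hline : ∀ t, HasDerivAt (fun t : ℂ => x + t • h) h t := fun t => by
    simpa using ((hasDerivAt_id t).smul_const h).const_add x
  have hg : DifferentiableOn ℂ (fun t : ℂ => F (x + t • h)) (ball 0 (s / ‖h‖)) :=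
    hF.comp (fun t _ => (hline t).differentiableAt.differentiableWithinAt) hmaps
  have hder : deriv (fun t : ℂ => F (x + t • h)) 0 = fderiv ℂ F x h := by
    have hF0 : HasFDerivAt F (fderiv ℂ F x) (x + (0 : ℂ) • h) := by
      rw [zero_smul, add_zero]
      exact (hF.differentiableAt (isOpen_ball.mem_nhds (mem_ball_self hs))).hasFDerivAt
    exact (hF0.comp_hasDerivAt (0 : ℂ) (hline 0)).deriv
  have h2 : 2 ≤ s / ‖h‖ := by rw [le_div_iff₀ hpos]; linarith
  have := norm_sub_sub_deriv_le h2 hg fun t ht => hM _ (hmaps ht)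
  simp only [one_smul, zero_smul, add_zero, hder] at this
  refine this.trans (le_of_eq ?_)
  field_simp

theorem diskAlg.norm_le_of_ev {ρ : ℝ} {g : diskAlg ρ} {C : ℝ} (hC : 0 ≤ C)
    (h : ∀ z, ‖diskAlg.ev z g‖ ≤ C) : ‖g‖ ≤ C :=
  (ContinuousMap.norm_le g.1 hC).2 h

/-- A jointly holomorphic function is a holomorphic family in the disk algebra. -/
theorem exists_diskAlg_family [FiniteDimensional ℂ E] {R ρ : ℝ} (hρ : 0 < ρ) (hρR : ρ < R)
    {f : E × ℂ → ℂ} (hf : DifferentiableOn ℂ f (ball 0 R)) :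
    ∃ Q : E → diskAlg ρ, DifferentiableOn ℂ Q (ball 0 ρ) ∧
      ∀ x ∈ ball (0 : E) ρ, ∀ z : closedBall (0 : ℂ) ρ, diskAlg.ev z (Q x) = f (x, z) := by
  have hball : ∀ x ∈ closedBall (0 : E) ρ, ∀ z ∈ closedBall (0 : ℂ) ρ,
      (x, z) ∈ ball (0 : E × ℂ) R := by
    intro x hx z hz
    rw [mem_closedBall_zero_iff] at hx hz
    rw [mem_ball_zero_iff, Prod.norm_mk]
    exact (max_le hx hz).trans_lt hρR
  have hex : ∀ x, ∃ q : diskAlg ρ, x ∈ ball (0 : E) ρ → ∀ z : closedBall (0 : ℂ) ρ,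
      diskAlg.ev z q = f (x, z) := by
    intro x
    by_cases hx : x ∈ ball (0 : E) ρ
    · have hd : DifferentiableOn ℂ (fun z => f (x, z)) (closedBall 0 ρ) :=
        hf.comp ((differentiable_const x).prodMk differentiable_id).differentiableOn
          fun z hz => hball x (ball_subset_closedBall hx) z hz
      exact ⟨diskAlg.ofFun _ hd.continuousOn (hd.mono ball_subset_closedBall), fun _ z => rfl⟩
    · exact ⟨0, fun h => absurd h hx⟩
  choose Q hQ using hex
  refine ⟨Q, ?_, hQ⟩
  have hprop : ProperSpace E := FiniteDimensional.proper ℂ E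
  obtain ⟨M, hM⟩ : ∃ M, ∀ p ∈ closedBall (0 : E × ℂ) ρ, ‖f p‖ ≤ M :=
    (isCompact_closedBall _ _).exists_bound_of_continuousOn
      (hf.continuousOn.mono (closedBall_subset_ball hρR))
  have hM0 : 0 ≤ M := (norm_nonneg _).trans (hM 0 (mem_closedBall_self hρ.le))
  intro x hx
  obtain ⟨s, hs, hsx⟩ := Metric.isOpen_iff.1 isOpen_ball x hx
  set C := 4 * M / s ^ 2 with hC
  have hC0 : 0 ≤ C := by positivity
  let L : ℂ → E →L[ℂ] ℂ := fun z => fderiv ℂ (fun y => f (y, z)) x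
  have est : ∀ h : E, ‖h‖ ≤ s / 2 → ∀ z : closedBall (0 : ℂ) ρ,
      ‖diskAlg.ev z (Q (x + h) - Q x) - L z h‖ ≤ C * ‖h‖ ^ 2 := by
    intro h hh z
    have hxh : x + h ∈ ball (0 : E) ρ := hsx (by
      rw [mem_ball, dist_eq_norm, add_sub_cancel_left]; linarith)
    rw [map_sub, hQ _ hxh, hQ _ hx]
    refine norm_sub_sub_fderiv_le hs hh (F := fun y => f (y, z)) ?_ ?_
    · exact hf.comp (differentiable_id.prodMk (differentiable_const (z : ℂ))).differentiableOn
        fun y hy => hball y (ball_subset_closedBall (hsx hy)) z z.2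
    · intro y hy
      refine hM _ ?_
      have h1 := ball_subset_closedBall (hsx hy)
      have h2 := z.2
      rw [mem_closedBall_zero_iff] at h1 h2 ⊢
      exact max_le h1 h2
  have hmem : ∀ h : E, ∃ ℓ : diskAlg ρ, ∀ z : closedBall (0 : ℂ) ρ, diskAlg.ev z ℓ = L z h := by
    intro h
    obtain ⟨κ, hκ, hκh⟩ : ∃ κ : ℝ, 0 < κ ∧ κ * ‖h‖ ≤ s / 2 := by
      refine ⟨s / 2 / (‖h‖ + 1), by positivity, ?_⟩
      rw [div_mul_eq_mul_div, div_le_iff₀ (by positivity)]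
      nlinarith [norm_nonneg h]
    let t : ℕ → ℝ := fun n => κ / (n + 1)
    have ht : ∀ n, 0 < t n := fun n => by positivity
    have htκ : ∀ n, t n ≤ κ := fun n => div_le_self hκ.le (by linarith [n.cast_nonneg (α := ℝ)])
    have hnt : ∀ n, ‖(t n : ℂ)‖ = t n := fun n => by
      rw [Complex.norm_real, Real.norm_of_nonneg (ht n).le]
    let Δ : ℕ → diskAlg ρ := fun n => (t n : ℂ)⁻¹ • (Q (x + (t n : ℂ) • h) - Q x)
    have hΔ : ∀ n (z : closedBall (0 : ℂ) ρ), ‖diskAlg.ev z (Δ n) - L z h‖ ≤ C * ‖h‖ ^ 2 * t n := by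
      intro n z
      have h1 := est ((t n : ℂ) • h) (by
        rw [norm_smul, hnt]
        exact (mul_le_mul_of_nonneg_right (htκ n) (norm_nonneg h)).trans hκh) z
      have hne : (t n : ℂ) ≠ 0 := by exact_mod_cast (ht n).ne'
      have h2 : diskAlg.ev z (Δ n) - L z h =
          (t n : ℂ)⁻¹ * (diskAlg.ev z (Q (x + (t n : ℂ) • h) - Q x) - L z ((t n : ℂ) • h)) := by
        simp only [Δ, map_smul, smul_eq_mul]
        rw [mul_sub, inv_mul_cancel_left₀ hne]
      rw [h2, norm_mul, norm_inv, hnt]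
      refine (mul_le_mul_of_nonneg_left h1 (inv_nonneg.2 (ht n).le)).trans (le_of_eq ?_)
      rw [norm_smul, hnt]
      have := (ht n).ne'
      field_simp
    have htend : Tendsto t atTop (𝓝 0) := by
      simpa [t, div_eq_mul_inv] using
        (tendsto_one_div_add_atTop_nhds_zero_nat (𝕜 := ℝ)).const_mul κ
    have hanti : ∀ {n m}, n ≤ m → t m ≤ t n := fun {n m} hnm => by
      have : (n : ℝ) ≤ m := by exact_mod_cast hnm
      exact div_le_div_of_nonneg_left hκ.le (by positivity) (by linarith)
    have hK : 0 ≤ C * ‖h‖ ^ 2 := by positivity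
    have hcau : CauchySeq Δ := by
      refine cauchySeq_of_le_tendsto_0 (fun n => 2 * (C * ‖h‖ ^ 2 * t n)) (fun n m N hn hm => ?_) ?_
      · rw [dist_eq_norm]
        refine diskAlg.norm_le_of_ev (by have := ht N; positivity) fun z => ?_
        rw [map_sub]
        calc _ = ‖(diskAlg.ev z (Δ n) - L z h) - (diskAlg.ev z (Δ m) - L z h)‖ := by
              rw [sub_sub_sub_cancel_right]
          _ ≤ _ := norm_sub_le _ _
          _ ≤ C * ‖h‖ ^ 2 * t n + C * ‖h‖ ^ 2 * t m := add_le_add (hΔ n z) (hΔ m z)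
          _ ≤ _ := by nlinarith [hanti hn, hanti hm]
      · simpa using (htend.const_mul (C * ‖h‖ ^ 2)).const_mul 2
    obtain ⟨ℓ, hℓ⟩ := cauchySeq_tendsto_of_complete hcau
    refine ⟨ℓ, fun z => ?_⟩
    have h1 : Tendsto (fun n => diskAlg.ev z (Δ n)) atTop (𝓝 (diskAlg.ev z ℓ)) :=
      ((diskAlg.evL z).continuous.tendsto ℓ).comp hℓ
    have h2 : Tendsto (fun n => diskAlg.ev z (Δ n)) atTop (𝓝 (L z h)) := by
      rw [tendsto_iff_norm_sub_tendsto_zero]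
      refine squeeze_zero (fun _ => norm_nonneg _) (fun n => hΔ n z) ?_
      simpa using htend.const_mul (C * ‖h‖ ^ 2)
    exact tendsto_nhds_unique h1 h2
  choose ℓ hℓ using hmem
  let ℓl : E →ₗ[ℂ] diskAlg ρ :=
    { toFun := ℓ
      map_add' := fun a b => diskAlg.ext_ev fun z => by simp [hℓ]
      map_smul' := fun c a => diskAlg.ext_ev fun z => by simp [hℓ] }
  have hder : HasFDerivAt Q (LinearMap.toContinuousLinearMap ℓl) x := by
    rw [hasFDerivAt_iff_isLittleO_nhds_zero]
    have hO : (fun h => Q (x + h) - Q x - LinearMap.toContinuousLinearMap ℓl h) =O[𝓝 0]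
        fun h : E => ‖h‖ ^ 2 := by
      refine Asymptotics.IsBigO.of_bound C ?_
      filter_upwards [closedBall_mem_nhds (0 : E) (half_pos hs)] with h hh
      rw [mem_closedBall_zero_iff] at hh
      refine diskAlg.norm_le_of_ev (by positivity) fun z => ?_
      rw [map_sub]
      have : diskAlg.ev z (LinearMap.toContinuousLinearMap ℓl h) = L z h := hℓ h z
      rw [this, Real.norm_of_nonneg (by positivity)]
      exact est h hh z
    refine hO.trans_isLittleO ?_
    exact Asymptotics.isLittleO_norm_pow_id one_lt_two
  exact hder.differentiableAt.differentiableWithinAt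

end HolomorphicFamilies

section Weierstrass

open Metric Polynomial

/-- The polynomial `∑ c_j X^j` of degree less than `s`. -/
noncomputable def lowPoly {A : Type} [CommRing A] {s : ℕ} (c : Fin s → A) : A[X] :=
  ∑ j, C (c j) * X ^ (j : ℕ)

/-- The monic polynomial `X^r + ∑ c_j X^j`. -/
noncomputable def monicPoly {A : Type} [CommRing A] {r : ℕ} (c : Fin r → A) : A[X] :=
  X ^ r + lowPoly c

section

variable {A B : Type} [CommRing A] [CommRing B]

theorem degree_lowPoly_lt {s : ℕ} (c : Fin s → A) : (lowPoly c).degree < s :=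
  degree_sum_fin_lt c

theorem monic_monicPoly {r : ℕ} (c : Fin r → A) : (monicPoly c).Monic :=
  monic_X_pow_add (degree_lowPoly_lt c)

theorem degree_monicPoly [Nontrivial A] {r : ℕ} (c : Fin r → A) : (monicPoly c).degree = r := by
  rw [monicPoly, degree_add_eq_left_of_degree_lt, degree_X_pow]
  rw [degree_X_pow]
  exact degree_lowPoly_lt c

theorem map_lowPoly (φ : A →+* B) {s : ℕ} (c : Fin s → A) :
    (lowPoly c).map φ = lowPoly fun j => φ (c j) := by
  simp [lowPoly, Polynomial.map_sum]

theorem map_monicPoly (φ : A →+* B) {s : ℕ} (c : Fin s → A) :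
    (monicPoly c).map φ = monicPoly fun j => φ (c j) := by
  simp [monicPoly, map_lowPoly]

theorem eval_lowPoly {s : ℕ} (c : Fin s → A) (z : A) :
    (lowPoly c).eval z = ∑ j, c j * z ^ (j : ℕ) := by
  simp [lowPoly, eval_finsetSum]

theorem eval_monicPoly {s : ℕ} (c : Fin s → A) (z : A) :
    (monicPoly c).eval z = z ^ s + ∑ j, c j * z ^ (j : ℕ) := by
  simp [monicPoly, eval_lowPoly]

theorem eq_lowPoly_of_degree_lt {s : ℕ} {f : A[X]} (hf : f.degree < s) :
    f = lowPoly fun j : Fin s => f.coeff j := by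
  rcases eq_or_ne f 0 with rfl | h0
  · simp [lowPoly]
  rw [lowPoly, Fin.sum_univ_eq_sum_range (fun j => C (f.coeff j) * X ^ j) s]
  exact f.as_sum_range_C_mul_X_pow' ((natDegree_lt_iff_degree_lt h0).2 hf)

theorem MvPolynomial.dvd_aeval_sub_aeval [Algebra ℂ A] {κ : Type} {m : A} {f g : κ → A}
    (h : ∀ k, m ∣ f k - g k) (p : MvPolynomial κ ℂ) :
    m ∣ MvPolynomial.aeval f p - MvPolynomial.aeval g p := by
  induction p using MvPolynomial.induction_on with
  | C c => simp
  | add p q hp hq =>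
    rw [map_add, map_add, add_sub_add_comm]
    exact dvd_add hp hq
  | mul_X p k hp =>
    rw [map_mul, map_mul, MvPolynomial.aeval_X, MvPolynomial.aeval_X]
    have : MvPolynomial.aeval f p * f k - MvPolynomial.aeval g p * g k =
        (MvPolynomial.aeval f p - MvPolynomial.aeval g p) * f k +
          MvPolynomial.aeval g p * (f k - g k) := by ring
    rw [this]
    exact dvd_add (hp.mul_right _) ((h k).mul_left _)

end

namespace diskAlg

variable {ρ : ℝ}

theorem aeval_lowPoly {s : ℕ} (c : Fin s → ℂ) :
    aeval (coord : diskAlg ρ) (lowPoly c) = polyPart ρ s c := by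
  rw [polyPart_apply, lowPoly, map_sum]
  refine Finset.sum_congr rfl fun j _ => ?_
  rw [map_mul, aeval_C, map_pow, aeval_X, Algebra.smul_def]

theorem ev_aeval (z : closedBall (0 : ℂ) ρ) (f : ℂ[X]) :
    ev z (aeval (coord : diskAlg ρ) f) = f.eval (z : ℂ) := by
  rw [← aeval_algHom_apply, ev_coord, coe_aeval_eq_eval]

theorem dvd_of_aeval_dvd {s : ℕ} {m f : ℂ[X]} (hm : m.Monic) (hs : m.degree = s)
    (hinj : Function.Injective (divMap s (aeval (coord : diskAlg ρ) m)))
    (h : aeval (coord : diskAlg ρ) m ∣ aeval (coord : diskAlg ρ) f) : m ∣ f := by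
  obtain ⟨h, hh⟩ := h
  have hlt : (f %ₘ m).degree < s := hs ▸ degree_modByMonic_lt f hm
  have hlow := eq_lowPoly_of_degree_lt hlt
  rw [← modByMonic_eq_zero_iff_dvd hm]
  set c : Fin s → ℂ := fun j => (f %ₘ m).coeff j
  have h1 : aeval (coord : diskAlg ρ) f = aeval (coord : diskAlg ρ) m *
      aeval (coord : diskAlg ρ) (f /ₘ m) + polyPart ρ s c := by
    rw [← aeval_lowPoly, ← hlow, ← map_mul, ← map_add, add_comm, modByMonic_add_div]
  have h2 : divMap s (aeval (coord : diskAlg ρ) m) (aeval (coord : diskAlg ρ) (f /ₘ m), c) =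
      divMap s (aeval (coord : diskAlg ρ) m) (h, 0) := by
    rw [divMap_apply, divMap_apply, ← h1, hh]
    simp
  have h3 := hinj h2
  rw [Prod.mk.injEq] at h3
  rw [hlow, h3.2]
  simp [lowPoly]

theorem divMap_mul_injective {s : ℕ} {d q : diskAlg ρ} (hq : IsUnit q)
    (h : Function.Injective (divMap s d)) : Function.Injective (divMap s (d * q)) := by
  intro v w hvw
  have : divMap s d (q * v.1, v.2) = divMap s d (q * w.1, w.2) := by
    simp only [divMap_apply, mul_assoc] at hvw ⊢
    exact hvw
  have h2 := h this
  rw [Prod.mk.injEq] at h2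
  exact Prod.ext (hq.mul_right_injective h2.1) h2.2

end diskAlg

variable {E : Type} [NormedAddCommGroup E] [NormedSpace ℂ E]

theorem DifferentiableOn.mvPolynomial_aeval {A κ : Type} [NormedCommRing A] [NormedAlgebra ℂ A]
    {V : Set E} {f : κ → E → A} (hf : ∀ k, DifferentiableOn ℂ (f k) V) (p : MvPolynomial κ ℂ) :
    DifferentiableOn ℂ (fun x => MvPolynomial.aeval (fun k => f k x) p) V := by
  induction p using MvPolynomial.induction_on with
  | C c => simp only [MvPolynomial.aeval_C]; exact differentiableOn_const _
  | add p q hp hq => simp only [map_add]; exact hp.add hq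
  | mul_X p k hp => simp only [map_mul, MvPolynomial.aeval_X]; exact hp.mul (hf k)

theorem diskAlg.differentiableOn_divMap {ρ : ℝ} (s : ℕ) {V : Set E} {d : E → diskAlg ρ}
    (hd : DifferentiableOn ℂ d V) : DifferentiableOn ℂ (fun x => diskAlg.divMap s (d x)) V :=
  Differentiable.comp_differentiableOn (F := diskAlg ρ)
    (G := (diskAlg ρ × (Fin s → ℂ)) →L[ℂ] diskAlg ρ) (diskAlg.differentiable_divMap s) hd

theorem exists_local_factorization {g : ℂ → ℂ} {R : ℝ} (hR : 0 < R)
    (hg : DifferentiableOn ℂ g (ball 0 R)) (h0 : ¬ ∀ᶠ z in 𝓝 (0 : ℂ), g z = 0) :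
    ∃ (r : ℕ) (ρ : ℝ) (u : diskAlg ρ), 0 < ρ ∧ ρ < R ∧ IsUnit u ∧
      ∀ z : closedBall (0 : ℂ) ρ, g z = z ^ r * diskAlg.ev z u := by
  have han : AnalyticAt ℂ g 0 := hg.analyticAt (isOpen_ball.mem_nhds (mem_ball_self hR))
  obtain ⟨r, u, hu, hu0, hgu⟩ := han.exists_eventuallyEq_pow_smul_nonzero_iff.2 h0
  have hne : ∀ᶠ z in 𝓝 (0 : ℂ), u z ≠ 0 := hu.continuousAt.eventually_ne hu0
  have hdiff : ∀ᶠ z in 𝓝 (0 : ℂ), DifferentiableAt ℂ u z :=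
    hu.eventually_analyticAt.mono fun z hz => hz.differentiableAt
  obtain ⟨s, hs, hball⟩ := Metric.eventually_nhds_iff_ball.1 (hgu.and (hne.and hdiff))
  set ρ := min (s / 2) (R / 2) with hρ
  have hsub : closedBall (0 : ℂ) ρ ⊆ ball 0 s :=
    closedBall_subset_ball ((min_le_left _ _).trans_lt (by linarith))
  have hd : DifferentiableOn ℂ u (closedBall 0 ρ) := fun z hz =>
    (hball z (hsub hz)).2.2.differentiableWithinAt
  refine ⟨r, ρ, diskAlg.ofFun u hd.continuousOn (hd.mono ball_subset_closedBall),
    lt_min (by linarith) (by linarith), (min_le_right _ _).trans_lt (by linarith),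
    diskAlg.isUnit_of_ev_ne_zero _ fun z => (hball z (hsub z.2)).2.1, fun z => ?_⟩
  have := (hball z (hsub z.2)).1
  rwa [sub_zero, smul_eq_mul] at this

set_option maxHeartbeats 1000000 in
/-- Weierstrass preparation for `δ(w)` and division of `w` by the square of its
distinguished polynomial. -/
theorem exists_weierstrass_data [FiniteDimensional ℂ E] {κ : Type} {R : ℝ} (hR : 0 < R)
    (w : κ → E × ℂ → ℂ) (hw : ∀ k, DifferentiableOn ℂ (w k) (ball 0 R)) [Finite κ]
    (δ : MvPolynomial κ ℂ)
    (hδ : ¬ ∀ᶠ z in 𝓝 (0 : ℂ), MvPolynomial.eval (fun k => w k (0, z)) δ = 0) :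
    ∃ (r : ℕ) (ρ : ℝ) (α : Fin r → E → ℂ) (Y : κ → Fin (2 * r) → E → ℂ) (Q : κ → E × ℂ → ℂ)
      (q : E × ℂ → ℂ), 0 < ρ ∧ ρ ≤ R ∧ (∀ j, DifferentiableOn ℂ (α j) (ball 0 ρ)) ∧
      (∀ k j, DifferentiableOn ℂ (Y k j) (ball 0 ρ)) ∧
      (∀ k, DifferentiableOn ℂ (Q k) (ball 0 ρ)) ∧
      ∀ x ∈ ball (0 : E) ρ, ContinuousOn (fun z => q (x, z)) (ball 0 ρ) ∧
        (∀ z ∈ ball (0 : ℂ) ρ, q (x, z) ≠ 0 ∧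
          (∀ k, w k (x, z) = Q k (x, z) * (monicPoly fun j => α j x).eval z ^ 2 +
            (lowPoly fun j => Y k j x).eval z) ∧
          MvPolynomial.eval (fun k => w k (x, z)) δ =
            q (x, z) * (monicPoly fun j => α j x).eval z) ∧
        (∀ p : MvPolynomial κ ℂ,
          (∀ y ∈ ball (0 : E × ℂ) R, MvPolynomial.eval (fun k => w k y) p = 0) →
          (monicPoly fun j => α j x) ^ 2 ∣
            MvPolynomial.aeval (fun k => lowPoly fun j => Y k j x) p) ∧
        (monicPoly fun j => α j x) ∣
          MvPolynomial.aeval (fun k => lowPoly fun j => Y k j x) δ := by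
  classical
  have hg : DifferentiableOn ℂ (fun z => MvPolynomial.eval (fun k => w k (0, z)) δ) (ball 0 R) := by
    refine DifferentiableOn.mvPolynomial_aeval (f := fun k z => w k (0, z)) (fun k => ?_) δ
    refine (hw k).comp ((differentiable_const _).prodMk differentiable_id).differentiableOn ?_
    intro z hz
    rw [mem_ball_zero_iff] at hz ⊢
    rw [Prod.norm_mk]
    exact max_lt (by rwa [norm_zero]) hz
  obtain ⟨r, ρ, u, hρ, hρR, hu, hgu⟩ := exists_local_factorization hR hg hδ
  choose W hWd hW using fun k => exists_diskAlg_family (E := E) hρ hρR (hw k)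
  let d : E → diskAlg ρ := fun x => MvPolynomial.aeval (fun k => W k x) δ
  have hd : DifferentiableOn ℂ d (ball 0 ρ) := DifferentiableOn.mvPolynomial_aeval hWd δ
  have hmem0 : (0 : E) ∈ ball (0 : E) ρ := mem_ball_self hρ
  have hev : ∀ x ∈ ball (0 : E) ρ, ∀ (z : closedBall (0 : ℂ) ρ) (p : MvPolynomial κ ℂ),
      diskAlg.ev z (MvPolynomial.aeval (fun k => W k x) p) =
        MvPolynomial.eval (fun k => w k (x, z)) p := by
    intro x hx z p
    rw [← MvPolynomial.aeval_eq_eval, MvPolynomial.comp_aeval_apply]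
    simp only [hW _ x hx]
  have hd0 : d 0 = diskAlg.coord ^ r * u := diskAlg.ext_ev fun z => by
    rw [hev 0 hmem0, hgu z, map_mul, map_pow, diskAlg.ev_coord]
  have hT : DifferentiableOn ℂ (fun x => diskAlg.divMap r (d x)) (ball 0 ρ) :=
    diskAlg.differentiableOn_divMap r hd
  have hTb : Function.Bijective (diskAlg.divMap r (d 0)) := by
    rw [hd0]
    exact diskAlg.divMap_bijective hρ r hu
  obtain ⟨V, hVsub, hV, h0V, S, hS, hST⟩ := exists_inverse_family isOpen_ball hmem0 hT hTb
  let q : E → diskAlg ρ := fun x => (S x (diskAlg.coord ^ r)).1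
  let α : Fin r → E → ℂ := fun j x => -(S x (diskAlg.coord ^ r)).2 j
  have hSd : DifferentiableOn ℂ (fun x => S x (diskAlg.coord ^ r)) V :=
    hS.clm_apply (differentiableOn_const _)
  have hq : DifferentiableOn ℂ q V := hSd.fst
  have hα : ∀ j, DifferentiableOn ℂ (α j) V := fun j =>
    (differentiableOn_pi.1 hSd.snd j).neg
  let a : E → diskAlg ρ := fun x => aeval diskAlg.coord (monicPoly fun j => α j x)
  have ha : ∀ x ∈ V, a x = d x * q x := by
    intro x hx
    have h1 := (hST x hx).1 (diskAlg.coord ^ r)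
    rw [diskAlg.divMap_apply] at h1
    have h2 : aeval diskAlg.coord (lowPoly fun j => α j x) =
        -diskAlg.polyPart ρ r (S x (diskAlg.coord ^ r)).2 := by
      rw [diskAlg.aeval_lowPoly, ← map_neg]; rfl
    simp only [a, monicPoly, map_add, map_pow, aeval_X]
    rw [h2, ← sub_eq_add_neg, sub_eq_iff_eq_add]
    exact h1.symm
  obtain ⟨u', rfl⟩ := hu
  have hS0 : S 0 (diskAlg.coord ^ r) = (((u'⁻¹ : (diskAlg ρ)ˣ) : diskAlg ρ), 0) := by
    rw [← (hST 0 h0V).2 ((((u'⁻¹ : (diskAlg ρ)ˣ) : diskAlg ρ), 0))]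
    congr 1
    simp [diskAlg.divMap_apply, hd0]
  have hq0 : IsUnit (q 0) := by
    simp only [q, hS0]
    exact u'⁻¹.isUnit
  have ha0 : a 0 = diskAlg.coord ^ r := by
    rw [ha 0 h0V, hd0]
    simp [q, hS0]
  let V' : Set E := V ∩ q ⁻¹' {v | IsUnit v}
  have hV' : IsOpen V' := hq.continuousOn.isOpen_inter_preimage hV Units.isOpen
  have haV' : DifferentiableOn ℂ (fun x => a x ^ 2) V' :=
    (((hd.mono hVsub).mul hq).congr ha).pow 2 |>.mono Set.inter_subset_left
  have hT₂ : DifferentiableOn ℂ (fun x => diskAlg.divMap (2 * r) (a x ^ 2)) V' :=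
    diskAlg.differentiableOn_divMap (2 * r) haV'
  have hT₂b : Function.Bijective (diskAlg.divMap (2 * r) (a 0 ^ 2)) := by
    rw [ha0, ← pow_mul, mul_comm r 2]
    simpa using diskAlg.divMap_bijective hρ (2 * r) isUnit_one
  obtain ⟨V₂, hV₂sub, hV₂, h0V₂, S₂, hS₂, hST₂⟩ := exists_inverse_family hV'
    (show (0 : E) ∈ V' from ⟨h0V, hq0⟩) hT₂ hT₂b
  obtain ⟨ε, hε, hεsub⟩ := Metric.isOpen_iff.1 hV₂ 0 h0V₂
  have hSW : ∀ k, DifferentiableOn ℂ (fun x => S₂ x (W k x)) V₂ := fun k =>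
    hS₂.clm_apply ((hWd k).mono fun x hx => hVsub (hV₂sub hx).1)
  have hunit : ∀ x, ∃ v : diskAlg ρ, x ∈ V' → q x * v = 1 := by
    intro x
    by_cases hx : x ∈ V'
    · obtain ⟨v, hv⟩ := hx.2.exists_right_inv
      exact ⟨v, fun _ => hv⟩
    · exact ⟨0, fun h => absurd h hx⟩
  choose v hv using hunit
  let evx : ℂ → diskAlg ρ → ℂ := fun z g => if hz : z ∈ closedBall (0 : ℂ) ρ then
    diskAlg.ev ⟨z, hz⟩ g else 0
  have hevx : ∀ (z : closedBall (0 : ℂ) ρ) g, evx z g = diskAlg.ev z g := fun z g => by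
    simp only [evx, dif_pos z.2]
  have hsub : ball (0 : E) (min ρ ε) ⊆ V₂ := (ball_subset_ball (min_le_right _ _)).trans hεsub
  have hsubρ : ball (0 : ℂ) (min ρ ε) ⊆ ball 0 ρ := ball_subset_ball (min_le_left _ _)
  refine ⟨r, min ρ ε, α, fun k j x => (S₂ x (W k x)).2 j, fun k y => evx y.2 (S₂ y.1 (W k y.1)).1,
    fun y => evx y.2 (v y.1), lt_min hρ hε, (min_le_left _ _).trans hρR.le,
    fun j => (hα j).mono fun x hx => (hV₂sub (hsub hx)).1,
    fun k j => (differentiableOn_pi.1 (hSW k).snd j).mono hsub, fun k => ?_, fun x hx => ?_⟩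
  · refine (diskAlg.differentiableOn_uncurry (fun x => (S₂ x (W k x)).1) hV₂ (hSW k).fst _
      fun x _ z => hevx z _).mono ?_
    rintro ⟨x, z⟩ hxz
    rw [← ball_prod_same] at hxz
    exact ⟨hsub hxz.1, hsubρ hxz.2⟩
  have hxV₂ := hsub hx
  have hxV' := hV₂sub hxV₂
  have hxV : x ∈ V := hxV'.1
  have hxρ : x ∈ ball (0 : E) ρ := hVsub hxV
  have hda : d x = a x * v x := by
    rw [ha x hxV, mul_assoc, hv x hxV', mul_one]
  have hWk : ∀ k, W k x = a x ^ 2 * (S₂ x (W k x)).1 +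
      aeval diskAlg.coord (lowPoly fun j => (S₂ x (W k x)).2 j) := by
    intro k
    have := (hST₂ x hxV₂).1 (W k x)
    rw [diskAlg.divMap_apply, ← diskAlg.aeval_lowPoly] at this
    exact this.symm
  have haev : ∀ p : MvPolynomial κ ℂ, aeval (diskAlg.coord : diskAlg ρ) (MvPolynomial.aeval
      (fun k => lowPoly fun j => (S₂ x (W k x)).2 j) p) = MvPolynomial.aeval
        (fun k => aeval (diskAlg.coord : diskAlg ρ) (lowPoly fun j => (S₂ x (W k x)).2 j)) p :=
    fun p => MvPolynomial.comp_aeval_apply _ _ _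
  have hdvd : ∀ p : MvPolynomial κ ℂ, a x ^ 2 ∣ MvPolynomial.aeval (fun k => W k x) p -
      MvPolynomial.aeval
        (fun k => aeval (diskAlg.coord : diskAlg ρ) (lowPoly fun j => (S₂ x (W k x)).2 j)) p := by
    refine MvPolynomial.dvd_aeval_sub_aeval fun k => ?_
    rw [sub_eq_iff_eq_add.2 (hWk k)]
    exact dvd_mul_right _ _
  refine ⟨?_, fun z hz => ?_, fun p hp => ?_, ?_⟩
  · have h1 : ContinuousOn (fun z => evx z (v x)) (closedBall 0 ρ) := by
      rw [continuousOn_iff_continuous_domRestrict]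
      exact (diskAlg.continuous_ev (v x)).congr fun z => (hevx z _).symm
    exact h1.mono (hsubρ.trans ball_subset_closedBall)
  · have hz' := ball_subset_closedBall (hsubρ hz)
    have haz : (monicPoly fun j => α j x).eval z = diskAlg.ev ⟨z, hz'⟩ (a x) :=
      (diskAlg.ev_aeval ⟨z, hz'⟩ _).symm
    refine ⟨?_, fun k => ?_, ?_⟩
    · intro h0
      have h1 := congrArg (diskAlg.ev ⟨z, hz'⟩) (hv x hxV')
      rw [map_mul, map_one, ← hevx ⟨z, hz'⟩ (v x)] at h1
      simp only [h0, mul_zero, zero_ne_one] at h1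
    · have h1 := congrArg (diskAlg.ev ⟨z, hz'⟩) (hWk k)
      rw [hW k x hxρ, map_add, map_mul, map_pow, ← haz, diskAlg.ev_aeval] at h1
      rw [h1, mul_comm]
      simp only [evx, dif_pos hz']
    · have h1 := congrArg (diskAlg.ev ⟨z, hz'⟩) hda
      rw [hev x hxρ, map_mul, ← haz] at h1
      rw [h1, mul_comm]
      simp only [evx, dif_pos hz']
  · have hp0 : MvPolynomial.aeval (fun k => W k x) p = 0 := diskAlg.ext_ev fun z => by
      rw [hev x hxρ, map_zero]
      refine hp _ ?_
      have hz := z.2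
      rw [mem_closedBall_zero_iff] at hz
      rw [mem_ball_zero_iff] at hxρ ⊢
      exact max_lt (hxρ.trans hρR) (hz.trans_lt hρR)
    have h1 := hdvd p
    rw [hp0, zero_sub, dvd_neg] at h1
    refine diskAlg.dvd_of_aeval_dvd (ρ := ρ) (s := 2 * r) ((monic_monicPoly _).pow 2) ?_ ?_ ?_
    · rw [degree_pow, degree_monicPoly]
      simp [two_mul]
    · rw [map_pow]
      exact Function.LeftInverse.injective (hST₂ x hxV₂).2
    · rw [haev, map_pow]
      exact h1
  · have h1 := (dvd_pow_self (a x) two_ne_zero).trans (hdvd δ)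
    have h2 : a x ∣ d x := ⟨_, hda⟩
    have h3 := (dvd_sub_right h2).1 h1
    refine diskAlg.dvd_of_aeval_dvd (ρ := ρ) (s := r) (monic_monicPoly _) (degree_monicPoly _) ?_ ?_
    · have := diskAlg.divMap_mul_injective hxV'.2 (Function.LeftInverse.injective (hST x hxV).2)
      rw [← ha x hxV] at this
      exact this
    · rw [haev]
      exact h3

end Weierstrass

section UnrestrictedNashApproximation

open Metric

/-- Holomorphic functions near the origin can be approximated by globally defined Nash
functions (in fact by polynomials), with a radius depending only on the domain. -/
def UnrestrictedApprox (E : Type) [NormedAddCommGroup E] [NormedSpace ℂ E] : Prop :=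
  ∀ R > 0, ∃ r > 0, ∀ f : E → ℂ, DifferentiableOn ℂ f (ball 0 R) → ∀ ε > 0,
    ∃ g : E → ℂ, NashOn Set.univ g ∧ ∀ x ∈ ball (0 : E) r, ‖f x - g x‖ < ε

variable {E E' : Type} [NormedAddCommGroup E] [NormedSpace ℂ E] [NormedAddCommGroup E']
  [NormedSpace ℂ E']

theorem ContinuousLinearEquiv.exists_ball_subset (e : E ≃L[ℂ] E') {R : ℝ} (hR : 0 < R) :
    ∃ r > 0, ∀ x ∈ ball (0 : E) r, e x ∈ ball (0 : E') R := by
  have : e ⁻¹' ball 0 R ∈ 𝓝 (0 : E) :=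
    e.continuous.continuousAt.preimage_mem_nhds (by simpa using ball_mem_nhds 0 hR)
  obtain ⟨r, hr, h⟩ := Metric.mem_nhds_iff.1 this
  exact ⟨r, hr, fun x hx => h hx⟩

theorem UnrestrictedApprox.transfer (e : E ≃L[ℂ] E') (h : UnrestrictedApprox E) :
    UnrestrictedApprox E' := by
  intro R hR
  obtain ⟨R', hR', hRR⟩ := e.exists_ball_subset hR
  obtain ⟨r', hr', H⟩ := h R' hR'
  obtain ⟨r, hr, hrr⟩ := e.symm.exists_ball_subset hr'
  refine ⟨r, hr, fun f hf ε hε => ?_⟩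
  obtain ⟨g, hg, hfg⟩ := H (fun x => f (e x)) (hf.comp e.differentiable.differentiableOn hRR) ε hε
  refine ⟨fun y => g (e.symm y), ?_, fun y hy => ?_⟩
  · simpa using hg.comp_affine isOpen_univ Set.univ_nonempty isOpen_univ convex_univ
      (e.symm : E' →L[ℂ] E) e.symm.toHomeomorph.isOpenMap 0 (fun _ _ => Set.mem_univ _)
  · simpa using hfg (e.symm y) (hrr y hy)

namespace diskAlg

variable {ρ : ℝ}

theorem exists_shift (hρ : 0 < ρ) : ∃ (S : diskAlg ρ →L[ℂ] diskAlg ρ) (c : diskAlg ρ →L[ℂ] ℂ),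
    ∀ g, g = coord * S g + algebraMap ℂ _ (c g) := by
  have hb := divMap_coord_pow_bijective hρ 1
  let e := ContinuousLinearEquiv.ofBijective (divMap 1 ((coord : diskAlg ρ) ^ 1))
    (LinearMap.ker_eq_bot.2 hb.1) (LinearMap.range_eq_top.2 hb.2)
  refine ⟨(ContinuousLinearMap.fst ℂ _ _).comp (e.symm : diskAlg ρ →L[ℂ] diskAlg ρ × (Fin 1 → ℂ)),
    (ContinuousLinearMap.proj 0).comp ((ContinuousLinearMap.snd ℂ _ _).comp
      (e.symm : diskAlg ρ →L[ℂ] diskAlg ρ × (Fin 1 → ℂ))), fun g => ?_⟩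
  have h : divMap 1 ((coord : diskAlg ρ) ^ 1) (e.symm g) = g := e.apply_symm_apply g
  rw [divMap_apply, pow_one, polyPart_succ, polyPart_apply] at h
  simpa using h.symm

theorem taylor_expansion {S : diskAlg ρ →L[ℂ] diskAlg ρ} {c : diskAlg ρ →L[ℂ] ℂ}
    (h : ∀ g, g = coord * S g + algebraMap ℂ _ (c g)) (g : diskAlg ρ) (N : ℕ) :
    g = ∑ k ∈ Finset.range N, algebraMap ℂ _ (c ((S ^ k) g)) * coord ^ k +
      coord ^ N * (S ^ N) g := by
  induction N with
  | zero => simp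
  | succ N ih =>
    rw [Finset.sum_range_succ, add_assoc]
    conv_lhs => rw [ih]
    congr 1
    conv_lhs => rw [h ((S ^ N) g)]
    rw [pow_succ' S, pow_succ]
    simp only [mul_apply_eq_comp]
    ring

end diskAlg

theorem UnrestrictedApprox.prod [FiniteDimensional ℂ E] (h : UnrestrictedApprox E) :
    UnrestrictedApprox (E × ℂ) := by
  intro R hR
  have hprop : ProperSpace E := FiniteDimensional.proper ℂ E
  obtain ⟨S, c, hSc⟩ := diskAlg.exists_shift (half_pos hR)
  obtain ⟨r', hr', H⟩ := h (R / 2) (half_pos hR)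
  set r := min (min r' (R / 4)) (min 1 (1 / (2 * (‖S‖ + 1)))) with hr
  have hS0 : 0 < ‖S‖ + 1 := by positivity
  have hr0 : 0 < r := by positivity
  have hrr' : r ≤ r' := (min_le_left _ _).trans (min_le_left _ _)
  have hrR : r ≤ R / 4 := (min_le_left _ _).trans (min_le_right _ _)
  have hr1 : r ≤ 1 := (min_le_right _ _).trans (min_le_left _ _)
  have hrS : r * ‖S‖ ≤ 1 / 2 := by
    have : r ≤ 1 / (2 * (‖S‖ + 1)) := (min_le_right _ _).trans (min_le_right _ _)
    rw [le_div_iff₀ (by positivity)] at this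
    nlinarith
  refine ⟨r, hr0, fun f hf ε hε => ?_⟩
  obtain ⟨Q, hQ, hQf⟩ := exists_diskAlg_family (half_pos hR) (by linarith) hf
  obtain ⟨M, hM⟩ : ∃ M, ∀ x ∈ closedBall (0 : E) r, ‖Q x‖ ≤ M :=
    (isCompact_closedBall _ _).exists_bound_of_continuousOn
      (hQ.continuousOn.mono (closedBall_subset_ball (by linarith)))
  have hM0 : 0 ≤ M := (norm_nonneg _).trans (hM 0 (mem_closedBall_self hr0.le))
  obtain ⟨N, hN⟩ : ∃ N : ℕ, M * (1 / 2 : ℝ) ^ N < ε / 2 := by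
    have := (tendsto_pow_atTop_nhds_zero_of_lt_one (r := (1 / 2 : ℝ)) (by norm_num)
      (by norm_num)).const_mul M
    rw [mul_zero] at this
    exact (this.eventually_lt_const (half_pos hε)).exists
  have hε' : 0 < ε / (2 * (N + 1)) := by positivity
  have hcd : ∀ k, DifferentiableOn ℂ (fun x => c ((S ^ k) (Q x))) (ball 0 (R / 2)) := fun k =>
    c.differentiable.comp_differentiableOn ((S ^ k).differentiable.comp_differentiableOn hQ)
  choose g hg hgc using fun k => H _ (hcd k) _ hε'
  have hfst : ∀ k, NashOn (Set.univ : Set (E × ℂ)) fun y => g k y.1 := fun k => by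
    simpa using (hg k).comp_affine isOpen_univ Set.univ_nonempty isOpen_univ
      convex_univ (ContinuousLinearMap.fst ℂ E ℂ) isOpenMap_fst 0 (fun _ _ => Set.mem_univ _)
  have hsnd : NashOn (Set.univ : Set (E × ℂ)) fun y => y.2 :=
    NashOn.clm isOpen_univ convex_univ Set.univ_nonempty (ContinuousLinearMap.snd ℂ E ℂ)
  refine ⟨fun y => ∑ k ∈ Finset.range N, g k y.1 * y.2 ^ k, ?_, ?_⟩
  · have := NashOn.eval isOpen_univ convex_univ Set.univ_nonempty (κ := Option ℕ)
      (t := fun k => k.elim (fun y : E × ℂ => y.2) fun k y => g k y.1)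
      (by rintro (_ | k) <;> simp [hfst, hsnd])
      (∑ k ∈ Finset.range N, MvPolynomial.X (some k) * MvPolynomial.X none ^ k)
    simpa using this
  · rintro ⟨x, z⟩ hxz
    rw [← ball_prod_same] at hxz
    obtain ⟨hx, hz⟩ := hxz
    replace hx : x ∈ ball (0 : E) r := hx
    replace hz : z ∈ ball (0 : ℂ) r := hz
    dsimp only
    have hz' : z ∈ closedBall (0 : ℂ) (R / 2) :=
      ball_subset_closedBall (ball_subset_ball (by linarith) hz)
    rw [mem_ball_zero_iff] at hz
    have h1 := congrArg (diskAlg.ev ⟨z, hz'⟩) (diskAlg.taylor_expansion hSc (Q x) N)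
    rw [hQf x (ball_subset_ball (by linarith) hx)] at h1
    simp only [map_add, map_sum, map_mul, map_pow, diskAlg.ev_coord, AlgHom.commutes,
      Algebra.algebraMap_self, RingHom.id_apply] at h1
    have h2 : f (x, z) - ∑ k ∈ Finset.range N, g k x * z ^ k =
        ∑ k ∈ Finset.range N, (c ((S ^ k) (Q x)) - g k x) * z ^ k +
          z ^ N * diskAlg.ev ⟨z, hz'⟩ ((S ^ N) (Q x)) := by
      rw [h1]
      simp only [sub_mul, Finset.sum_sub_distrib]
      ring
    rw [h2]
    have h3 : ‖∑ k ∈ Finset.range N, (c ((S ^ k) (Q x)) - g k x) * z ^ k‖ ≤ ε / 2 := by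
      refine (norm_sum_le_of_le (Finset.range N) (f := fun k => (c ((S ^ k) (Q x)) - g k x) * z ^ k)
        (n := fun _ => ε / (2 * (N + 1))) fun k _ => ?_).trans ?_
      · rw [norm_mul, norm_pow]
        refine (mul_le_of_le_one_right (norm_nonneg _) (pow_le_one₀ (norm_nonneg _)
          (hz.le.trans hr1))).trans (hgc k x (ball_subset_ball hrr' hx)).le
      · rw [Finset.sum_const, Finset.card_range, nsmul_eq_mul, mul_div_assoc',
          div_le_div_iff₀ (by positivity) two_pos]
        nlinarith
    have h4 : ‖z ^ N * diskAlg.ev ⟨z, hz'⟩ ((S ^ N) (Q x))‖ ≤ M * (1 / 2 : ℝ) ^ N := by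
      have h5 : ‖diskAlg.ev ⟨z, hz'⟩ ((S ^ N) (Q x))‖ ≤ ‖S‖ ^ N * M := by
        refine (diskAlg.norm_ev_le _ _).trans (((S ^ N).le_opNorm _).trans ?_)
        refine mul_le_mul ?_ (hM x (ball_subset_closedBall hx)) (norm_nonneg _) (by positivity)
        rcases Nat.eq_zero_or_pos N with rfl | hN0
        · rw [pow_zero, pow_zero]
          exact ContinuousLinearMap.norm_id_le
        · exact norm_pow_le' S hN0
      rw [norm_mul, norm_pow]
      calc ‖z‖ ^ N * _ ≤ r ^ N * (‖S‖ ^ N * M) := by gcongr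
        _ = M * (r * ‖S‖) ^ N := by ring
        _ ≤ _ := by gcongr
    calc _ ≤ _ := norm_add_le _ _
      _ ≤ ε / 2 + M * (1 / 2 : ℝ) ^ N := add_le_add h3 h4
      _ < ε := by linarith

theorem unrestrictedApprox_pi (n : ℕ) : UnrestrictedApprox (Fin n → ℂ) := by
  induction n with
  | zero =>
    intro R hR
    refine ⟨R, hR, fun f hf ε hε => ⟨fun _ => f 0,
      NashOn.const isOpen_univ convex_univ Set.univ_nonempty _, fun x _ => ?_⟩⟩
    rw [Subsingleton.elim x 0, sub_self, norm_zero]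
    exact hε
  | succ n ih =>
    exact ih.prod.transfer (ContinuousLinearEquiv.ofFinrankEq (by simp))

end UnrestrictedNashApproximation

section UniversalDivision

open Polynomial

theorem MvPolynomial.eval_aeval_eval {κ B : Type} (Z : B → ℂ) (f : κ → MvPolynomial B ℂ)
    (p : MvPolynomial κ ℂ) :
    MvPolynomial.eval Z (MvPolynomial.aeval f p) =
      MvPolynomial.eval (fun k => MvPolynomial.eval Z (f k)) p := by
  rw [← MvPolynomial.aeval_eq_eval, MvPolynomial.comp_aeval_apply]
  rfl

/-- Division of `p(Q a² + Y)` by a power of a monic polynomial `a`, with polynomial dependence of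
the cofactor on the coefficients, and polynomial conditions for divisibility. -/
theorem exists_universal_cofactor {κ : Type} (r : ℕ) (p : MvPolynomial κ ℂ) {i : ℕ} (hi : i ≤ 2) :
    ∃ (S : Finset (MvPolynomial (κ × Fin (2 * r) ⊕ Fin r) ℂ))
      (c : MvPolynomial (κ ⊕ ((κ × Fin (2 * r) ⊕ Fin r) ⊕ Unit)) ℂ),
      (∀ β, (∀ e ∈ S, MvPolynomial.eval β e = 0) ↔
        (monicPoly fun j => β (Sum.inr j)) ^ i ∣
          MvPolynomial.aeval (fun k => lowPoly fun j => β (Sum.inl (k, j))) p) ∧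
      ∀ (Q : κ → ℂ) (β : κ × Fin (2 * r) ⊕ Fin r → ℂ) (z : ℂ),
        (∀ e ∈ S, MvPolynomial.eval β e = 0) →
        MvPolynomial.eval (fun k => Q k * (monicPoly fun j => β (Sum.inr j)).eval z ^ 2 +
          (lowPoly fun j => β (Sum.inl (k, j))).eval z) p =
        (monicPoly fun j => β (Sum.inr j)).eval z ^ i *
          MvPolynomial.eval (Sum.elim Q (Sum.elim β fun _ => z)) c := by
  classical
  let A := MvPolynomial (κ × Fin (2 * r) ⊕ Fin r) ℂ
  let T := MvPolynomial (κ ⊕ ((κ × Fin (2 * r) ⊕ Fin r) ⊕ Unit)) ℂ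
  let Yu : κ → A[X] := fun k => lowPoly fun j => MvPolynomial.X (Sum.inl (k, j))
  let a : A[X] := monicPoly fun j => MvPolynomial.X (Sum.inr j)
  have ha : (a ^ i).Monic := (monic_monicPoly _).pow i
  let f : A[X] := MvPolynomial.aeval Yu p
  let S : Finset A := (Finset.range ((f %ₘ a ^ i).natDegree + 1)).image (f %ₘ a ^ i).coeff
  let φ : A →+* T := (MvPolynomial.rename fun b => Sum.inr (Sum.inl b)).toRingHom
  let ψ : A[X] →+* T := eval₂RingHom φ (MvPolynomial.X (Sum.inr (Sum.inr ())))
  let ψ' : A[X] →ₐ[ℂ] T :=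
    { ψ with
      commutes' := fun c => by
        change eval₂ φ _ (algebraMap ℂ A[X] c) = _
        rw [Polynomial.algebraMap_apply, eval₂_C]
        exact AlgHom.commutes (MvPolynomial.rename (R := ℂ) fun b => Sum.inr (Sum.inl b)) c }
  have hamap : ∀ β : κ × Fin (2 * r) ⊕ Fin r → ℂ,
      a.map (MvPolynomial.eval β) = monicPoly fun j => β (Sum.inr j) := fun β => by
    simp [a, map_monicPoly]
  have hYmap : ∀ (β : κ × Fin (2 * r) ⊕ Fin r → ℂ) k,
      (Yu k).map (MvPolynomial.eval β) = lowPoly fun j => β (Sum.inl (k, j)) := fun β k => by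
    simp [Yu, map_lowPoly]
  have hfmap : ∀ β : κ × Fin (2 * r) ⊕ Fin r → ℂ, f.map (MvPolynomial.eval β) =
      MvPolynomial.aeval (fun k => lowPoly fun j => β (Sum.inl (k, j))) p := fun β => by
    have h1 := MvPolynomial.comp_aeval_apply (R := ℂ) Yu
      (Polynomial.mapAlgHom (MvPolynomial.aeval (R := ℂ) β)) p
    simp only [coe_mapAlgHom] at h1
    have h2 : ((MvPolynomial.aeval (R := ℂ) β : A →ₐ[ℂ] ℂ) : A →+* ℂ) = MvPolynomial.eval β := by
      ext <;> simp
    simp only [h2, hYmap] at h1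
    exact h1
  have hS : ∀ β : κ × Fin (2 * r) ⊕ Fin r → ℂ, (∀ e ∈ S, MvPolynomial.eval β e = 0) ↔
      (f %ₘ a ^ i).map (MvPolynomial.eval β) = 0 := by
    intro β
    constructor
    · intro h
      ext j
      rw [coeff_map, coeff_zero]
      by_cases hj : j < (f %ₘ a ^ i).natDegree + 1
      · exact h _ (Finset.mem_image_of_mem _ (Finset.mem_range.2 hj))
      · rw [coeff_eq_zero_of_natDegree_lt (by omega), map_zero]
    · intro h e he
      obtain ⟨j, -, rfl⟩ := Finset.mem_image.1 he
      rw [← coeff_map, h, coeff_zero]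
  have hψ : ∀ (Q : κ → ℂ) (β : κ × Fin (2 * r) ⊕ Fin r → ℂ) (z : ℂ) (g : A[X]),
      MvPolynomial.eval (Sum.elim Q (Sum.elim β fun _ => z)) (ψ g) =
        (g.map (MvPolynomial.eval β)).eval z := by
    intro Q β z g
    change MvPolynomial.eval _ (eval₂ _ _ g) = _
    rw [hom_eval₂, eval_map]
    congr 1
    · ext <;> simp [φ]
    · simp
  obtain ⟨c₁, hc₁⟩ : ψ a ^ i ∣ MvPolynomial.aeval
      (fun k => MvPolynomial.X (Sum.inl k) * ψ a ^ 2 + ψ (Yu k)) p -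
        MvPolynomial.aeval (fun k => ψ (Yu k)) p := by
    refine MvPolynomial.dvd_aeval_sub_aeval (fun k => ?_) p
    rw [add_sub_cancel_right]
    exact (pow_dvd_pow _ hi).mul_left _
  have hψf : MvPolynomial.aeval (fun k => ψ (Yu k)) p = ψ f :=
    (MvPolynomial.comp_aeval_apply (R := ℂ) Yu ψ' p).symm
  refine ⟨S, c₁ + ψ (f /ₘ a ^ i), fun β => ?_, fun Q β z h => ?_⟩
  · rw [hS, map_modByMonic _ ha, Polynomial.map_pow, hamap, hfmap,
      modByMonic_eq_zero_iff_dvd ((monic_monicPoly _).pow i)]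
  · rw [hS] at h
    have h1 := modByMonic_add_div f (a ^ i)
    have h2 := congrArg (fun g => (g.map (MvPolynomial.eval β)).eval z) h1
    simp only [Polynomial.map_add, h, zero_add, Polynomial.map_mul, Polynomial.map_pow, eval_mul,
      eval_pow, hamap] at h2
    rw [sub_eq_iff_eq_add, hψf] at hc₁
    have h3 := congrArg (MvPolynomial.eval (Sum.elim Q (Sum.elim β fun _ => z))) hc₁
    rw [MvPolynomial.eval_aeval_eval] at h3
    simp only [map_add, map_mul, map_pow, hψ, hamap, hYmap, MvPolynomial.eval_X, Sum.elim_inl] at h3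
    rw [h3, map_add, hψ, mul_add, ← h2]

end UniversalDivision

section Newton

open Polynomial

variable {τ : Type}

theorem exists_second_order_expansion (p : MvPolynomial (Option τ) ℂ) :
    ∃ h : (MvPolynomial (Option τ) ℂ)[X], ∀ (v : Option τ → ℂ) (s : ℂ),
      MvPolynomial.eval (fun k => k.elim (v none + s) fun t => v (some t)) p =
        MvPolynomial.eval v p + s * MvPolynomial.eval v (MvPolynomial.pderiv none p) +
          s ^ 2 * h.eval₂ (MvPolynomial.eval v) s := by
  classical
  induction p using MvPolynomial.induction_on with
  | C a => exact ⟨0, fun v s => by simp⟩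
  | add p q hp hq =>
    obtain ⟨h, hh⟩ := hp
    obtain ⟨g, hg⟩ := hq
    refine ⟨h + g, fun v s => ?_⟩
    rw [map_add, hh, hg, map_add, map_add, map_add, eval₂_add]
    ring
  | mul_X p k hp =>
    obtain ⟨h, hh⟩ := hp
    cases k with
    | none =>
      refine ⟨h * C (MvPolynomial.X none) + C (MvPolynomial.pderiv none p) + X * h, fun v s => ?_⟩
      rw [map_mul, hh]
      simp only [MvPolynomial.eval_X, Option.elim_none, map_mul, Derivation.leibniz,
        MvPolynomial.pderiv_X_self, map_add, eval₂_add, eval₂_mul, eval₂_C, eval₂_X, smul_eq_mul,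
        mul_one]
      ring
    | some t =>
      refine ⟨h * C (MvPolynomial.X (some t)), fun v s => ?_⟩
      rw [map_mul, hh]
      simp only [MvPolynomial.eval_X, Option.elim_some, map_mul, Derivation.leibniz,
        MvPolynomial.pderiv_X_of_ne (Option.some_ne_none t), eval₂_mul, eval₂_C,
        smul_eq_mul, mul_zero, zero_add]
      ring

theorem exists_root_family (K : ℕ) : ∃ (B : Set (Fin K → ℂ)) (m : (Fin K → ℂ) → ℂ), IsOpen B ∧
    0 ∈ B ∧ DifferentiableOn ℂ m B ∧ ∀ s ∈ B, 1 + m s + ∑ k, s k * m s ^ ((k : ℕ) + 2) = 0 := by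
  let Φ : (Fin K → ℂ) × ℂ → (Fin K → ℂ) × ℂ :=
    fun y => (y.1, 1 + y.2 + ∑ k, y.1 k * y.2 ^ ((k : ℕ) + 2))
  have hΦ : ContDiff ℂ 1 Φ := by
    refine contDiff_fst.prodMk ((contDiff_const.add contDiff_snd).add (ContDiff.sum fun k _ => ?_))
    exact (((ContinuousLinearMap.proj (R := ℂ) (φ := fun _ : Fin K => ℂ) k).contDiff).comp
      contDiff_fst).mul (contDiff_snd.pow _)
  let L : ((Fin K → ℂ) × ℂ) →L[ℂ] ℂ := ContinuousLinearMap.snd ℂ _ _ +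
    ∑ k : Fin K, ((-1 : ℂ) ^ ((k : ℕ) + 2)) •
      (ContinuousLinearMap.proj (R := ℂ) (φ := fun _ : Fin K => ℂ) k).comp
        (ContinuousLinearMap.fst ℂ _ _)
  let D : ((Fin K → ℂ) × ℂ) →L[ℂ] ((Fin K → ℂ) × ℂ) := (ContinuousLinearMap.fst ℂ _ _).prod L
  have hD : HasFDerivAt Φ D (0, -1) := by
    refine HasFDerivAt.prodMk hasFDerivAt_fst (HasFDerivAt.add (hasFDerivAt_snd.const_add 1) ?_)
    refine HasFDerivAt.fun_sum fun k _ => ?_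
    have h1 : HasFDerivAt (fun y : (Fin K → ℂ) × ℂ => y.1 k)
        ((ContinuousLinearMap.proj (R := ℂ) (φ := fun _ : Fin K => ℂ) k).comp
          (ContinuousLinearMap.fst ℂ _ _)) (0, -1) :=
      ContinuousLinearMap.hasFDerivAt (((ContinuousLinearMap.proj (R := ℂ)
        (φ := fun _ : Fin K => ℂ) k).comp (ContinuousLinearMap.fst ℂ (Fin K → ℂ) ℂ)))
    have h2 : HasFDerivAt (fun y : (Fin K → ℂ) × ℂ => y.2)
        (ContinuousLinearMap.snd ℂ (Fin K → ℂ) ℂ) (0, -1) := hasFDerivAt_snd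
    have h3 : HasFDerivAt (fun y : (Fin K → ℂ) × ℂ => y.1 k * y.2 ^ ((k : ℕ) + 2)) _ (0, -1) :=
      h1.mul (h2.pow ((k : ℕ) + 2))
    refine h3.congr_fderiv (ContinuousLinearMap.ext fun y => ?_)
    simp
  have hinj : Function.Injective D := by
    rw [injective_iff_map_eq_zero]
    rintro ⟨s, μ⟩ h
    have h1 : s = 0 := congrArg Prod.fst h
    have h2 := congrArg Prod.snd h
    subst h1
    have : μ = 0 := by simpa [D, L] using h2
    rw [this]; rfl
  let e : ((Fin K → ℂ) × ℂ) ≃L[ℂ] ((Fin K → ℂ) × ℂ) :=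
    (LinearEquiv.ofInjectiveEndo (D : _ →ₗ[ℂ] _) hinj).toContinuousLinearEquiv
  have hDe : HasFDerivAt Φ (e : ((Fin K → ℂ) × ℂ) →L[ℂ] ((Fin K → ℂ) × ℂ)) (0, -1) := by
    have he : (e : ((Fin K → ℂ) × ℂ) →L[ℂ] ((Fin K → ℂ) × ℂ)) = D :=
      ContinuousLinearMap.ext fun _ => rfl
    rwa [he]
  have hat : ContDiffAt ℂ 1 Φ (0, -1) := hΦ.contDiffAt
  let o := hat.toOpenPartialHomeomorph Φ hDe one_ne_zero
  have hΦ0 : Φ (0, -1) = (0, 0) := by simp [Φ]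
  have hmem : ((0, 0) : (Fin K → ℂ) × ℂ) ∈ o.target := by
    rw [← hΦ0]
    exact hat.image_mem_toOpenPartialHomeomorph_target hDe one_ne_zero
  have hinv : ContDiffAt ℂ 1 o.symm (0, 0) := by
    rw [← hΦ0]
    exact hat.to_localInverse hDe one_ne_zero
  have hev : ∀ᶠ y in 𝓝 ((0, 0) : (Fin K → ℂ) × ℂ), y ∈ o.target ∧ DifferentiableAt ℂ o.symm y :=
    (show ∀ᶠ y in 𝓝 ((0, 0) : (Fin K → ℂ) × ℂ), y ∈ o.target from
      o.open_target.mem_nhds hmem).and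
      ((hinv.eventually (by simp)).mono fun y hy => hy.differentiableAt one_ne_zero)
  obtain ⟨W, hWsub, hW, h0W⟩ := eventually_nhds_iff.1 hev
  have hι : Differentiable ℂ fun s : Fin K → ℂ => (s, (0 : ℂ)) :=
    differentiable_id.prodMk (differentiable_const _)
  refine ⟨(fun s => (s, (0 : ℂ))) ⁻¹' W, fun s => (o.symm (s, 0)).2, hW.preimage hι.continuous, h0W,
    fun s hs => ?_, fun s hs => ?_⟩
  · exact (((hWsub _ hs).2.comp s (hι s)).snd).differentiableWithinAt
  · have h1 : Φ (o.symm (s, 0)) = (s, 0) := o.right_inv (hWsub _ hs).1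
    have h2 : (o.symm (s, 0)).1 = s := congrArg Prod.fst h1
    have h3 := congrArg Prod.snd h1
    simp only [Φ, h2] at h3
    exact h3

end Newton

section NewtonCorrection

open MvPolynomial

theorem MvPolynomial.eval_elim_rename_some {τ : Type} (x : ℂ) (v : Option τ → ℂ)
    (D : MvPolynomial τ ℂ) :
    eval (fun k => k.elim x fun t => v (some t)) (rename some D) = eval v (rename some D) := by
  rw [eval_rename, eval_rename]
  rfl

/-- One step of Newton's method, for approximate solutions of the system
`P(v) = 0`, `D(v) yᵢ = Aᵢ(v)`, with errors divisible by `a²`, where `a` generates the ideal of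
`D ∂P/∂v₀`: it gives an exact solution depending holomorphically on the parameter. -/
theorem exists_newton_correction {G ι τ : Type} [NormedAddCommGroup G] [NormedSpace ℂ G]
    (P : MvPolynomial (Option τ) ℂ) (D : MvPolynomial τ ℂ) (A : ι → MvPolynomial (Option τ) ℂ)
    {v : G → Option τ → ℂ} {y b : G → ι → ℂ} {a c u : G → ℂ}
    (hv : ∀ k, Differentiable ℂ fun Z => v Z k) (hy : ∀ i, Differentiable ℂ fun Z => y Z i)
    (hb : ∀ i, Differentiable ℂ fun Z => b Z i) (ha : Differentiable ℂ a)
    (hc : Differentiable ℂ c) (hu : Differentiable ℂ u) :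
    ∃ (Ω : Set G) (v' : G → Option τ → ℂ) (y' : G → ι → ℂ), IsOpen Ω ∧
      (∀ Z, u Z ≠ 0 → c Z = 0 → Z ∈ Ω) ∧
      (∀ k, DifferentiableOn ℂ (fun Z => v' Z k) Ω) ∧
      (∀ i, DifferentiableOn ℂ (fun Z => y' Z i) Ω) ∧
      (∀ Z t, v' Z (some t) = v Z (some t)) ∧
      (∀ Z, c Z = 0 → (∀ i, b Z i = 0) → v' Z = v Z ∧ y' Z = y Z) ∧
      ∀ Z ∈ Ω, eval (v Z) P = a Z ^ 2 * c Z →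
        (∀ i, eval (v Z) (rename some D) * y Z i - eval (v Z) (A i) = a Z ^ 2 * b Z i) →
        eval (v Z) (pderiv none P * rename some D) = a Z * u Z →
        eval (v' Z) P = 0 ∧ ∀ i, eval (v' Z) (rename some D) * y' Z i = eval (v' Z) (A i) := by
  obtain ⟨H, hH⟩ := exists_second_order_expansion P
  choose B hB using fun i => exists_second_order_expansion (A i)
  obtain ⟨W, m, hW, h0W, hm, hroot⟩ := exists_root_family (H.natDegree + 1)
  have hpoly : ∀ p : MvPolynomial (Option τ) ℂ, Differentiable ℂ fun Z => eval (v Z) p := fun p =>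
    differentiableOn_univ.1 (DifferentiableOn.mvPolynomial_aeval
      (fun k => (hv k).differentiableOn) p)
  let d : G → ℂ := fun Z => eval (v Z) (rename some D)
  have hd : Differentiable ℂ d := hpoly _
  let s : G → Fin (H.natDegree + 1) → ℂ := fun Z k =>
    c Z * (u Z)⁻¹ ^ 2 * d Z ^ 2 * eval (v Z) (H.coeff k) * (a Z * d Z * c Z * (u Z)⁻¹) ^ (k : ℕ)
  have hU0 : IsOpen {Z | u Z ≠ 0} := isOpen_ne_fun hu.continuous continuous_const
  have hinv : DifferentiableOn ℂ (fun Z => (u Z)⁻¹) {Z | u Z ≠ 0} :=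
    hu.differentiableOn.fun_inv fun _ hZ => hZ
  have hs : DifferentiableOn ℂ s {Z | u Z ≠ 0} := by
    refine differentiableOn_pi.2 fun k => ?_
    exact (((hc.differentiableOn.fun_mul (hinv.fun_pow 2)).fun_mul
      (hd.differentiableOn.fun_pow 2)).fun_mul (hpoly _).differentiableOn).fun_mul
      ((((ha.fun_mul hd).fun_mul hc).differentiableOn.fun_mul hinv).fun_pow _)
  let Ω : Set G := {Z | u Z ≠ 0} ∩ s ⁻¹' W
  have hΩ : IsOpen Ω := hs.continuousOn.isOpen_inter_preimage hU0 hW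
  let κ : G → ℂ := fun Z => c Z * (u Z)⁻¹ * m (s Z)
  have hκ : DifferentiableOn ℂ κ Ω := by
    have h1 : DifferentiableOn ℂ (fun Z => m (s Z)) Ω :=
      hm.comp (hs.mono Set.inter_subset_left) fun Z hZ => hZ.2
    exact (hc.differentiableOn.fun_mul (hinv.mono Set.inter_subset_left)).fun_mul h1
  let σ : G → ℂ := fun Z => a Z * d Z * κ Z
  have hσ : DifferentiableOn ℂ σ Ω := (ha.fun_mul hd).differentiableOn.fun_mul hκ
  let β : G → ι → ℂ := fun Z i => eval (v Z) (pderiv none (A i)) +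
    σ Z * (B i).eval₂ (eval (v Z)) (σ Z)
  have hβ : ∀ i, DifferentiableOn ℂ (fun Z => β Z i) Ω := fun i => by
    refine (hpoly _).differentiableOn.fun_add (hσ.fun_mul ?_)
    simp only [Polynomial.eval₂_eq_sum_range]
    exact DifferentiableOn.fun_sum fun j _ => (hpoly _).differentiableOn.fun_mul (hσ.fun_pow j)
  refine ⟨Ω, fun Z k => k.elim (v Z none + σ Z) fun t => v Z (some t), fun Z i =>
    y Z i - eval (v Z) (pderiv none P) * a Z * b Z i * (u Z)⁻¹ + a Z * κ Z * β Z i, hΩ,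
    fun Z hZ hcZ => ⟨hZ, ?_⟩, ?_, fun i => ?_, fun _ _ => rfl, fun Z hcZ hbZ => ?_,
    fun Z hZ h1 h2 h3 => ?_⟩
  · have : s Z = 0 := by
      ext k
      simp [s, hcZ]
    rwa [Set.mem_preimage, this]
  · rintro (_ | t)
    · exact (hv none).differentiableOn.fun_add hσ
    · exact (hv (some t)).differentiableOn
  · exact ((hy i).differentiableOn.fun_sub ((((hpoly _).fun_mul ha).fun_mul
      (hb i)).differentiableOn.fun_mul (hinv.mono Set.inter_subset_left))).fun_add
      ((ha.differentiableOn.fun_mul hκ).fun_mul (hβ i))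
  · have hκ0 : κ Z = 0 := by simp [κ, hcZ]
    refine ⟨funext ?_, funext fun i => ?_⟩
    · rintro (_ | t) <;> simp [σ, hκ0]
    · simp [hκ0, hbZ]
  · have hu0 : u Z ≠ 0 := hZ.1
    rw [map_mul] at h3
    change _ * d Z = _ at h3
    constructor
    · have h4 := hroot (s Z) hZ.2
      rw [hH, h1, Polynomial.eval₂_eq_sum_range, Finset.sum_range]
      have h5 : σ Z ^ 2 * ∑ k : Fin (H.natDegree + 1), eval (v Z) (H.coeff k) * σ Z ^ (k : ℕ) =
          a Z ^ 2 * c Z * ∑ k, s Z k * m (s Z) ^ ((k : ℕ) + 2) := by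
        rw [Finset.mul_sum, Finset.mul_sum]
        refine Finset.sum_congr rfl fun k _ => ?_
        simp only [σ, κ]
        generalize m (s Z) = μ
        simp only [s]
        ring
      have h6 : σ Z * eval (v Z) (pderiv none P) = a Z ^ 2 * c Z * m (s Z) := by
        simp only [σ, κ]
        field_simp
        linear_combination a Z * c Z * m (s Z) * h3
      rw [h5, h6]
      linear_combination a Z ^ 2 * c Z * h4
    · intro i
      rw [eval_elim_rename_some, hB]
      have h7 := h2 i
      change d Z * _ - _ = _ at h7
      change d Z * _ = _
      have h8 : eval (v Z) (A i) + σ Z * eval (v Z) (pderiv none (A i)) +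
          σ Z ^ 2 * (B i).eval₂ (eval (v Z)) (σ Z) =
            eval (v Z) (A i) + a Z * d Z * κ Z * β Z i := by
        simp only [β, σ]
        ring
      rw [h8, mul_add, mul_sub]
      have h9 : d Z * (eval (v Z) (pderiv none P) * a Z * b Z i * (u Z)⁻¹) = a Z ^ 2 * b Z i := by
        field_simp
        linear_combination a Z * b Z i * h3
      rw [h9]
      linear_combination h7

end NewtonCorrection

section Parametrization

open Metric MvPolynomial

theorem Polynomial.Monic.eq_zero_of_continuousOn {p : Polynomial ℂ} (hp : p.Monic) {U : Set ℂ}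
    (hU : IsOpen U) {f : ℂ → ℂ} (hf : ContinuousOn f U)
    (h : ∀ z ∈ U, p.eval z ≠ 0 → f z = 0) : ∀ z ∈ U, f z = 0 := by
  intro z hz
  have h1 : Tendsto f (𝓝[≠] z) (𝓝 (f z)) := (hf.continuousAt (hU.mem_nhds hz)).tendsto.mono_left
    nhdsWithin_le_nhds
  have h2 : ∀ᶠ y in 𝓝[≠] z, p.eval y ≠ 0 :=
    nhdsNE_le_cofinite z (Polynomial.finite_setOfPred_isRoot hp.ne_zero).compl_mem_cofinite
  have h3 : ∀ᶠ y in 𝓝[≠] z, (0 : ℂ) = f y := by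
    filter_upwards [h2, nhdsWithin_le_nhds (hU.mem_nhds hz)] with y hy hyU using (h y hyU hy).symm
  exact tendsto_nhds_unique h1 (tendsto_const_nhds.congr' h3)

/-- Indices for the coefficients of a family of polynomials of degree less than `2 * s` and of a
monic polynomial of degree `s`. -/
abbrev CoeffIndex (τ ι : Type) (s : ℕ) : Type := (Option τ ⊕ ι) × Fin (2 * s) ⊕ Fin s

/-- Indices for quotients, for coefficients as in `CoeffIndex`, and for a point of the line. -/
abbrev CofactorIndex (τ ι : Type) (s : ℕ) : Type := (Option τ ⊕ ι) ⊕ (CoeffIndex τ ι s ⊕ Unit)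

variable {E : Type} [NormedAddCommGroup E] [NormedSpace ℂ E]

theorem exists_holomorphic_parametrization [FiniteDimensional ℂ E] {ι τ : Type} [Fintype ι]
    [Fintype τ] (P : MvPolynomial (Option τ) ℂ) (D : MvPolynomial τ ℂ)
    (A : ι → MvPolynomial (Option τ) ℂ) {R : ℝ} (hR : 0 < R) {v : E × ℂ → Option τ → ℂ}
    {F : E × ℂ → ι → ℂ} (hv : ∀ k, DifferentiableOn ℂ (fun x => v x k) (ball 0 R))
    (hF : ∀ i, DifferentiableOn ℂ (fun x => F x i) (ball 0 R))
    (hP : ∀ x ∈ ball (0 : E × ℂ) R, eval (v x) P = 0)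
    (hA : ∀ x ∈ ball (0 : E × ℂ) R, ∀ i, eval (v x) (rename some D) * F x i = eval (v x) (A i))
    (hδ : ¬ ∀ᶠ z in 𝓝 (0 : ℂ), eval (v (0, z)) (pderiv none P * rename some D) = 0) :
    ∃ (J : Type) (_ : Fintype J) (ρ : ℝ) (β : J → E → ℂ) (Q : Option τ ⊕ ι → E × ℂ → ℂ)
      (S : Set (MvPolynomial J ℂ)) (Ω : Set ((Option τ ⊕ ι) ⊕ (J ⊕ Unit) → ℂ))
      (V : ((Option τ ⊕ ι) ⊕ (J ⊕ Unit) → ℂ) → Option τ → ℂ)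
      (y : ((Option τ ⊕ ι) ⊕ (J ⊕ Unit) → ℂ) → ι → ℂ)
      (p : τ → MvPolynomial ((Option τ ⊕ ι) ⊕ (J ⊕ Unit)) ℂ),
      0 < ρ ∧ ρ ≤ R ∧ (∀ j, DifferentiableOn ℂ (β j) (ball 0 ρ)) ∧
      (∀ k, DifferentiableOn ℂ (Q k) (ball 0 ρ)) ∧ S.Finite ∧
      (∀ e ∈ S, ∀ x ∈ ball (0 : E) ρ, eval (fun j => β j x) e = 0) ∧ IsOpen Ω ∧
      (∀ k, DifferentiableOn ℂ (fun Z => V Z k) Ω) ∧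
      (∀ i, DifferentiableOn ℂ (fun Z => y Z i) Ω) ∧
      (∀ Z t, V Z (some t) = eval Z (p t)) ∧
      (∀ x ∈ ball (0 : E × ℂ) ρ, ∀ Z,
        Z = Sum.elim (fun k => Q k x) (Sum.elim (fun j => β j x.1) fun _ => x.2) →
        Z ∈ Ω ∧ V Z = v x ∧ y Z = F x) ∧
      ∀ Z ∈ Ω, (∀ e ∈ S, eval (fun j => Z (Sum.inr (Sum.inl j))) e = 0) →
        eval (V Z) P = 0 ∧ ∀ i, eval (V Z) (rename some D) * y Z i = eval (V Z) (A i) := by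
  let w : Option τ ⊕ ι → E × ℂ → ℂ := Sum.elim (fun k x => v x k) fun i x => F x i
  have hw : ∀ k, DifferentiableOn ℂ (w k) (ball 0 R) := by rintro (k | i); exacts [hv k, hF i]
  let δ : MvPolynomial (Option τ ⊕ ι) ℂ := rename Sum.inl (pderiv none P * rename some D)
  let pP : MvPolynomial (Option τ ⊕ ι) ℂ := rename Sum.inl P
  let pA : ι → MvPolynomial (Option τ ⊕ ι) ℂ := fun i =>
    rename Sum.inl (rename some D) * X (Sum.inr i) - rename Sum.inl (A i)
  have hinl : ∀ (W : Option τ ⊕ ι → ℂ) q,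
      eval W (rename Sum.inl q) = eval (fun k => W (.inl k)) q :=
    fun W q => eval_rename _ _ _
  have hpA : ∀ (W : Option τ ⊕ ι → ℂ) i, eval W (pA i) =
      eval (fun k => W (.inl k)) (rename some D) * W (.inr i) -
        eval (fun k => W (.inl k)) (A i) := fun W i => by
    simp only [pA, map_sub, map_mul, hinl, eval_X]
  obtain ⟨s, ρ, α, Y, Q, q, hρ, hρR, hα, hY, hQ, H⟩ := exists_weierstrass_data hR w hw δ (by
    simpa only [δ, hinl, w, Sum.elim_inl] using hδ)
  obtain ⟨Sδ, cδ, hSδ, hcδ⟩ := exists_universal_cofactor s δ one_le_two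
  obtain ⟨SP, cP, hSP, hcP⟩ := exists_universal_cofactor s pP le_rfl
  choose SA cA hSA hcA using fun i => exists_universal_cofactor s (pA i) le_rfl
  let z : MvPolynomial (CofactorIndex τ ι s) ℂ := X (.inr (.inr ()))
  let aT : MvPolynomial (CofactorIndex τ ι s) ℂ :=
    (monicPoly fun j => X (.inr (.inl (.inr j)))).eval z
  let wT : Option τ ⊕ ι → MvPolynomial (CofactorIndex τ ι s) ℂ := fun k => X (.inl k) * aT ^ 2 +
    (lowPoly fun j => X (.inr (.inl (.inl (k, j))))).eval z
  have haT : ∀ Z, eval Z aT =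
      (monicPoly fun j => Z (.inr (.inl (.inr j)))).eval (Z (.inr (.inr ()))) := fun Z => by
    simp [aT, z, eval_monicPoly]
  have hwT : ∀ Z k, eval Z (wT k) = Z (.inl k) * eval Z aT ^ 2 +
      (lowPoly fun j => Z (.inr (.inl (.inl (k, j))))).eval (Z (.inr (.inr ()))) := fun Z k => by
    simp [wT, z, eval_lowPoly]
  have hdiff : ∀ p : MvPolynomial (CofactorIndex τ ι s) ℂ,
      Differentiable ℂ fun Z => eval Z p := fun p =>
    differentiableOn_univ.1 (DifferentiableOn.mvPolynomial_aeval
      (f := fun k (Z : CofactorIndex τ ι s → ℂ) => Z k)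
      (fun k => (differentiable_apply k).differentiableOn) p)
  obtain ⟨Ω, V, y, hΩ, hmem, hV, hy, hVs, hfix, hnewton⟩ := exists_newton_correction P D A
    (v := fun Z k => eval Z (wT (.inl k))) (y := fun Z i => eval Z (wT (.inr i)))
    (b := fun Z i => eval Z (cA i)) (a := fun Z => eval Z aT) (c := fun Z => eval Z cP)
    (u := fun Z => eval Z cδ) (fun _ => hdiff _) (fun _ => hdiff _) (fun _ => hdiff _) (hdiff _)
    (hdiff _) (hdiff _)
  let S : Set (MvPolynomial (CoeffIndex τ ι s) ℂ) := ↑Sδ ∪ ↑SP ∪ ⋃ i, ↑(SA i)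
  have hdata : ∀ Z : CofactorIndex τ ι s → ℂ,
      (∀ e ∈ S, eval (fun j => Z (.inr (.inl j))) e = 0) →
      eval (fun k => eval Z (wT k)) δ = eval Z aT * eval Z cδ ∧
      eval (fun k => eval Z (wT k)) pP = eval Z aT ^ 2 * eval Z cP ∧
      ∀ i, eval (fun k => eval Z (wT k)) (pA i) = eval Z aT ^ 2 * eval Z (cA i) := by
    intro Z hZ
    have hZe : Sum.elim (fun k => Z (.inl k)) (Sum.elim (fun j => Z (.inr (.inl j)))
        fun _ => Z (.inr (.inr ()))) = Z := by
      funext k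
      rcases k with k | k | k <;> rfl
    have h1 := hcδ (fun k => Z (.inl k)) (fun j => Z (.inr (.inl j))) (Z (.inr (.inr ())))
      fun e he => hZ e (.inl (.inl he))
    have h2 := hcP (fun k => Z (.inl k)) (fun j => Z (.inr (.inl j))) (Z (.inr (.inr ())))
      fun e he => hZ e (.inl (.inr he))
    have h3 := fun i => hcA i (fun k => Z (.inl k)) (fun j => Z (.inr (.inl j)))
      (Z (.inr (.inr ()))) fun e he => hZ e (.inr (Set.mem_iUnion.2 ⟨i, he⟩))
    simp only [hZe, ← haT, ← hwT, pow_one] at h1 h2 h3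
    exact ⟨h1, h2, h3⟩
  let β : CoeffIndex τ ι s → E → ℂ := Sum.elim (fun k => Y k.1 k.2) α
  have hSβ : ∀ e ∈ S, ∀ x ∈ ball (0 : E) ρ, eval (fun j => β j x) e = 0 := by
    intro e he x hx
    obtain ⟨-, -, H1, H2⟩ := H x hx
    rcases he with (he | he) | he
    · exact (hSδ fun j => β j x).2 (by rw [pow_one]; exact H2) e he
    · exact (hSP fun j => β j x).2 (H1 _ fun y hy => by rw [hinl]; exact hP y hy) e he
    · obtain ⟨i, he⟩ := Set.mem_iUnion.1 he
      refine (hSA i fun j => β j x).2 (H1 _ fun y hy => ?_) e he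
      rw [hpA]
      exact sub_eq_zero.2 (hA y hy i)
  refine ⟨_, inferInstance, ρ, β, Q, S, Ω, V, y, fun t => wT (.inl (some t)), hρ, hρR, ?_, hQ,
    (Sδ.finite_toSet.union SP.finite_toSet).union (Set.finite_iUnion fun i => (SA i).finite_toSet),
    hSβ, hΩ, hV, hy, hVs, ?_, fun Z hZ hZS => ?_⟩
  · rintro (⟨k, j⟩ | j)
    exacts [hY k j, hα j]
  · rintro ⟨x, z⟩ hxz Z rfl
    rw [← ball_prod_same] at hxz
    obtain ⟨hx, hz⟩ := hxz
    replace hx : x ∈ ball (0 : E) ρ := hx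
    replace hz : z ∈ ball (0 : ℂ) ρ := hz
    obtain ⟨hq, H0, -, -⟩ := H x hx
    let Z : ℂ → CofactorIndex τ ι s → ℂ := fun z =>
      Sum.elim (fun k => Q k (x, z)) (Sum.elim (fun j => β j x) fun _ => z)
    have hZ : ContinuousOn Z (ball 0 ρ) := by
      refine continuousOn_pi.2 ?_
      rintro (k | j | _)
      · refine (hQ k).continuousOn.comp (by fun_prop) fun z hz => ?_
        rw [← ball_prod_same]
        exact ⟨hx, hz⟩
      · exact continuousOn_const
      · exact continuousOn_id
    have hZa : ∀ z, eval (Z z) aT = (monicPoly fun j => α j x).eval z := fun z => haT _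
    have hZw : ∀ z ∈ ball (0 : ℂ) ρ, ∀ k, eval (Z z) (wT k) = w k (x, z) := fun z hz k => by
      rw [hwT, hZa]
      exact ((H0 z hz).2.1 k).symm
    have hxzR : ∀ z ∈ ball (0 : ℂ) ρ, (x, z) ∈ ball (0 : E × ℂ) R := fun z hz => by
      rw [← ball_prod_same]
      exact ⟨ball_subset_ball hρR hx, ball_subset_ball hρR hz⟩
    have hcont : ∀ p : MvPolynomial (CofactorIndex τ ι s) ℂ,
        ContinuousOn (fun z => eval (Z z) p) (ball 0 ρ) := fun p =>
      (hdiff p).continuous.comp_continuousOn hZ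
    have hzero := fun f hf h => (monic_monicPoly fun j => α j x).eq_zero_of_continuousOn
      (isOpen_ball (x := (0 : ℂ)) (ε := ρ)) (f := f) hf h z hz
    have hD := fun z => hdata (Z z) fun e he => hSβ e he x hx
    have hu : eval (Z z) cδ - q (x, z) = 0 := by
      refine hzero (fun z => eval (Z z) cδ - q (x, z)) ((hcont _).sub hq) fun z hz ha => ?_
      have h1 := (hD z).1
      simp only [hZw z hz, hZa, (H0 z hz).2.2] at h1
      rw [mul_comm] at h1
      rw [mul_left_cancel₀ ha h1, sub_self]
    have hc : eval (Z z) cP = 0 := by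
      refine hzero (fun z => eval (Z z) cP) (hcont _) fun z hz ha => ?_
      have h1 := (hD z).2.1
      simp only [hZw z hz, hZa, pP, hinl] at h1
      have h2 := hP _ (hxzR z hz)
      exact (mul_eq_zero.1 (h1.symm.trans h2)).resolve_left (pow_ne_zero _ ha)
    have hb : ∀ i, eval (Z z) (cA i) = 0 := fun i => by
      refine hzero (fun z => eval (Z z) (cA i)) (hcont _) fun z hz ha => ?_
      have h1 := (hD z).2.2 i
      simp only [hZw z hz, hZa, hpA] at h1
      have h2 := sub_eq_zero.2 (hA _ (hxzR z hz) i)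
      exact (mul_eq_zero.1 (h1.symm.trans h2)).resolve_left (pow_ne_zero _ ha)
    obtain ⟨hV', hy'⟩ := hfix (Z z) hc hb
    refine ⟨hmem (Z z) ?_ hc, hV'.trans (funext fun k => hZw z hz _),
      hy'.trans (funext fun k => hZw z hz _)⟩
    rw [sub_eq_zero.1 hu]
    exact (H0 z hz).1
  · obtain ⟨h1, h2, h3⟩ := hdata Z hZS
    refine hnewton Z hZ ?_ (fun i => ?_) ?_
    · rwa [hinl] at h2
    · rw [← h3, hpA]
    · rwa [hinl] at h1

end Parametrization

section NashCriterion

open MvPolynomial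

variable {E : Type} [NormedAddCommGroup E] [NormedSpace ℂ E]

theorem nashOn_of_presentation {U : Set E} (hU : IsOpen U) (hc : Convex ℝ U) {ι τ : Type}
    {P : MvPolynomial (Option τ) ℂ} {D : MvPolynomial τ ℂ} {A : ι → MvPolynomial (Option τ) ℂ}
    {v : E → Option τ → ℂ} {y : E → ι → ℂ} (hv : ∀ t, NashOn U fun x => v x (some t))
    (hvd : DifferentiableOn ℂ (fun x => v x none) U)
    (hyd : ∀ i, DifferentiableOn ℂ (fun x => y x i) U) (hP : ∀ x ∈ U, eval (v x) P = 0)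
    (hA : ∀ x ∈ U, ∀ i, eval (v x) (rename some D) * y x i = eval (v x) (A i)) {x₀ : E}
    (hx₀ : x₀ ∈ U) (hne : eval (v x₀) (pderiv none P * rename some D) ≠ 0) (i : ι) :
    NashOn U fun x => y x i := by
  rw [map_mul] at hne
  have hnone : NashOn U fun x => v x none := by
    obtain ⟨p, rfl⟩ := (optionEquivLeft ℂ τ).symm.surjective P
    have hp : ∀ (w : Option τ → ℂ) (p : Polynomial (MvPolynomial τ ℂ)),
        eval w ((optionEquivLeft ℂ τ).symm p) = p.eval₂ (eval fun t => w (some t)) (w none) :=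
      fun w p => aeval_optionEquivLeft_symm w p
    refine NashOn.of_root hU hc hv p hx₀ (fun h => left_ne_zero_of_mul hne ?_) hvd
      fun x hx => by rw [← hp]; exact hP x hx
    rw [pderiv_optionEquivLeft_symm, hp, Polynomial.eval₂_eq_eval_map,
      ← Polynomial.derivative_map, h]
    simp
  refine NashOn.of_root hU hc (t := fun k x => v x k) (Option.forall.2 ⟨hnone, hv⟩)
    (Polynomial.C (rename some D) * Polynomial.X - Polynomial.C (A i)) hx₀ (fun h => ?_) (hyd i)
    fun x hx => ?_
  · have h1 := congrArg (fun p => Polynomial.coeff p 1) h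
    simp [Polynomial.coeff_C] at h1
    exact right_ne_zero_of_mul hne h1
  · simpa [sub_eq_zero] using hA x hx i

end NashCriterion

theorem TendstoUniformlyOn.exists_tail_comp {X G : Type} [MetricSpace G] [ProperSpace G]
    {Z : X → G} {Zs : ℕ → X → G} {s : Set X} (h : TendstoUniformlyOn Zs Z atTop s)
    {K Ω : Set G} (hK : IsCompact K) (hZ : ∀ x ∈ s, Z x ∈ K) (hΩ : IsOpen Ω) (hKΩ : K ⊆ Ω) :
    (∀ᶠ n in atTop, ∀ x ∈ s, Zs n x ∈ Ω) ∧
      ∀ {H : Type} [UniformSpace H] (Γ : G → H), ContinuousOn Γ Ω →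
        TendstoUniformlyOn (fun n x => Γ (Zs n x)) (fun x => Γ (Z x)) atTop s := by
  obtain ⟨ε, hε, hsub⟩ := hK.exists_cthickening_subset_open hΩ hKΩ
  have hmem : ∀ᶠ n in atTop, ∀ x ∈ s, Zs n x ∈ Metric.cthickening ε K := by
    filter_upwards [Metric.tendstoUniformlyOn_iff.1 h ε hε] with n hn x hx
    exact Metric.mem_cthickening_of_dist_le _ _ _ _ (hZ x hx)
      ((dist_comm _ _).trans_lt (hn x hx)).le
  refine ⟨hmem.mono fun n hn x hx => hsub (hn x hx), fun {H} _ Γ hΓ u hu => ?_⟩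
  have huc := hK.cthickening.uniformContinuousOn_of_continuous (hΓ.mono hsub) hu
  filter_upwards [hmem, h _ (mem_inf_principal.1 huc)] with n hn hn' x hx
  exact hn' x hx ⟨Metric.self_subset_cthickening _ (hZ x hx), hn x hx⟩

section NashApproximation

open Metric MvPolynomial

/-- Local approximation at the origin of holomorphic solutions of finitely many polynomial
equations by Nash solutions. -/
def NashApprox (E : Type) [NormedAddCommGroup E] [NormedSpace ℂ E] : Prop :=
  ∀ (ι : Type) [Fintype ι] (F : E → ι → ℂ) (R : ℝ) (S : Set (MvPolynomial ι ℂ)), 0 < R →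
    S.Finite → (∀ i, DifferentiableOn ℂ (fun x => F x i) (ball 0 R)) →
    (∀ q ∈ S, ∀ x ∈ ball 0 R, eval (F x) q = 0) →
    ∃ r, 0 < r ∧ r ≤ R ∧ ∃ G : ℕ → E → ι → ℂ, (∀ n i, NashOn (ball 0 r) fun x => G n x i) ∧
      (∀ n, ∀ q ∈ S, ∀ x ∈ ball 0 r, eval (G n x) q = 0) ∧
      TendstoUniformlyOn G F atTop (ball 0 r)

variable {E : Type} [NormedAddCommGroup E] [NormedSpace ℂ E]

theorem NashApprox.exists_of_presentation [FiniteDimensional ℂ E] (hE : NashApprox E)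
    (hE' : UnrestrictedApprox (E × ℂ)) {ι τ : Type} [Fintype ι] [Fintype τ]
    (P : MvPolynomial (Option τ) ℂ) (D : MvPolynomial τ ℂ)
    (A : ι → MvPolynomial (Option τ) ℂ) {R : ℝ} (hR : 0 < R) {v : E × ℂ → Option τ → ℂ}
    {F : E × ℂ → ι → ℂ} (hv : ∀ k, DifferentiableOn ℂ (fun x => v x k) (ball 0 R))
    (hF : ∀ i, DifferentiableOn ℂ (fun x => F x i) (ball 0 R))
    (hP : ∀ x ∈ ball (0 : E × ℂ) R, eval (v x) P = 0)
    (hA : ∀ x ∈ ball (0 : E × ℂ) R, ∀ i, eval (v x) (rename some D) * F x i = eval (v x) (A i))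
    (hδ : ¬ ∀ᶠ z in 𝓝 (0 : ℂ), eval (v (0, z)) (pderiv none P * rename some D) = 0)
    {S : Set (MvPolynomial ι ℂ)} (hS : S.Finite)
    (hSe : ∀ q ∈ S, ∃ e, (¬ ∀ᶠ x in 𝓝 (0 : E × ℂ), eval (v x) e = 0) ∧
      ∀ v' y', eval v' P = 0 → (∀ i, eval v' (rename some D) * y' i = eval v' (A i)) →
        eval v' e * eval y' q = 0) :
    ∃ r, 0 < r ∧ r ≤ R ∧ ∃ G : ℕ → E × ℂ → ι → ℂ,
      (∀ n i, NashOn (ball 0 r) fun x => G n x i) ∧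
      (∀ n, ∀ q ∈ S, ∀ x ∈ ball 0 r, eval (G n x) q = 0) ∧
      TendstoUniformlyOn G F atTop (ball 0 r) := by
  choose! e he hSe using hSe
  obtain ⟨J, _, ρ, β, Q, S', Ω, V, y, p, hρ, hρR, hβ, hQ, hS', hSβ, hΩ, hV, hy, hVp, hex, hsol⟩ :=
    exists_holomorphic_parametrization P D A hR hv hF hP hA hδ
  obtain ⟨r₁, hr₁, hr₁ρ, B, hB, hBS, hBlim⟩ := hE J (fun x j => β j x) ρ S' hρ hS' hβ hSβ
  obtain ⟨r₂, hr₂, H⟩ := hE' ρ hρ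
  choose g hg hgQ using fun (n : ℕ) k => H (Q k) (hQ k) (1 / ((n : ℝ) + 1)) (by positivity)
  obtain ⟨r, hr, hrlt⟩ := exists_between (lt_min hr₁ hr₂)
  have hrr₁ : r < r₁ := hrlt.trans_le (min_le_left _ _)
  have hrr₂ : r < r₂ := hrlt.trans_le (min_le_right _ _)
  have hrρ : r < ρ := hrr₁.trans_le hr₁ρ
  let U : Set (E × ℂ) := ball 0 r
  have hU : IsOpen U := isOpen_ball
  have hUc : Convex ℝ U := convex_ball 0 r
  have hUne : U.Nonempty := ⟨0, mem_ball_self hr⟩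
  have hUρ : U ⊆ ball 0 ρ := ball_subset_ball hrρ.le
  have hfst : ∀ {s : ℝ} {x : E × ℂ}, x ∈ ball (0 : E × ℂ) s → x.1 ∈ ball (0 : E) s := by
    intro s x hx
    rw [mem_ball_zero_iff] at hx ⊢
    exact (norm_fst_le x).trans_lt hx
  let Z : E × ℂ → (Option τ ⊕ ι) ⊕ (J ⊕ Unit) → ℂ := fun x =>
    Sum.elim (fun k => Q k x) (Sum.elim (fun j => β j x.1) fun _ => x.2)
  let Zs : ℕ → E × ℂ → (Option τ ⊕ ι) ⊕ (J ⊕ Unit) → ℂ := fun n x =>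
    Sum.elim (fun k => g n k x) (Sum.elim (fun j => B n x.1 j) fun _ => x.2)
  have hZcont : ContinuousOn Z (ball 0 ρ) := by
    refine continuousOn_pi.2 ?_
    rintro (k | j | _)
    · exact (hQ k).continuousOn
    · exact (hβ j).continuousOn.comp continuousOn_fst fun x hx => hfst hx
    · exact continuousOn_snd
  have hZsNash : ∀ n k, NashOn U fun x => Zs n x k := by
    rintro n (k | j | _)
    · exact (hg n k).mono hU hUne isOpen_univ convex_univ (Set.subset_univ _)
    · change NashOn U fun x => B n x.1 j
      simpa using (hB n j).comp_affine hU hUne isOpen_ball (convex_ball 0 r₁)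
        (ContinuousLinearMap.fst ℂ E ℂ) isOpenMap_fst 0 fun x hx => by
          simpa using ball_subset_ball hrr₁.le (hfst hx)
    · exact NashOn.clm hU hUc hUne (ContinuousLinearMap.snd ℂ E ℂ)
  have hZsdiff : ∀ n, DifferentiableOn ℂ (Zs n) U := fun n =>
    differentiableOn_pi.2 fun k => (hZsNash n k).1
  have hZlim : TendstoUniformlyOn Zs Z atTop U := by
    rw [Metric.tendstoUniformlyOn_iff]
    intro ε hε
    filter_upwards [Metric.tendstoUniformlyOn_iff.1 hBlim ε hε,
      tendsto_one_div_add_atTop_nhds_zero_nat.eventually_lt_const hε] with n hn hn' x hx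
    rw [dist_pi_lt_iff hε]
    rintro (k | j | _)
    · exact (dist_eq_norm (Q k x) _).trans_lt
        ((hgQ n k x (ball_subset_ball hrr₂.le hx)).trans hn')
    · exact (dist_le_pi_dist (fun j => β j x.1) (B n x.1) j).trans_lt
        (hn x.1 (ball_subset_ball hrr₁.le (hfst hx)))
    · simpa [Z, Zs] using hε
  have hprop : ProperSpace (E × ℂ) := FiniteDimensional.proper ℂ _
  have hsubρ : closedBall (0 : E × ℂ) r ⊆ ball 0 ρ := closedBall_subset_ball hrρ
  obtain ⟨hmem, hcomp⟩ := hZlim.exists_tail_comp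
    ((isCompact_closedBall 0 r).image_of_continuousOn (hZcont.mono hsubρ))
    (fun x hx => Set.mem_image_of_mem Z (ball_subset_closedBall hx)) hΩ (by
      rintro _ ⟨x, hx, rfl⟩
      exact (hex x (hsubρ hx) _ rfl).1)
  have hVpoly : ∀ q : MvPolynomial (Option τ) ℂ, DifferentiableOn ℂ (fun Z => eval (V Z) q) Ω :=
    fun q => DifferentiableOn.mvPolynomial_aeval hV q
  have hypoly : ∀ q : MvPolynomial ι ℂ, DifferentiableOn ℂ (fun Z => eval (y Z) q) Ω :=
    fun q => DifferentiableOn.mvPolynomial_aeval hy q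
  have hne : ∀ q : MvPolynomial (Option τ) ℂ, (¬ ∀ᶠ x in 𝓝 (0 : E × ℂ), eval (v x) q = 0) →
      ∀ᶠ n in atTop, ∃ x ∈ U, eval (V (Zs n x)) q ≠ 0 := by
    intro q hq
    obtain ⟨x, hx, hqx⟩ : ∃ x ∈ U, eval (v x) q ≠ 0 := by
      by_contra! hcon
      exact hq (eventually_of_mem (ball_mem_nhds 0 hr) hcon)
    rw [← (hex x (hUρ hx) _ rfl).2.1] at hqx
    filter_upwards [((hcomp (fun Z => eval (V Z) q)
      (hVpoly q).continuousOn).tendsto_at hx).eventually_ne hqx] with n hn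
      using ⟨x, hx, hn⟩
  have hδ' : ¬ ∀ᶠ x in 𝓝 (0 : E × ℂ), eval (v x) (pderiv none P * rename some D) = 0 := fun h =>
    hδ ((Continuous.prodMk_right (0 : E)).continuousAt.eventually h)
  obtain ⟨N, hN⟩ := eventually_atTop.1
    (hmem.and ((hne _ hδ').and ((eventually_all_finite hS).2 fun q hq => hne _ (he q hq))))
  have hsol' : ∀ n, ∀ x ∈ U, eval (V (Zs (n + N) x)) P = 0 ∧ ∀ i,
      eval (V (Zs (n + N) x)) (rename some D) * y (Zs (n + N) x) i =
        eval (V (Zs (n + N) x)) (A i) := fun n x hx =>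
    hsol _ ((hN _ (N.le_add_left n)).1 x hx) fun q hq =>
      hBS _ q hq _ (ball_subset_ball hrr₁.le (hfst hx))
  refine ⟨r, hr, hrρ.le.trans hρR, fun n x => y (Zs (n + N) x), fun n i => ?_, fun n q hq => ?_, ?_⟩
  · obtain ⟨hm, ⟨x₀, hx₀, hne₀⟩, -⟩ := hN _ (N.le_add_left n)
    refine nashOn_of_presentation hU hUc (v := fun x => V (Zs (n + N) x)) (fun t => ?_)
      ((hV none).comp (hZsdiff _) hm) (fun i => (hy i).comp (hZsdiff _) hm)
      (fun x hx => (hsol' n x hx).1) (fun x hx => (hsol' n x hx).2) hx₀ hne₀ i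
    simp only [hVp]
    exact NashOn.eval hU hUc hUne (hZsNash _) (p t)
  · obtain ⟨hm, -, hmS⟩ := hN _ (N.le_add_left n)
    obtain ⟨x₀, hx₀, hne₀⟩ := hmS q hq
    exact (eqOn_zero_or_of_mul hU hUc ((hVpoly (e q)).comp (hZsdiff _) hm)
      ((hypoly q).comp (hZsdiff _) hm) fun x hx => hSe q hq _ _ (hsol' n x hx).1
        (hsol' n x hx).2).resolve_left fun h => hne₀ (h x₀ hx₀)
  · have hlim := hcomp y (continuousOn_pi.2 fun i => (hy i).continuousOn)
    intro u hu
    filter_upwards [(tendsto_add_atTop_nat N).eventually (hlim u hu)] with n hn x hx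
    rw [← (hex x (hUρ hx) _ rfl).2.2]
    exact hn x hx

end NashApproximation

section NashInduction

open Metric MvPolynomial

variable {E E' : Type} [NormedAddCommGroup E] [NormedSpace ℂ E] [NormedAddCommGroup E']
  [NormedSpace ℂ E']

theorem exists_direction_not_eventually_zero [Nontrivial E] {R : ℝ} {f : E → ℂ}
    (hf : DifferentiableOn ℂ f (ball 0 R)) (hR : 0 < R) (h : ¬ ∀ᶠ x in 𝓝 0, f x = 0) :
    ∃ e : E, e ≠ 0 ∧ ¬ ∀ᶠ z : ℂ in 𝓝 0, f (z • e) = 0 := by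
  by_contra! hcon
  refine h (eventually_of_mem (ball_mem_nhds 0 hR) fun x hx => ?_)
  by_cases hx0 : x = 0
  · obtain ⟨e, he⟩ := exists_ne (0 : E)
    simpa [hx0] using (hcon e he).self_of_nhds
  · have hd : Differentiable ℂ fun z : ℂ => z • x := by fun_prop
    obtain ⟨W, hW, hWo, h0W⟩ := _root_.eventually_nhds_iff.1 (hcon x hx0)
    have h1 := eqOn_zero_of_convex (isOpen_ball.preimage hd.continuous)
      ((convex_ball (0 : E) R).linear_preimage
        ((LinearMap.toSpanSingleton ℂ E x).restrictScalars ℝ))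
      (hf.comp hd.differentiableOn (Set.mapsTo_preimage _ _)) hWo ⟨0, h0W, by simpa using hR⟩
      (fun z hz => hW z hz.1) 1 (by simpa using hx)
    simpa using h1

theorem NashApprox.of_finrank_eq_add_one [FiniteDimensional ℂ E] [FiniteDimensional ℂ E']
    (hE : NashApprox E) (hE' : UnrestrictedApprox (E × ℂ))
    (hrank : Module.finrank ℂ E' = Module.finrank ℂ E + 1) : NashApprox E' := by
  intro ι _ F R S hR hS hF hFS
  have hU : IsOpen (ball (0 : E') R) := isOpen_ball
  have hUc : Convex ℝ (ball (0 : E') R) := convex_ball 0 R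
  have : IsDomain (holFn (ball (0 : E') R)) :=
    isDomain_of_le_holFn hU hUc ⟨0, mem_ball_self hR⟩ le_rfl
  have : Nontrivial E' := Module.nontrivial_of_finrank_pos (R := ℂ) (by omega)
  let Fh : ι → holFn (ball (0 : E') R) := fun i =>
    ⟨(ball (0 : E') R).domRestrict fun x => F x i, _, hF i, rfl⟩
  obtain ⟨τ, _, vh, P, D, A, hP, hP', hD, hA, hrel⟩ := exists_simple_presentation Fh
  choose v hv hvh using fun k => (vh k).2
  have heval : ∀ {κ : Type} {w : κ → E' → ℂ} {wh : κ → holFn (ball (0 : E') R)},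
      (∀ k, (ball (0 : E') R).domRestrict (w k) = wh k) → ∀ p (x : ball (0 : E') R),
      (aeval wh p : holFn (ball (0 : E') R)).1 x = eval (fun k => w k x) p := by
    intro κ w wh h p x
    have h1 := comp_aeval_apply (R := ℂ) wh ((Pi.evalAlgHom ℂ (fun _ => ℂ) x).comp
      (holFn (ball (0 : E') R)).val) p
    have h2 : (fun k => ((Pi.evalAlgHom ℂ (fun _ => ℂ) x).comp
      (holFn (ball (0 : E') R)).val) (wh k)) = fun k => w k x := funext fun k =>
        (congrFun (h k) x).symm
    rw [h2] at h1
    exact h1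
  have hvd : ∀ p : MvPolynomial (Option τ) ℂ,
      DifferentiableOn ℂ (fun x => eval (fun k => v k x) p) (ball 0 R) := fun p =>
    DifferentiableOn.mvPolynomial_aeval hv p
  have hne : ∀ p, aeval vh p ≠ 0 → ¬ ∀ᶠ x in 𝓝 0, eval (fun k => v k x) p = 0 := by
    intro p hp h
    obtain ⟨W, hW, hWo, h0W⟩ := _root_.eventually_nhds_iff.1 h
    refine hp (Subtype.ext (funext fun x => ?_))
    rw [heval hvh]
    exact eqOn_zero_of_convex hU hUc (hvd p) hWo ⟨0, h0W, mem_ball_self hR⟩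
      (fun x hx => hW x hx.1) x x.2
  obtain ⟨e, he0, he⟩ := exists_direction_not_eventually_zero (hvd _) hR
    (hne (pderiv none P * rename some D) (by rw [map_mul]; exact mul_ne_zero hP' hD))
  let Φ₀ : (E × ℂ) ≃L[ℂ] E' := ContinuousLinearEquiv.ofFinrankEq (by simp [hrank])
  obtain ⟨Ψ, hΨ⟩ := SeparatingDual.exists_continuousLinearEquiv_apply_eq (R := ℂ)
    (x := Φ₀ (0, 1)) (y := e) (by simp) he0
  let Φ : (E × ℂ) ≃L[ℂ] E' := Φ₀.trans Ψ
  have hΦ : ∀ z : ℂ, Φ (0, z) = z • e := fun z => by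
    have : ((0 : E), z) = z • ((0 : E), (1 : ℂ)) := by simp
    rw [this, map_smul]
    exact congrArg (z • ·) hΨ
  obtain ⟨R', hR', hΦR⟩ := Φ.exists_ball_subset hR
  obtain ⟨r', hr', -, G, hG, hGS, hlim⟩ := hE.exists_of_presentation hE' P D A hR'
    (v := fun x k => v k (Φ x)) (F := fun x => F (Φ x))
    (fun k => (hv k).comp Φ.differentiable.differentiableOn hΦR)
    (fun i => (hF i).comp Φ.differentiable.differentiableOn hΦR)
    (fun x hx => by rw [← heval hvh P ⟨_, hΦR x hx⟩, hP]; rfl)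
    (fun x hx i => by
      rw [← heval hvh _ ⟨_, hΦR x hx⟩, ← heval hvh _ ⟨_, hΦR x hx⟩, ← hA]; rfl)
    (by simpa only [hΦ] using he) hS (fun q hq => by
      obtain ⟨a, ha, H⟩ := hrel q (Subtype.ext (funext fun x => by
        rw [heval (w := fun i x => F x i) fun _ => rfl]
        exact hFS q hq x x.2))
      refine ⟨a, fun h => hne a ha ?_, H⟩
      have h1 := Φ.symm.continuous.continuousAt.eventually
        (show ∀ᶠ x in 𝓝 (Φ.symm 0), eval (fun k => v k (Φ x)) a = 0 by rwa [map_zero])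
      simpa using h1)
  obtain ⟨r, hr, hΦr⟩ := Φ.symm.exists_ball_subset hr'
  have hsub : ∀ x ∈ ball (0 : E') (min r R), Φ.symm x ∈ ball (0 : E × ℂ) r' := fun x hx =>
    hΦr x (ball_subset_ball (min_le_left _ _) hx)
  refine ⟨min r R, lt_min hr hR, min_le_right _ _, fun n x => G n (Φ.symm x), fun n i => ?_,
    fun n q hq x hx => hGS n q hq _ (hsub x hx), fun u hu => ?_⟩
  · simpa using (hG n i).comp_affine isOpen_ball
      ⟨0, mem_ball_self (lt_min hr hR)⟩ isOpen_ball (convex_ball 0 r')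
      (Φ.symm : E' →L[ℂ] E × ℂ) Φ.symm.toHomeomorph.isOpenMap 0
      (fun x hx => by rw [add_zero]; exact hsub x hx)
  · filter_upwards [hlim u hu] with n hn x hx
    simpa using hn _ (hsub x hx)

theorem nashApprox_pi (n : ℕ) : NashApprox (Fin n → ℂ) := by
  induction n with
  | zero =>
    intro ι _ F R S hR _ _ hFS
    refine ⟨R, hR, le_rfl, fun _ _ => F 0, fun _ i => NashOn.const isOpen_ball (convex_ball 0 R)
      ⟨0, mem_ball_self hR⟩ _, fun _ q hq _ _ => hFS q hq 0 (mem_ball_self hR), fun u hu => ?_⟩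
    refine Eventually.of_forall fun _ x _ => ?_
    rw [Subsingleton.elim x 0]
    exact mem_uniformity_of_eq hu rfl
  | succ n ih =>
    exact ih.of_finrank_eq_add_one (unrestrictedApprox_pi n).prod (by simp)

end NashInduction

theorem stmt_1 (n M : ℕ) (U : Set (Fin n → ℂ)) (hU : IsOpen U) (hUc : IsConnected U)
    (V : Set (Fin M → ℂ)) (hV : IsAlgSet M V)
    (F : (Fin n → ℂ) → (Fin M → ℂ)) (hF : DifferentiableOn ℂ F U)
    (hFV : ∀ x ∈ U, F x ∈ V)
    (x₀ : Fin n → ℂ) (hx₀ : x₀ ∈ U) :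
    ∃ U₀ : Set (Fin n → ℂ), IsOpen U₀ ∧ x₀ ∈ U₀ ∧ U₀ ⊆ U ∧
      ∃ G : ℕ → (Fin n → ℂ) → (Fin M → ℂ),
        (∀ ν i, NashFn n U₀ (fun x => G ν x i)) ∧
        (∀ ν, ∀ x ∈ U₀, G ν x ∈ V) ∧
        TendstoUniformlyOn G F atTop U₀ := by
  obtain ⟨k, ps, rfl⟩ := hV
  obtain ⟨R, hR, hRU⟩ := Metric.isOpen_iff.1 hU x₀ hx₀
  have hmaps : ∀ {s : ℝ}, ∀ x ∈ Metric.ball (0 : Fin n → ℂ) s, x + x₀ ∈ Metric.ball x₀ s := by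
    intro s x hx
    simpa [dist_eq_norm] using hx
  have hmaps' : ∀ {s : ℝ}, ∀ x ∈ Metric.ball x₀ s, x - x₀ ∈ Metric.ball (0 : Fin n → ℂ) s := by
    intro s x hx
    simpa [dist_eq_norm] using hx
  obtain ⟨r, hr, hrR, G, hG, hGS, hlim⟩ := nashApprox_pi n (Fin M) (fun x => F (x + x₀)) R
    (Set.range ps) hR (Set.finite_range ps)
    (fun i => (differentiableOn_pi.1 hF i).comp (by fun_prop) fun x hx => hRU (hmaps x hx))
    (by
      rintro _ ⟨j, rfl⟩ x hx
      exact hFV _ (hRU (hmaps x hx)) j)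
  refine ⟨Metric.ball x₀ r, Metric.isOpen_ball, Metric.mem_ball_self hr,
    (Metric.ball_subset_ball hrR).trans hRU, fun ν x => G ν (x - x₀), fun ν i => ?_,
    fun ν x hx j => hGS ν _ ⟨j, rfl⟩ _ (hmaps' x hx), fun u hu => ?_⟩
  · refine NashOn.nashFn Metric.isOpen_ball ?_
    simpa [sub_eq_add_neg] using (hG ν i).comp_affine Metric.isOpen_ball
      ⟨x₀, Metric.mem_ball_self hr⟩ Metric.isOpen_ball (convex_ball 0 r)
      (ContinuousLinearMap.id ℂ (Fin n → ℂ)) IsOpenMap.id (-x₀) fun x hx => by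
        simpa [sub_eq_add_neg] using hmaps' x hx
  · filter_upwards [hlim u hu] with ν hν x hx
    simpa using hν _ (hmaps' x hx)
end

section
/- Let U₀ ⊂⊂ U₁ be open subsets of C^n with U₀ relatively compact in U₁, and let (F̃^ν : U₁ → C^n) be a sequence of Nash mappings converging uniformly on U₁ to the identity map. Then for all sufficiently large ν there exists a Nash mapping H^ν : U₀ → U₁ with F̃^ν ∘ H^ν = id_{U₀}. -/
open Filter Topology

open Metric in
/-- A holomorphic map close to the identity near `U` has a holomorphic right inverse on `U`,
which is also a local left inverse. -/
theorem exists_differentiableOn_rightInverse {E : Type*} [NormedAddCommGroup E] [NormedSpace ℂ E]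
    [CompleteSpace E] {F : E → E} {U : Set E} (hU : IsOpen U) {r : ℝ} (hr : 0 < r)
    (hF : ∀ y ∈ U, DifferentiableOn ℂ F (ball y (4 * r)))
    (hFr : ∀ y ∈ U, ∀ x ∈ ball y (4 * r), ‖F x - x‖ < r / 4) :
    ∃ H : E → E, DifferentiableOn ℂ H U ∧ (∀ y ∈ U, H y ∈ closedBall y r) ∧
      (∀ y ∈ U, F (H y) = y) ∧ ∀ y ∈ U, ∀ᶠ x in 𝓝 (H y), H (F x) = x := by
  have hdG : ∀ y ∈ U, ∀ x ∈ ball y (3 * r), ‖fderiv ℂ (fun z => F z - z) x‖ ≤ 1 / 2 := by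
    intro y hy x hx
    have hsub : ball x r ⊆ ball y (4 * r) := ball_subset_ball' (by
      rw [mem_ball] at hx; linarith)
    have := Complex.norm_fderiv_le_div_of_mapsTo_ball (R₂ := r / 2)
      (((hF y hy).mono hsub).fun_sub differentiableOn_id) (fun z hz => ?_) hr
    · refine this.trans (le_of_eq ?_)
      field_simp
    · rw [mem_closedBall, dist_eq_norm]
      have h1 := hFr y hy z (hsub hz)
      have h2 := hFr y hy x (hsub (mem_ball_self hr))
      refine (norm_sub_le _ _).trans ?_
      simp only [id]
      linarith
  have hat : ∀ y ∈ U, ∀ x ∈ ball y (3 * r), DifferentiableAt ℂ F x := fun y hy x hx =>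
    (hF y hy).differentiableAt (isOpen_ball.mem_nhds (ball_subset_ball (by linarith) hx))
  have hapx : ∀ y ∈ U, ApproximatesLinearOn F (ContinuousLinearMap.id ℂ E) (ball y (3 * r))
      (1 / 2) := by
    intro y hy x hx x' hx'
    have := (convex_ball y (3 * r)).norm_image_sub_le_of_norm_fderiv_le (𝕜 := ℂ)
      (fun z hz => (hat y hy z hz).fun_sub differentiableAt_id) (hdG y hy) hx' hx
    convert this using 2
    · simp only [id, ContinuousLinearMap.id_apply]; abel_nf
    · simp
  have hanti : ∀ y ∈ U, ∀ x ∈ ball y (3 * r), ∀ x' ∈ ball y (3 * r),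
      ‖x - x'‖ ≤ 2 * ‖F x - F x'‖ := by
    intro y hy x hx x' hx'
    have h1 := hapx y hy x hx x' hx'
    have h2 := norm_sub_norm_le (x - x') (F x - F x')
    rw [norm_sub_rev (x - x') (F x - F x')] at h2
    norm_num at h1
    linarith
  have hex : ∀ y ∈ U, ∃ x ∈ closedBall y r, F x = y := by
    intro y hy
    have := (hapx y hy).surjOn_closedBall_of_nonlinearRightInverse
      ⟨id, 1, fun _ => by simp, fun _ => rfl⟩ hr.le
      (closedBall_subset_ball (by linarith))
    refine this ?_
    have h := hFr y hy y (mem_ball_self (by linarith))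
    rw [mem_closedBall, dist_comm, dist_eq_norm]
    push_cast
    linarith
  choose! H hH hFH using hex
  have hHcont : ∀ y ∈ U, ContinuousAt H y := by
    intro y hy
    rw [Metric.continuousAt_iff]
    intro ε hε
    obtain ⟨δ, hδ, hδU⟩ := Metric.isOpen_iff.1 hU y hy
    refine ⟨min δ (min r (ε / 2)), by positivity, fun {z} hz => ?_⟩
    simp only [lt_min_iff] at hz
    have hzU := hδU hz.1
    have hz1 := hH z hzU
    have hy1 := hH y hy
    rw [mem_closedBall] at hz1 hy1
    have := hanti y hy (H z)
      (by rw [mem_ball]; linarith [dist_triangle (H z) z y]) (H y) (by rw [mem_ball]; linarith)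
    rw [hFH z hzU, hFH y hy, ← dist_eq_norm, ← dist_eq_norm] at this
    linarith
  have hH3 : ∀ y ∈ U, H y ∈ ball y (3 * r) := fun y hy =>
    closedBall_subset_ball (by linarith) (hH y hy)
  refine ⟨H, fun y hy => ?_, hH, hFH, fun y hy => ?_⟩
  · have hd := hat y hy _ (hH3 y hy)
    have hb := hdG y hy _ (hH3 y hy)
    rw [fderiv_fun_sub hd differentiableAt_fun_id] at hb
    have hid : fderiv ℂ (fun z : E => z) (H y) = 1 := fderiv_fun_id
    rw [hid, norm_sub_rev] at hb
    let u := Units.oneSub (1 - fderiv ℂ F (H y)) (lt_of_le_of_lt hb (by norm_num))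
    have hu : (ContinuousLinearEquiv.unitsEquiv ℂ E u : E →L[ℂ] E) = fderiv ℂ F (H y) := by
      ext x
      simp [u]
    have hd' := hd.hasFDerivAt
    rw [← hu] at hd'
    exact (HasFDerivAt.of_local_left_inverse (hHcont y hy) hd'
      ((hU.eventually_mem hy).mono hFH)).differentiableAt.differentiableWithinAt
  · have hFc : ContinuousAt F (H y) := (hat y hy _ (hH3 y hy)).continuousAt
    have h1 : ∀ᶠ x in 𝓝 (H y), F x ∈ U := hFc.eventually_mem (by
      rw [hFH y hy]; exact hU.mem_nhds hy)
    have h2 : ∀ᶠ x in 𝓝 (H y), H (F x) ∈ ball y (3 * r) := by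
      have : ContinuousAt (H ∘ F) (H y) :=
        ContinuousAt.comp (by rw [hFH y hy]; exact hHcont y hy) hFc
      refine this.eventually_mem (isOpen_ball.mem_nhds ?_)
      simp only [Function.comp, hFH y hy, hH3 y hy]
    filter_upwards [h1, h2, isOpen_ball.mem_nhds (hH3 y hy)] with x hx1 hx2 hx3
    have := hanti y hy _ hx2 x hx3
    rw [hFH _ hx1, sub_self, norm_zero, mul_zero] at this
    exact sub_eq_zero.1 (norm_le_zero_iff.1 this)

/-- If each `y j` is algebraic over the algebraically independent family `h`, then each `h i`
satisfies a nonzero polynomial relation with the family `y`. -/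
theorem MvPolynomial.exists_ne_zero_eval₂_eq_zero {n : ℕ} {D : Type*} [CommRing D] [IsDomain D]
    [Algebra ℂ D] {h y : Fin n → D} (hh : AlgebraicIndependent ℂ h)
    {P : Fin n → Polynomial (MvPolynomial (Fin n) ℂ)} (hP : ∀ j, P j ≠ 0)
    (hPy : ∀ j, Polynomial.eval₂ (MvPolynomial.aeval h : _ →ₐ[ℂ] D).toRingHom (y j) (P j) = 0)
    (i : Fin n) :
    ∃ Q : Polynomial (MvPolynomial (Fin n) ℂ), Q ≠ 0 ∧
      Polynomial.eval₂ (MvPolynomial.aeval y : _ →ₐ[ℂ] D).toRingHom (h i) Q = 0 := by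
  have halg : ∀ a ∈ Set.range h ∪ Set.range y, IsAlgebraic (Algebra.adjoin ℂ (Set.range h)) a := by
    rintro _ (⟨j, rfl⟩ | ⟨j, rfl⟩)
    · exact isAlgebraic_algebraMap
        (⟨h j, Algebra.subset_adjoin ⟨j, rfl⟩⟩ : Algebra.adjoin ℂ (Set.range h))
    · refine ⟨(P j).map hh.aevalEquiv.toRingEquiv.toRingHom, ?_, ?_⟩
      · rw [Polynomial.map_ne_zero_iff hh.aevalEquiv.injective]
        exact hP j
      · have hcomp : (algebraMap (Algebra.adjoin ℂ (Set.range h)) D).comp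
            hh.aevalEquiv.toRingEquiv.toRingHom =
              (MvPolynomial.aeval h : _ →ₐ[ℂ] D).toRingHom :=
          RingHom.ext fun x => by exact hh.algebraMap_aevalEquiv x
        rw [Polynomial.aeval_def, Polynomial.eval₂_map, hcomp]
        exact hPy j
  have hdep : ¬ AlgebraicIndependent ℂ (fun o : Option (Fin n) => o.elim (h i) y) := by
    intro hind
    have hI : (AlgebraicIndependent.matroid ℂ D).Indep
        (Set.range (fun o : Option (Fin n) => o.elim (h i) y)) := by
      rw [AlgebraicIndependent.matroid_indep_iff]
      exact hind.coe_range
    have hsub : Set.range (fun o : Option (Fin n) => o.elim (h i) y) ⊆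
        (AlgebraicIndependent.matroid ℂ D).closure (Set.range h) := by
      rw [AlgebraicIndependent.matroid_closure_eq]
      rintro _ ⟨_ | j, rfl⟩
      · exact halg _ (Or.inl ⟨i, rfl⟩)
      · exact halg _ (Or.inr ⟨j, rfl⟩)
    have h1 := hI.encard_le_eRk_of_subset hsub
    rw [Matroid.eRk_closure_eq] at h1
    replace h1 := h1.trans (Matroid.eRk_le_encard _ _)
    rw [← Set.image_univ, ← Set.image_univ, hind.injective.encard_image,
      hh.injective.encard_image] at h1
    simp only [Set.encard_univ, ENat.card_eq_coe_fintype_card, Fintype.card_option,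
      Fintype.card_fin] at h1
    norm_cast at h1
    omega
  rw [algebraicIndependent_iff] at hdep
  push Not at hdep
  obtain ⟨q, hq, hq0⟩ := hdep
  refine ⟨MvPolynomial.optionEquivLeft ℂ (Fin n) q, by simpa using hq0, ?_⟩
  rw [← hq]
  let φ : Polynomial (MvPolynomial (Fin n) ℂ) →+* D :=
    Polynomial.eval₂RingHom (MvPolynomial.aeval y : _ →ₐ[ℂ] D).toRingHom (h i)
  have : φ.comp (MvPolynomial.optionEquivLeft ℂ (Fin n)).toRingEquiv.toRingHom =
      (MvPolynomial.aeval (fun o : Option (Fin n) => o.elim (h i) y) : _ →ₐ[ℂ] D).toRingHom := by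
    ext o
    · simp [φ]
    · cases o <;> simp [φ]
  exact congrArg (fun f => f q) this

/-- The algebra of complex differentiable functions on `B`. -/
def Subalgebra.differentiableOn {E : Type*} [NormedAddCommGroup E] [NormedSpace ℂ E]
    (B : Set E) : Subalgebra ℂ (B → ℂ) where
  carrier := {f | ∃ g : E → ℂ, DifferentiableOn ℂ g B ∧ f = fun x : B => g x}
  mul_mem' := by
    rintro _ _ ⟨g, hg, rfl⟩ ⟨g', hg', rfl⟩
    exact ⟨_, hg.mul hg', rfl⟩
  add_mem' := by
    rintro _ _ ⟨g, hg, rfl⟩ ⟨g', hg', rfl⟩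
    exact ⟨_, hg.add hg', rfl⟩
  algebraMap_mem' c := ⟨fun _ => c, differentiableOn_const c, rfl⟩

/-- Identity theorem on a convex open set, obtained by restricting to complex lines. -/
theorem DifferentiableOn.eqOn_zero_of_eventuallyEq {E : Type*} [NormedAddCommGroup E]
    [NormedSpace ℂ E] {B : Set E} (hB : IsOpen B) (hc : Convex ℝ B) {g : E → ℂ}
    (hg : DifferentiableOn ℂ g B) {x : E} (hx : x ∈ B) (h0 : ∀ᶠ z in 𝓝 x, g z = 0)
    {z : E} (hz : z ∈ B) : g z = 0 := by
  let L : ℂ → E := fun t => x + t • (z - x)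
  have hL : Differentiable ℂ L := by fun_prop
  have hLc : Convex ℝ (L ⁻¹' B) := by
    have : L ⁻¹' B = ((LinearMap.toSpanSingleton ℂ E (z - x)).restrictScalars ℝ) ⁻¹'
        ((fun w => x + w) ⁻¹' B) := rfl
    rw [this]
    exact (hc.translate_preimage_right x).linear_preimage _
  have hLo : IsOpen (L ⁻¹' B) := hB.preimage hL.continuous
  have han : AnalyticOnNhd ℂ (g ∘ L) (L ⁻¹' B) :=
    (hg.comp hL.differentiableOn (Set.mapsTo_preimage _ _)).analyticOnNhd hLo
  have hL0 : L 0 = x := by simp [L]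
  have hL1 : L 1 = z := by simp [L]
  have hev : g ∘ L =ᶠ[𝓝 0] 0 := by
    have : Tendsto L (𝓝 0) (𝓝 x) := by
      simpa [hL0] using hL.continuous.tendsto 0
    exact this.eventually h0
  have := han.eqOn_zero_of_preconnected_of_eventuallyEq_zero hLc.isPreconnected
    (by simpa [hL0] using hx) hev (by simpa [hL1] using hz : (1 : ℂ) ∈ L ⁻¹' B)
  simpa [hL1] using this

theorem Subalgebra.isDomain_differentiableOn {E : Type*} [NormedAddCommGroup E]
    [NormedSpace ℂ E] {B : Set E} (hB : IsOpen B) (hc : Convex ℝ B) (hne : B.Nonempty) :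
    IsDomain (Subalgebra.differentiableOn B) := by
  have : Nonempty B := hne.to_subtype
  have : NoZeroDivisors (Subalgebra.differentiableOn B) := by
    refine ⟨?_⟩
    rintro ⟨_, f, hf, rfl⟩ ⟨_, g, hg, rfl⟩ h
    rw [or_iff_not_imp_left]
    intro hf0
    have hfg : ∀ x ∈ B, f x * g x = 0 := fun x hx =>
      congrFun (congrArg Subtype.val h) (⟨x, hx⟩ : B)
    obtain ⟨x, hx, hfx⟩ : ∃ x ∈ B, f x ≠ 0 := by
      by_contra! hcon
      exact hf0 (Subtype.ext (funext fun x => hcon x x.2))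
    have hev : ∀ᶠ z in 𝓝 x, g z = 0 := by
      filter_upwards [hB.mem_nhds hx,
        ((hf.continuousOn.continuousAt (hB.mem_nhds hx)).eventually_ne hfx)] with z hz hz'
      exact (mul_eq_zero.1 (hfg z hz)).resolve_left hz'
    exact Subtype.ext (funext fun z => hg.eqOn_zero_of_eventuallyEq hB hc hx hev z.2)
  exact NoZeroDivisors.to_isDomain _

theorem AlgHom.apply_eval₂_aeval {n : ℕ} {D : Type*} [CommRing D] [Algebra ℂ D] (φ : D →ₐ[ℂ] ℂ)
    (h : Fin n → D) (z : D) (P : Polynomial (MvPolynomial (Fin n) ℂ)) :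
    φ (Polynomial.eval₂ (MvPolynomial.aeval h : _ →ₐ[ℂ] D).toRingHom z P) =
      Polynomial.eval₂ (MvPolynomial.eval fun j => φ (h j)) (φ z) P := by
  change (φ : D →+* ℂ) _ = _
  rw [Polynomial.hom_eval₂]
  congr 1
  ext j <;> simp

theorem MvPolynomial.eq_zero_of_eventually_eval_eq_zero {n : ℕ} {p : MvPolynomial (Fin n) ℂ}
    {x₀ : Fin n → ℂ} (h : ∀ᶠ x in 𝓝 x₀, MvPolynomial.eval x p = 0) : p = 0 := by
  obtain ⟨ε, hε, hb⟩ := Metric.eventually_nhds_iff_ball.1 h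
  refine MvPolynomial.funext_set (fun j => Metric.ball (x₀ j) ε) (fun j => ?_) fun x hx => ?_
  · exact infinite_of_mem_nhds (x₀ j) (Metric.ball_mem_nhds _ hε)
  · rw [map_zero]
    refine hb x ?_
    rwa [ball_pi _ hε]

/-- A holomorphic local inverse of a Nash mapping is a Nash mapping. -/
theorem NashFn.of_rightInverse {n : ℕ} {U₀ U₁ : Set (Fin n → ℂ)} (h₀ : IsOpen U₀)
    {F H : (Fin n → ℂ) → (Fin n → ℂ)} (hF : ∀ i, NashFn n U₁ (fun x => F x i))
    (hH : DifferentiableOn ℂ H U₀) (hmem : ∀ y ∈ U₀, H y ∈ U₁) (hFH : ∀ y ∈ U₀, F (H y) = y)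
    (hFc : ∀ y ∈ U₀, ContinuousAt F (H y)) (hHF : ∀ y ∈ U₀, ∀ᶠ x in 𝓝 (H y), H (F x) = x)
    (i : Fin n) :
    NashFn n U₀ (fun x => H x i) := by
  have hHi : ∀ j, DifferentiableOn ℂ (fun x => H x j) U₀ := differentiableOn_pi.1 hH
  refine ⟨hHi i, fun y₀ hy₀ => ?_⟩
  choose V hVo hV P hP hPV using fun j => (hF j).2 (H y₀) (hmem y₀ hy₀)
  have hHc : ContinuousAt H y₀ := hH.continuousOn.continuousAt (h₀.mem_nhds hy₀)
  have hev : ∀ᶠ y in 𝓝 y₀, y ∈ U₀ ∧ ∀ j, H y ∈ V j :=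
    (h₀.eventually_mem hy₀).and
      (eventually_all.2 fun j => hHc.eventually_mem ((hVo j).mem_nhds (hV j)))
  obtain ⟨ε, hε, hB⟩ := Metric.eventually_nhds_iff_ball.1 hev
  set B := Metric.ball y₀ ε
  have hBU : B ⊆ U₀ := fun y hy => (hB y hy).1
  have hdom := Subalgebra.isDomain_differentiableOn (Metric.isOpen_ball (x := y₀) (ε := ε))
    (convex_ball y₀ ε) (Metric.nonempty_ball.2 hε)
  let D := Subalgebra.differentiableOn B
  let ev : B → D →ₐ[ℂ] ℂ := fun b => (Pi.evalAlgHom ℂ (fun _ : B => ℂ) b).comp D.val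
  have hevext : ∀ d : D, (∀ b, ev b d = 0) → d = 0 := fun d hd => Subtype.ext (funext hd)
  let h : Fin n → D := fun j => ⟨fun b => H b j, _, (hHi j).mono hBU, rfl⟩
  let y : Fin n → D := fun j => ⟨fun b => b.1 j, _, differentiableOn_apply j B, rfl⟩
  have hevh : ∀ b : B, (fun j => ev b (h j)) = H b := fun b => rfl
  have hevy : ∀ b : B, (fun j => ev b (y j)) = b := fun b => rfl
  have hind : AlgebraicIndependent ℂ h := by
    rw [algebraicIndependent_iff]
    intro p hp
    refine MvPolynomial.eq_zero_of_eventually_eval_eq_zero (x₀ := H y₀) ?_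
    have hFB : ∀ᶠ x in 𝓝 (H y₀), F x ∈ B := (hFc y₀ hy₀).eventually_mem (by
      rw [hFH y₀ hy₀]; exact Metric.ball_mem_nhds _ hε)
    filter_upwards [hFB, hHF y₀ hy₀] with x hx hx'
    have h1 := congrArg (ev ⟨F x, hx⟩) hp
    rw [map_zero, MvPolynomial.comp_aeval_apply, hevh, MvPolynomial.aeval_eq_eval] at h1
    simpa [hx'] using h1
  have hPy : ∀ j,
      Polynomial.eval₂ (MvPolynomial.aeval h : _ →ₐ[ℂ] D).toRingHom (y j) (P j) = 0 := by
    refine fun j => hevext _ fun b => ?_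
    rw [AlgHom.apply_eval₂_aeval, hevh]
    have := hPV j (H b) ⟨(hB b b.2).2 j, hmem _ (hBU b.2)⟩
    beta_reduce at this
    rwa [hFH _ (hBU b.2)] at this
  obtain ⟨Q, hQ, hQ0⟩ := MvPolynomial.exists_ne_zero_eval₂_eq_zero hind hP hPy i
  refine ⟨B, Metric.isOpen_ball, Metric.mem_ball_self hε, Q, hQ, fun x hx => ?_⟩
  have := congrArg (ev ⟨x, hx.1⟩) hQ0
  rwa [AlgHom.apply_eval₂_aeval, hevy, map_zero] at this

theorem stmt_11 (n : ℕ) (U₀ U₁ : Set (Fin n → ℂ)) (h₀ : IsOpen U₀) (h₁ : IsOpen U₁)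
    (hcc : IsCompact (closure U₀)) (hsub : closure U₀ ⊆ U₁)
    (F : ℕ → (Fin n → ℂ) → (Fin n → ℂ))
    (hNash : ∀ ν i, NashFn n U₁ (fun x => F ν x i))
    (hconv : TendstoUniformlyOn F id atTop U₁) :
    ∀ᶠ ν in atTop, ∃ H : (Fin n → ℂ) → (Fin n → ℂ),
      (∀ i, NashFn n U₀ (fun x => H x i)) ∧
      (∀ x ∈ U₀, H x ∈ U₁) ∧
      ∀ x ∈ U₀, F ν (H x) = x := by
  obtain ⟨δ, hδ, hδU⟩ := hcc.exists_cthickening_subset_open h₁ hsub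
  have hr : 0 < δ / 4 := by positivity
  have hball : ∀ y ∈ U₀, Metric.closedBall y δ ⊆ U₁ := fun y hy =>
    (Metric.closedBall_subset_cthickening (subset_closure hy) δ).trans hδU
  have hball4 : ∀ y ∈ U₀, Metric.ball y (4 * (δ / 4)) ⊆ U₁ := fun y hy => by
    rw [mul_div_cancel₀ δ (by norm_num : (4 : ℝ) ≠ 0)]
    exact Metric.ball_subset_closedBall.trans (hball y hy)
  filter_upwards [Metric.tendstoUniformlyOn_iff.1 hconv (δ / 4 / 4) (by positivity)] with ν hν
  have hFd : DifferentiableOn ℂ (F ν) U₁ := differentiableOn_pi.2 fun i => (hNash ν i).1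
  obtain ⟨H, hH, hHr, hFH, hHF⟩ := exists_differentiableOn_rightInverse h₀ hr
    (fun y hy => hFd.mono (hball4 y hy)) (fun y hy x hx => by
      rw [← dist_eq_norm, dist_comm]
      exact hν x (hball4 y hy hx))
  have hmem : ∀ y ∈ U₀, H y ∈ U₁ := fun y hy =>
    hball y hy (Metric.closedBall_subset_closedBall (by linarith) (hHr y hy))
  exact ⟨H, NashFn.of_rightInverse h₀ (hNash ν) hH hmem hFH
    (fun y hy => hFd.continuousOn.continuousAt (h₁.mem_nhds (hmem y hy))) hHF, hmem, hFH⟩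
end
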